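/- Harnack-type comparability for the difference of nearby solutions (part of Proposition 5.1): there exist constants ε₁ ∈ (0,1) and C > 0 depending only on n such that the following holds. Let u₁, u₂ be classical solutions of the one-phase free boundary problem in the open unit ball B₁ satisfying (x_n − ε₁)⁺ ≤ u₁(x) ≤ u₂(x) ≤ (x_n + ε₁)⁺ for all x ∈ B₁, where x_n is the last coordinate. Then v := u₂ − u₁ satisfies v(x) ≤ C v(y) for all x, y ∈ B_{1/2} ∩ closure({u₁ > 0}). -/

import Mathlib

open MeasureTheory Metric Set Filter ENNReal NNReal

/-- The Euclidean Laplacian: the sum of the second partial derivatives. -/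
noncomputable def lap {n : ℕ} (u : EuclideanSpace ℝ (Fin n) → ℝ)
    (x : EuclideanSpace ℝ (Fin n)) : ℝ :=
  ∑ i : Fin n,
    fderiv ℝ (fun y => fderiv ℝ u y (EuclideanSpace.single i 1)) x (EuclideanSpace.single i 1)

/-- A classical solution of the one-phase free boundary problem in the open unit ball:
continuous and nonnegative on `B₁`, harmonic (smooth with vanishing Laplacian) on
`B₁ ∩ {u > 0}`, and the gradient extends continuously to `B₁ ∩ closure {u > 0}` with
norm `1` on the free boundary `B₁ ∩ ∂{u > 0}`. -/
def OnePhaseSolution {n : ℕ} (u : EuclideanSpace ℝ (Fin n) → ℝ) : Prop :=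
  ContinuousOn u (Metric.ball (0 : EuclideanSpace ℝ (Fin n)) 1) ∧
  (∀ x ∈ Metric.ball (0 : EuclideanSpace ℝ (Fin n)) 1, 0 ≤ u x) ∧
  ContDiffOn ℝ (⊤ : ℕ∞) u (Metric.ball (0 : EuclideanSpace ℝ (Fin n)) 1 ∩ {x | 0 < u x}) ∧
  (∀ x ∈ Metric.ball (0 : EuclideanSpace ℝ (Fin n)) 1 ∩ {x | 0 < u x}, lap u x = 0) ∧
  ∃ G : EuclideanSpace ℝ (Fin n) → EuclideanSpace ℝ (Fin n),
    ContinuousOn G (Metric.ball (0 : EuclideanSpace ℝ (Fin n)) 1 ∩ closure {x | 0 < u x}) ∧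
    (∀ x ∈ Metric.ball (0 : EuclideanSpace ℝ (Fin n)) 1 ∩ {x | 0 < u x}, G x = gradient u x) ∧
    (∀ x ∈ Metric.ball (0 : EuclideanSpace ℝ (Fin n)) 1 ∩ frontier {x | 0 < u x}, ‖G x‖ = 1)

open MeasureTheory Metric Set Filter ENNReal NNReal
open scoped Topology ContDiff RealInnerProductSpace

abbrev EE (n : ℕ) := EuclideanSpace ℝ (Fin n)

/-- smooth harmonic on an open set -/
def Hm {n : ℕ} (f : EE n → ℝ) (s : Set (EE n)) : Prop :=
  IsOpen s ∧ ContDiffOn ℝ (⊤ : ℕ∞) f s ∧ ∀ x ∈ s, lap f x = 0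

section calc1
variable {n : ℕ}

lemma Hm.mono {f : EE n → ℝ} {s t : Set (EE n)} (h : Hm f s) (ht : IsOpen t) (hts : t ⊆ s) :
    Hm f t := ⟨ht, h.2.1.mono hts, fun x hx => h.2.2 x (hts hx)⟩

lemma smooth_dir {f : EE n → ℝ} {s : Set (EE n)} (hs : IsOpen s)
    (h : ContDiffOn ℝ (⊤ : ℕ∞) f s) (v : EE n) :
    ContDiffOn ℝ (⊤ : ℕ∞) (fun y => fderiv ℝ f y v) s := by
  have : ContDiffOn ℝ (⊤ : ℕ∞) (fderiv ℝ f) s := h.fderiv_of_isOpen hs (by simp)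
  exact this.clm_apply contDiffOn_const

lemma smooth_diffAt {f : EE n → ℝ} {s : Set (EE n)} (hs : IsOpen s)
    (h : ContDiffOn ℝ (⊤ : ℕ∞) f s) {x : EE n} (hx : x ∈ s) : DifferentiableAt ℝ f x :=
  (h.contDiffAt (hs.mem_nhds hx)).differentiableAt (by simp)

lemma smooth_snd {f : EE n → ℝ} {s : Set (EE n)} (hs : IsOpen s)
    (h : ContDiffOn ℝ (⊤ : ℕ∞) f s) {x : EE n} (hx : x ∈ s) (v w : EE n) :
    fderiv ℝ (fun y => fderiv ℝ f y v) x w = fderiv ℝ (fderiv ℝ f) x w v := by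
  have h2 : ContDiffOn ℝ (⊤ : ℕ∞) (fderiv ℝ f) s := h.fderiv_of_isOpen hs (by simp)
  have h3 : DifferentiableAt ℝ (fderiv ℝ f) x :=
    (h2.contDiffAt (hs.mem_nhds hx)).differentiableAt (by simp)
  rw [fderiv_clm_apply h3 (differentiableAt_const v)]
  simp

lemma smooth_symm {f : EE n → ℝ} {s : Set (EE n)} (hs : IsOpen s)
    (h : ContDiffOn ℝ (⊤ : ℕ∞) f s) {x : EE n} (hx : x ∈ s) (v w : EE n) :
    fderiv ℝ (fun y => fderiv ℝ f y v) x w = fderiv ℝ (fun y => fderiv ℝ f y w) x v := by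
  rw [smooth_snd hs h hx, smooth_snd hs h hx]
  have := (h.contDiffAt (hs.mem_nhds hx)).isSymmSndFDerivAt (by simp; exact WithTop.coe_le_coe.2 le_top)
  exact this.eq w v

lemma Hm.dir {f : EE n → ℝ} {s : Set (EE n)} (h : Hm f s) (v : EE n) :
    Hm (fun y => fderiv ℝ f y v) s := by
  obtain ⟨hs, hf, hl⟩ := h
  refine ⟨hs, smooth_dir hs hf v, fun x hx => ?_⟩
  have key : ∀ i : Fin n, fderiv ℝ (fun y => fderiv ℝ (fun z => fderiv ℝ f z v) y
      (EuclideanSpace.single i 1)) x (EuclideanSpace.single i 1)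
      = fderiv ℝ (fun y => fderiv ℝ (fun z => fderiv ℝ f z (EuclideanSpace.single i 1)) y
      (EuclideanSpace.single i 1)) x v := by
    intro i
    have e1 : (fun y => fderiv ℝ (fun z => fderiv ℝ f z v) y (EuclideanSpace.single i 1))
      =ᶠ[𝓝 x] (fun y => fderiv ℝ (fun z => fderiv ℝ f z (EuclideanSpace.single i 1)) y v) := by
      filter_upwards [hs.mem_nhds hx] with y hy
      exact smooth_symm hs hf hy _ _
    rw [e1.fderiv_eq]
    exact smooth_symm hs (smooth_dir hs hf (EuclideanSpace.single i 1)) hx _ _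
  unfold lap
  rw [Finset.sum_congr rfl (fun i _ => key i)]
  have e2 : (fun y => lap f y) =ᶠ[𝓝 x] fun _ => 0 := by
    filter_upwards [hs.mem_nhds hx] with y hy using hl y hy
  have e3 : fderiv ℝ (fun y => lap f y) x v = 0 := by rw [e2.fderiv_eq]; simp
  rw [← e3]
  unfold lap
  rw [fderiv_fun_sum]
  · simp
  · intro i _
    exact smooth_diffAt hs (smooth_dir hs (smooth_dir hs hf _) _) hx

lemma lap_congr {f g : EE n → ℝ} {x : EE n} (h : f =ᶠ[𝓝 x] g) : lap f x = lap g x := by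
  unfold lap
  refine Finset.sum_congr rfl fun i _ => ?_
  have : (fun y => fderiv ℝ f y (EuclideanSpace.single i 1)) =ᶠ[𝓝 x]
     (fun y => fderiv ℝ g y (EuclideanSpace.single i 1)) := by
    filter_upwards [h.fderiv (𝕜 := ℝ)] with y hy
    rw [hy]
  rw [this.fderiv_eq]

lemma lap_basis {f : EE n → ℝ} {s : Set (EE n)} (hs : IsOpen s)
    (h : ContDiffOn ℝ (⊤ : ℕ∞) f s) {x : EE n} (hx : x ∈ s)
    (b : OrthonormalBasis (Fin n) ℝ (EE n)) :
    lap f x = ∑ i, fderiv ℝ (fun y => fderiv ℝ f y (b i)) x (b i) := by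
  have key : ∀ b : OrthonormalBasis (Fin n) ℝ (EE n),
     Laplacian.laplacian f x = ∑ i, fderiv ℝ (fun y => fderiv ℝ f y (b i)) x (b i) := by
    intro b
    rw [InnerProductSpace.laplacian_eq_iteratedFDeriv_orthonormalBasis f b]
    refine Finset.sum_congr rfl fun i _ => ?_
    rw [smooth_snd hs h hx]
    simp [iteratedFDeriv_two_apply]
  rw [← key b, key (EuclideanSpace.basisFun (Fin n) ℝ)]
  simp [lap]

lemma Hm.sub {f g : EE n → ℝ} {s : Set (EE n)} (hf : Hm f s) (hg : Hm g s) :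
    Hm (fun x => f x - g x) s := by
  refine ⟨hf.1, hf.2.1.sub hg.2.1, fun x hx => ?_⟩
  have hs := hf.1
  have : lap (fun x => f x - g x) x = lap f x - lap g x := by
    unfold lap
    rw [← Finset.sum_sub_distrib]
    refine Finset.sum_congr rfl fun i _ => ?_
    have e1 : (fun y => fderiv ℝ (fun x => f x - g x) y (EuclideanSpace.single i 1)) =ᶠ[𝓝 x]
      (fun y => fderiv ℝ f y (EuclideanSpace.single i 1) -
        fderiv ℝ g y (EuclideanSpace.single i 1)) := by
      filter_upwards [hs.mem_nhds hx] with y hy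
      rw [fderiv_fun_sub (smooth_diffAt hs hf.2.1 hy) (smooth_diffAt hs hg.2.1 hy)]
      simp
    rw [e1.fderiv_eq, fderiv_fun_sub (smooth_diffAt hs (smooth_dir hs hf.2.1 _) hx)
      (smooth_diffAt hs (smooth_dir hs hg.2.1 _) hx)]
    simp
  rw [this, hf.2.2 x hx, hg.2.2 x hx, sub_zero]

lemma Hm.const (c : ℝ) {s : Set (EE n)} (hs : IsOpen s) : Hm (fun _ => c) s := by
  refine ⟨hs, contDiffOn_const, fun x _ => ?_⟩
  simp [lap]

lemma Hm.neg {f : EE n → ℝ} {s : Set (EE n)} (hf : Hm f s) : Hm (fun x => - f x) s := by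
  simpa using (Hm.const 0 hf.1).sub hf

lemma Hm.add {f g : EE n → ℝ} {s : Set (EE n)} (hf : Hm f s) (hg : Hm g s) :
    Hm (fun x => f x + g x) s := by
  simpa using hf.sub hg.neg

lemma Hm.inner (v : EE n) {s : Set (EE n)} (hs : IsOpen s) : Hm (fun x => ⟪v, x⟫) s := by
  refine ⟨hs, (contDiff_const.inner ℝ contDiff_id).contDiffOn, fun x _ => ?_⟩
  have : ∀ y, fderiv ℝ (fun x : EE n => ⟪v, x⟫) y = innerSL ℝ v := by
    intro y
    exact (innerSL ℝ v).hasFDerivAt.fderiv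
  simp [lap, this]

lemma Hm.translate {f : EE n → ℝ} {s : Set (EE n)} (hf : Hm f s) (v : EE n) :
    Hm (fun x => f (x + v)) {x | x + v ∈ s} := by
  refine ⟨hf.1.preimage (by fun_prop), ?_, fun x hx => ?_⟩
  · exact hf.2.1.comp (by fun_prop) (fun x hx => hx)
  · have := hf.2.2 (x + v) hx
    rw [← this]
    unfold lap
    refine Finset.sum_congr rfl fun i _ => ?_
    have : ∀ y, fderiv ℝ (fun x => f (x + v)) y = fderiv ℝ f (y + v) := by
      intro y; rw [fderiv_comp_add_right]
    simp_rw [this]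
    rw [fderiv_comp_add_right (f := fun y => fderiv ℝ f y (EuclideanSpace.single i 1))]

end calc1

open MeasureTheory Metric Set Filter ENNReal NNReal
open scoped Topology ContDiff RealInnerProductSpace

section mvp
variable {n : ℕ}

lemma hasDerivAt_maxpow (m : ℕ) (s : ℝ) :
    HasDerivAt (fun s : ℝ => (max s 0) ^ (m + 2)) ((m + 2 : ℝ) * (max s 0) ^ (m + 1)) s := by
  rcases lt_trichotomy s 0 with h | h | h
  · rw [max_eq_right h.le]
    have : (fun s : ℝ => (max s 0) ^ (m + 2)) =ᶠ[𝓝 s] fun _ => 0 := by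
      filter_upwards [gt_mem_nhds h] with t ht
      simp [max_eq_right (le_of_lt ht)]
    simpa using (hasDerivAt_const s (0 : ℝ)).congr_of_eventuallyEq this
  · subst h
    simp only [max_self, ne_eq, Nat.add_eq_zero_iff, one_ne_zero, and_false, not_false_eq_true,
      zero_pow, mul_zero]
    rw [hasDerivAt_iff_isLittleO]
    simp only [max_self, ne_eq, Nat.add_eq_zero_iff, OfNat.ofNat_ne_zero, and_false,
      not_false_eq_true, zero_pow, sub_zero, smul_eq_mul, mul_zero]
    refine (Asymptotics.IsBigO.of_bound 1 ?_).trans_isLittleO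
      (Asymptotics.isLittleO_pow_id (𝕜 := ℝ) (n := m + 2) (by omega))
    filter_upwards with x
    simp only [norm_pow, one_mul]
    gcongr
    rw [Real.norm_eq_abs, Real.norm_eq_abs, abs_of_nonneg (le_max_right _ _)]
    exact max_le (le_abs_self _) (abs_nonneg _)
  · rw [max_eq_left h.le]
    have : (fun s : ℝ => (max s 0) ^ (m + 2)) =ᶠ[𝓝 s] fun s => s ^ (m + 2) := by
      filter_upwards [lt_mem_nhds h] with t ht
      simp [max_eq_left (le_of_lt ht)]
    have h2 := (hasDerivAt_pow (m + 2) s).congr_of_eventuallyEq this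
    simpa using h2

/-- kernel -/
noncomputable def kr (w : EE n) : ℝ := (max (1 - ‖w‖ ^ 2) 0) ^ 3
noncomputable def Kr (w : EE n) : ℝ := - (1 / 8) * (max (1 - ‖w‖ ^ 2) 0) ^ 4

lemma kr_continuous : Continuous (kr : EE n → ℝ) := by unfold kr; fun_prop
lemma Kr_continuous : Continuous (Kr : EE n → ℝ) := by unfold Kr; fun_prop

lemma kr_nonneg (w : EE n) : 0 ≤ kr w := by unfold kr; positivity
lemma kr_le_one (w : EE n) : kr w ≤ 1 := by
  unfold kr
  refine pow_le_one₀ (le_max_right _ _) (max_le ?_ zero_le_one)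
  nlinarith [sq_nonneg ‖w‖]

lemma kr_zero {w : EE n} (h : 1 ≤ ‖w‖) : kr w = 0 := by
  unfold kr
  rw [max_eq_right (by nlinarith)]; simp
lemma Kr_zero {w : EE n} (h : 1 ≤ ‖w‖) : Kr w = 0 := by
  unfold Kr
  rw [max_eq_right (by nlinarith)]; simp

lemma kr_lower {w : EE n} (h : ‖w‖ ≤ 3 / 4) : (7 / 16 : ℝ) ^ 3 ≤ kr w := by
  unfold kr
  have : (7 / 16 : ℝ) ≤ max (1 - ‖w‖ ^ 2) 0 := le_max_of_le_left (by nlinarith [norm_nonneg w])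
  gcongr

lemma kr_compact : HasCompactSupport (kr : EE n → ℝ) := by
  refine HasCompactSupport.intro (isCompact_closedBall 0 1) fun x hx => ?_
  apply kr_zero
  simp at hx
  exact hx.le

lemma Kr_compact : HasCompactSupport (Kr : EE n → ℝ) := by
  refine HasCompactSupport.intro (isCompact_closedBall 0 1) fun x hx => ?_
  apply Kr_zero
  simp at hx
  exact hx.le

lemma kr_integrable : Integrable (kr : EE n → ℝ) :=
  kr_continuous.integrable_of_hasCompactSupport kr_compact

lemma kr_integral_pos : 0 < ∫ w : EE n, kr w := by
  refine (integral_pos_iff_support_of_nonneg kr_nonneg kr_integrable).2 ?_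
  have : ball (0 : EE n) (3 / 4) ⊆ Function.support kr := by
    intro w hw
    simp at hw
    have := kr_lower hw.le
    simp only [Function.mem_support]
    intro h; rw [h] at this; norm_num at this
  exact lt_of_lt_of_le (measure_ball_pos _ _ (by norm_num)) (measure_mono this)

lemma Kr_hasFDerivAt (w : EE n) : HasFDerivAt Kr (kr w • innerSL ℝ w) w := by
  have h1 : HasFDerivAt (fun w : EE n => 1 - ‖w‖ ^ 2) (-(2 • innerSL ℝ w)) w := by
    have := (hasStrictFDerivAt_norm_sq w).hasFDerivAt
    have h := this.const_sub (1 : ℝ)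
    exact h
  have h2 := ((hasDerivAt_maxpow 2 (1 - ‖w‖ ^ 2)).comp_hasFDerivAt w h1).const_mul (-(1 / 8 : ℝ))
  refine h2.congr_fderiv ?_
  ext v
  simp [kr]
  ring

lemma kr_hasFDerivAt (w : EE n) :
    HasFDerivAt kr ((-6 * (max (1 - ‖w‖ ^ 2) 0) ^ 2) • innerSL ℝ w) w := by
  have h1 : HasFDerivAt (fun w : EE n => 1 - ‖w‖ ^ 2) (-(2 • innerSL ℝ w)) w := by
    have := (hasStrictFDerivAt_norm_sq w).hasFDerivAt
    have h := this.const_sub (1 : ℝ)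
    exact h
  have h2 := ((hasDerivAt_maxpow 1 (1 - ‖w‖ ^ 2)).comp_hasFDerivAt w h1)
  refine h2.congr_fderiv ?_
  ext v
  simp
  ring

/-- cutoff extension -/
lemma cutoff {f : EE n → ℝ} {y : EE n} {ρ r : ℝ} (h0 : 0 < ρ) (hr : ρ < r)
    (hf : ContDiffOn ℝ (⊤ : ℕ∞) f (ball y r)) :
    ∃ g : EE n → ℝ, ContDiff ℝ (⊤ : ℕ∞) g ∧ HasCompactSupport g ∧
      ∀ x ∈ closedBall y ρ, g x = f x := by
  let b : ContDiffBump y := ⟨ρ, (ρ + r) / 2, h0, by linarith⟩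
  refine ⟨fun x => b x * f x, ?_, ?_, ?_⟩
  · rw [contDiff_iff_contDiffAt]
    intro x
    by_cases hx : x ∈ ball y r
    · exact (b.contDiff.contDiffAt).mul (hf.contDiffAt (isOpen_ball.mem_nhds hx))
    · have : x ∉ tsupport b := by
        rw [b.tsupport_eq]
        simp only [mem_ball, not_lt, mem_closedBall, not_le] at hx ⊢
        show (ρ + r) / 2 < _
        linarith
      have h2 := notMem_tsupport_iff_eventuallyEq.1 this
      have h3 : (fun x => b x * f x) =ᶠ[𝓝 x] fun _ => 0 := by
        filter_upwards [h2] with z hz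
        simp [hz]
      exact contDiffAt_const.congr_of_eventuallyEq h3
  · exact b.hasCompactSupport.mul_right
  · intro x hx
    simp [b.one_of_mem_closedBall hx]

lemma ibp_ker {g : EE n → ℝ} (hg : ContDiff ℝ (⊤ : ℕ∞) g) (y : EE n) (ρ : ℝ) (v : EE n)
    {K : EE n → ℝ} {K' : EE n → EE n →L[ℝ] ℝ} (hK : ∀ w, HasFDerivAt K (K' w) w)
    (hKc : HasCompactSupport K) (hK'c : Continuous K') :
    ∫ w, g (y + ρ • w) * K' w v = - ∫ w, ρ * fderiv ℝ g (y + ρ • w) v * K w := by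
  have hKcont : Continuous K := continuous_iff_continuousAt.2 fun w => (hK w).continuousAt
  have hKd : ∀ w, fderiv ℝ K w = K' w := fun w => (hK w).fderiv
  have hd : ∀ w, HasFDerivAt (fun w => g (y + ρ • w)) (ρ • fderiv ℝ g (y + ρ • w)) w := by
    intro w
    have h1 : HasFDerivAt (fun w : EE n => y + ρ • w) (ρ • ContinuousLinearMap.id ℝ (EE n)) w :=
      ((hasFDerivAt_id w).const_smul ρ).const_add y
    have h2 := ((hg.differentiable (by simp)) (y + ρ • w)).hasFDerivAt.comp w h1
    refine h2.congr_fderiv ?_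
    ext z
    simp
  have hgf : Continuous (fderiv ℝ g) := hg.continuous_fderiv (by simp)
  have := integral_mul_fderiv_eq_neg_fderiv_mul_of_integrable (μ := (volume : Measure (EE n)))
    (f := fun w => g (y + ρ • w)) (g := K) (v := v) ?_ ?_ ?_
    (fun x _ => (hd x).differentiableAt) (fun x _ => (hK x).differentiableAt)
  · simp_rw [hKd] at this
    rw [this]
    congr 2
    ext w
    rw [(hd w).fderiv]
    simp
  · simp_rw [fun w => (hd w).fderiv]
    refine Continuous.integrable_of_hasCompactSupport ?_ hKc.mul_left
    simp only [smul_apply]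
    fun_prop
  · refine Continuous.integrable_of_hasCompactSupport ?_ ?_
    · simp_rw [hKd]; have := hg.continuous; fun_prop
    · exact (hKc.fderiv_apply (𝕜 := ℝ) v).mul_left
  · refine Continuous.integrable_of_hasCompactSupport ?_ hKc.mul_left
    have := hg.continuous; fun_prop

lemma lap_eq_of_ball {f g : EE n → ℝ} {y : EE n} {ρ : ℝ}
    (hfg : ∀ x ∈ closedBall y ρ, g x = f x) {x : EE n} (hx : x ∈ ball y ρ) :
    lap g x = lap f x := by
  apply lap_congr
  filter_upwards [isOpen_ball.mem_nhds hx] with z hz using hfg z (ball_subset_closedBall hz)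

lemma mvp {f : EE n → ℝ} {y : EE n} {ρ r : ℝ} (h0 : 0 < ρ) (hr : ρ < r)
    (hf : Hm f (ball y r)) :
    f y * ∫ w : EE n, kr w = ∫ w, f (y + ρ • w) * kr w := by
  obtain ⟨g, hg, hgc, hgf⟩ := cutoff h0 hr hf.2.1
  have hgc1 : Continuous (fderiv ℝ g) := hg.continuous_fderiv (by simp)
  have hgl : ∀ x ∈ ball y ρ, lap g x = 0 := fun x hx => by
    rw [lap_eq_of_ball hgf hx]
    exact hf.2.2 x (ball_subset_ball hr.le hx)
  obtain ⟨Bd, hBd⟩ : ∃ Bd, ∀ x, ‖fderiv ℝ g x‖ ≤ Bd :=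
    hgc1.bounded_above_of_compact_support (hgc.fderiv (𝕜 := ℝ))
  set F : ℝ → ℝ := fun t => ∫ w, g (y + t • w) * kr w with hF
  have hder : ∀ t, HasDerivAt F (∫ w, fderiv ℝ g (y + t • w) w * kr w) t := by
    intro t
    refine (hasDerivAt_integral_of_dominated_loc_of_deriv_le (bound := fun w => Bd * kr w)
      (F' := fun t w => fderiv ℝ g (y + t • w) w * kr w)
      (s := univ) univ_mem ?_ ?_ ?_ ?_ ?_ ?_).2
    · refine Eventually.of_forall fun s => Continuous.aestronglyMeasurable ?_
      have := hg.continuous; have := kr_continuous (n := n); fun_prop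
    · refine Continuous.integrable_of_hasCompactSupport ?_ kr_compact.mul_left
      have := hg.continuous; have := kr_continuous (n := n); fun_prop
    · refine Continuous.aestronglyMeasurable ?_
      have := kr_continuous (n := n); fun_prop
    · refine Eventually.of_forall fun w s _ => ?_
      rw [norm_mul, Real.norm_eq_abs (kr w), abs_of_nonneg (kr_nonneg w)]
      rcases le_total 1 ‖w‖ with h | h
      · simp [kr_zero h]
      · refine mul_le_mul_of_nonneg_right ?_ (kr_nonneg w)
        calc _ ≤ ‖fderiv ℝ g (y + s • w)‖ * ‖w‖ := ContinuousLinearMap.le_opNorm _ _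
          _ ≤ Bd * 1 := mul_le_mul (hBd _) h (norm_nonneg _) ((norm_nonneg _).trans (hBd y))
          _ = Bd := mul_one _
    · exact kr_integrable.const_mul _
    · refine Eventually.of_forall fun w s _ => ?_
      refine HasDerivAt.mul_const ?_ _
      have h1 : HasDerivAt (fun s : ℝ => y + s • w) w s := by
        simpa using ((hasDerivAt_id s).smul_const w).const_add y
      exact ((hg.differentiable (by simp)) (y + s • w)).hasFDerivAt.comp_hasDerivAt s h1
  have hzero : ∀ t, 0 ≤ t → t ≤ ρ → ∫ w, fderiv ℝ g (y + t • w) w * kr w = 0 := by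
    intro t ht0 ht
    have e1 : ∀ w : EE n, fderiv ℝ g (y + t • w) w * kr w =
        ∑ i : Fin n, fderiv ℝ g (y + t • w) (EuclideanSpace.single i 1) *
          (kr w • innerSL ℝ w) (EuclideanSpace.single i 1) := by
      intro w
      have hw : w = ∑ i, (w i) • (EuclideanSpace.single i (1 : ℝ) : EE n) := by
        have := (EuclideanSpace.basisFun (Fin n) ℝ).sum_repr w
        simpa using this.symm
      conv_lhs => rw [show fderiv ℝ g (y + t • w) w = fderiv ℝ g (y + t • w)
        (∑ i, (w i) • (EuclideanSpace.single i (1 : ℝ) : EE n)) by rw [← hw]]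
      rw [map_sum, Finset.sum_mul]
      refine Finset.sum_congr rfl fun i _ => ?_
      simp [EuclideanSpace.inner_single_right]
      ring
    have hgi : ∀ i : Fin n, ContDiff ℝ (⊤ : ℕ∞)
        (fun x => fderiv ℝ g x (EuclideanSpace.single i 1)) := by
      intro i
      exact (hg.fderiv_right (by simp)).clm_apply contDiff_const
    have hc2 : Continuous (fun w : EE n => kr w • innerSL ℝ w) :=
      kr_continuous.smul (innerSL ℝ).continuous
    have hIntg : ∀ i : Fin n, Integrable (fun w => fderiv ℝ g (y + t • w)
       (EuclideanSpace.single i 1) * (kr w • innerSL ℝ w) (EuclideanSpace.single i 1)) := by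
      intro i
      refine Continuous.integrable_of_hasCompactSupport ?_ ?_
      · fun_prop
      · refine HasCompactSupport.mul_left ?_
        simp only [smul_apply, smul_eq_mul]
        exact kr_compact.mul_right
    simp_rw [e1]
    rw [integral_finsetSum _ (fun i _ => hIntg i)]
    have e2 : ∀ i : Fin n, ∫ w, fderiv ℝ g (y + t • w)
       (EuclideanSpace.single i 1) * (kr w • innerSL ℝ w) (EuclideanSpace.single i 1)
       = - ∫ w, t * fderiv ℝ (fun x => fderiv ℝ g x (EuclideanSpace.single i 1))
          (y + t • w) (EuclideanSpace.single i 1) * Kr w := fun i =>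
      ibp_ker (hgi i) y t (EuclideanSpace.single i 1) Kr_hasFDerivAt Kr_compact hc2
    rw [Finset.sum_congr rfl fun i _ => e2 i, Finset.sum_neg_distrib, ← integral_finsetSum]
    · rw [neg_eq_zero]
      rw [← integral_zero (EE n) ℝ]
      congr 1
      ext w
      rw [← Finset.sum_mul, ← Finset.mul_sum]
      change t * lap g (y + t • w) * Kr w = 0
      rcases le_or_gt 1 ‖w‖ with h | h
      · simp [Kr_zero h]
      · rcases ht0.eq_or_lt with h' | h'
        · simp [← h']
        rw [hgl]
        · simp
        · simp [norm_smul, abs_of_pos h']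
          nlinarith
    · intro i _
      refine Continuous.integrable_of_hasCompactSupport ?_ Kr_compact.mul_left
      have := (hgi i).continuous_fderiv (by simp)
      have := Kr_continuous (n := n)
      fun_prop
  have hconst : F ρ = F 0 := by
    have := constant_of_has_deriv_right_zero (f := F) (a := 0) (b := ρ)
      (fun t _ => (hder t).continuousAt.continuousWithinAt)
      (fun t ht => by
        have := hder t
        rw [hzero t ht.1 ht.2.le] at this
        exact this.hasDerivWithinAt)
    exact this ρ ⟨h0.le, le_rfl⟩
  have hF0 : F 0 = f y * ∫ w : EE n, kr w := by
    simp only [hF, zero_smul, add_zero]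
    rw [integral_const_mul, hgf y (mem_closedBall_self h0.le)]
  have hFρ : F ρ = ∫ w, f (y + ρ • w) * kr w := by
    simp only [hF]
    congr 1
    ext w
    rcases le_or_gt 1 ‖w‖ with h | h
    · simp [kr_zero h]
    · rw [hgf]
      simp [norm_smul, abs_of_pos h0]
      nlinarith
  rw [← hF0, ← hFρ, hconst]

end mvp

open MeasureTheory Metric Set Filter ENNReal NNReal
open scoped Topology ContDiff RealInnerProductSpace

section harnack
variable {n : ℕ}

lemma kr_change (g : EE n → ℝ) (y : EE n) {ρ : ℝ} (hρ : 0 < ρ) :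
    ∫ w, g (y + ρ • w) * kr w = (ρ ^ n)⁻¹ * ∫ z, g z * kr (ρ⁻¹ • (z - y)) := by
  have h1 := Measure.integral_comp_smul (volume : Measure (EE n))
    (fun z => g (y + z) * kr (ρ⁻¹ • z)) ρ
  simp only [inv_smul_smul₀ hρ.ne', finrank_euclideanSpace, Fintype.card_fin, smul_eq_mul] at h1
  rw [h1, abs_of_pos (by positivity)]
  congr 1
  rw [← integral_add_left_eq_self (fun z => g z * kr (ρ⁻¹ • (z - y))) y]
  simp

/-- Harnack constant -/
noncomputable def CH (n : ℕ) : ℝ := 12 * (9 / 4) ^ n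

lemma CH_ge : 12 ≤ CH n := by
  unfold CH
  have : (1 : ℝ) ≤ (9 / 4) ^ n := one_le_pow₀ (by norm_num)
  linarith

lemma harnack1 {f : EE n → ℝ} {y y' : EE n} {R : ℝ} (hf : Hm f (ball y' R))
    (hpos : ∀ z ∈ ball y' R, 0 ≤ f z) (hR : 0 < R) (hy : ‖y - y'‖ ≤ R / 4) :
    f y ≤ CH n * f y' := by
  set ρ := (2 / 5) * R with hρ
  set ρ' := (9 / 10) * R with hρ'
  have hρ0 : 0 < ρ := by positivity
  have hρ'0 : 0 < ρ' := by positivity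
  have m1 := mvp hρ0 (r := 3 / 4 * R) (by linarith)
    (hf.mono isOpen_ball (fun z hz => by
      rw [mem_ball, dist_eq_norm] at *
      have : z - y' = (z - y) + (y - y') := by abel
      rw [this]
      linarith [norm_add_le (z - y) (y - y')]) : Hm f (ball y (3 / 4 * R)))
  have m2 := mvp hρ'0 (by linarith) hf
  rw [kr_change f y hρ0] at m1
  rw [kr_change f y' hρ'0] at m2
  have hIntg : Integrable (fun z => f z * kr (ρ'⁻¹ • (z - y'))) := by
    rw [← integrableOn_iff_integrable_of_support_subset (s := closedBall y' ρ')]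
    · refine ContinuousOn.integrableOn_compact (isCompact_closedBall _ _) ?_
      refine ContinuousOn.mul ?_ ?_
      · refine hf.2.1.continuousOn.mono (closedBall_subset_ball (by linarith))
      · exact (kr_continuous.comp (by fun_prop)).continuousOn
    · intro z hz
      by_contra hcon
      apply hz
      simp only
      rw [kr_zero, mul_zero]
      rw [mem_closedBall, dist_eq_norm, not_le] at hcon
      rw [norm_smul, norm_inv, Real.norm_eq_abs, abs_of_pos hρ'0]
      rw [inv_mul_eq_div, le_div_iff₀ hρ'0]; linarith
  have hcomp : ∀ z, f z * kr (ρ⁻¹ • (z - y)) ≤ 12 * (f z * kr (ρ'⁻¹ • (z - y'))) ∧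
      0 ≤ f z * kr (ρ⁻¹ • (z - y)) := by
    intro z
    have hn1 : ‖ρ⁻¹ • (z - y)‖ = ‖z - y‖ / ρ := by
      rw [norm_smul, norm_inv, Real.norm_eq_abs, abs_of_pos hρ0]; ring
    have hn2 : ‖ρ'⁻¹ • (z - y')‖ = ‖z - y'‖ / ρ' := by
      rw [norm_smul, norm_inv, Real.norm_eq_abs, abs_of_pos hρ'0]; ring
    rcases le_or_gt ρ ‖z - y‖ with h | h
    · rw [kr_zero (w := ρ⁻¹ • (z - y)) (by rw [hn1, le_div_iff₀ hρ0]; linarith)]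
      simp only [mul_zero, le_refl, and_true]
      by_cases hz : z ∈ ball y' R
      · have := hpos z hz; have := kr_nonneg (ρ'⁻¹ • (z - y')); positivity
      · rw [kr_zero (w := ρ'⁻¹ • (z - y'))]
        · simp
        · rw [mem_ball, dist_eq_norm, not_lt] at hz
          rw [hn2, le_div_iff₀ hρ'0]; linarith
    · have h2 : ‖z - y'‖ ≤ 3 / 4 * ρ' := by
        have : z - y' = (z - y) + (y - y') := by abel
        rw [this]
        linarith [norm_add_le (z - y) (y - y')]
      have hz : z ∈ ball y' R := by rw [mem_ball, dist_eq_norm]; linarith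
      have k1 := kr_lower (w := ρ'⁻¹ • (z - y')) (by rw [hn2, div_le_iff₀ hρ'0]; linarith)
      have k2 := kr_le_one (ρ⁻¹ • (z - y))
      have k3 := kr_nonneg (ρ⁻¹ • (z - y))
      have k4 := hpos z hz
      refine ⟨?_, by positivity⟩
      have : kr (ρ⁻¹ • (z - y)) ≤ 12 * kr (ρ'⁻¹ • (z - y')) := by
        norm_num at k1; linarith
      nlinarith
  have hle : ∫ z, f z * kr (ρ⁻¹ • (z - y)) ≤ 12 * ∫ z, f z * kr (ρ'⁻¹ • (z - y')) := by
    rw [← integral_const_mul]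
    exact integral_mono_of_nonneg (Eventually.of_forall fun z => (hcomp z).2)
      (hIntg.const_mul 12) (Eventually.of_forall fun z => (hcomp z).1)
  have hk := kr_integral_pos (n := n)
  have hfin : f y * ∫ w : EE n, kr w ≤ (CH n * f y') * ∫ w : EE n, kr w := by
    rw [m1, mul_assoc, m2]
    unfold CH
    have e : (ρ ^ n)⁻¹ = (9 / 4) ^ n * (ρ' ^ n)⁻¹ := by
      have : ρ' = 9 / 4 * ρ := by rw [hρ, hρ']; ring
      rw [this, mul_pow (9 / 4) ρ, mul_inv, ← mul_assoc, mul_inv_cancel₀ (by positivity), one_mul]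
    rw [e]
    have h4 : 0 ≤ (9 / 4 : ℝ) ^ n * (ρ' ^ n)⁻¹ := by positivity
    calc _ ≤ (9 / 4 : ℝ) ^ n * (ρ' ^ n)⁻¹ * (12 * ∫ z, f z * kr (ρ'⁻¹ • (z - y'))) :=
          mul_le_mul_of_nonneg_left hle h4
      _ = _ := by ring
  exact le_of_mul_le_mul_right hfin hk

lemma harnack2 {f : EE n → ℝ} {y y' : EE n} {R : ℝ} (hf : Hm f (ball y' R))
    (hpos : ∀ z ∈ ball y' R, 0 ≤ f z) (hR : 0 < R) (hy : ‖y - y'‖ ≤ R / 8) :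
    f y' ≤ CH n * f y := by
  have hsub : ball y (7 / 8 * R) ⊆ ball y' R := by
    intro z hz
    rw [mem_ball, dist_eq_norm] at *
    have : z - y' = (z - y) + (y - y') := by abel
    rw [this]
    linarith [norm_add_le (z - y) (y - y')]
  refine harnack1 (R := 7 / 8 * R) (hf.mono isOpen_ball hsub) (fun z hz => hpos z (hsub hz))
    (by positivity) ?_
  rw [norm_sub_rev]; linarith

/-- gradient constant -/
noncomputable def CG0 (n : ℕ) : ℝ :=
  12 * (volume (closedBall (0 : EE n) 1)).toReal / ∫ w : EE n, kr w

lemma CG0_nonneg : 0 ≤ CG0 n := by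
  unfold CG0
  have := kr_integral_pos (n := n)
  positivity

lemma grad0 {f : EE n → ℝ} {x : EE n} {r m : ℝ} (hf : Hm f (ball x r))
    (hm : ∀ z ∈ ball x r, |f z| ≤ m) (hr : 0 < r) (v : EE n) :
    |fderiv ℝ f x v| ≤ CG0 n * m * ‖v‖ / r := by
  set ρ := r / 2 with hρ
  have hρ0 : 0 < ρ := by positivity
  have hm0 : 0 ≤ m := (abs_nonneg _).trans (hm x (mem_ball_self hr))
  obtain ⟨g, hg, hgc, hgf⟩ := cutoff hρ0 (show ρ < r by linarith) hf.2.1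
  have m1 := mvp hρ0 (show ρ < r by linarith) (hf.dir v)
  have e1 : ∫ w, fderiv ℝ f (x + ρ • w) v * kr w = ∫ w, fderiv ℝ g (x + ρ • w) v * kr w := by
    congr 1
    ext w
    rcases le_or_gt 1 ‖w‖ with h | h
    · simp [kr_zero h]
    · have hx : x + ρ • w ∈ ball x ρ := by
        simp [norm_smul, abs_of_pos hρ0]
        nlinarith
      have : g =ᶠ[𝓝 (x + ρ • w)] f := by
        filter_upwards [isOpen_ball.mem_nhds hx] with z hz using hgf z (ball_subset_closedBall hz)
      rw [this.fderiv_eq]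
  have hc : Continuous (fun w : EE n => (-6 * (max (1 - ‖w‖ ^ 2) 0) ^ 2) • innerSL ℝ w) :=
    Continuous.smul (f := fun w : EE n => (-6 * (max (1 - ‖w‖ ^ 2) 0) ^ 2)) (by fun_prop)
      (innerSL ℝ).continuous
  have ib := ibp_ker hg x ρ v kr_hasFDerivAt kr_compact hc
  have e2 : ∫ w, ρ * fderiv ℝ g (x + ρ • w) v * kr w
      = ρ * ∫ w, fderiv ℝ g (x + ρ • w) v * kr w := by
    rw [← integral_const_mul]; congr 1; ext w; ring
  rw [e2] at ib
  have bd : ‖∫ w, g (x + ρ • w) * ((-6 * (max (1 - ‖w‖ ^ 2) 0) ^ 2) • innerSL ℝ w) v‖ ≤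
      (6 * m * ‖v‖) * (volume (closedBall (0 : EE n) 1)).toReal := by
    have e3 : ∫ w, g (x + ρ • w) * ((-6 * (max (1 - ‖w‖ ^ 2) 0) ^ 2) • innerSL ℝ w) v =
       ∫ w in closedBall (0 : EE n) 1,
         g (x + ρ • w) * ((-6 * (max (1 - ‖w‖ ^ 2) 0) ^ 2) • innerSL ℝ w) v := by
      symm
      apply setIntegral_eq_integral_of_forall_compl_eq_zero
      intro w hw
      simp only [mem_closedBall, dist_zero_right, not_le] at hw
      have : max (1 - ‖w‖ ^ 2) 0 = 0 := max_eq_right (by nlinarith)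
      simp [this]
    rw [e3]
    refine norm_setIntegral_le_of_norm_le_const measure_closedBall_lt_top ?_
    intro w hw
    simp only [mem_closedBall, dist_zero_right] at hw
    have hx : x + ρ • w ∈ closedBall x ρ := by
      simp [norm_smul, abs_of_pos hρ0]
      nlinarith
    rw [hgf _ hx, norm_mul, Real.norm_eq_abs]
    have h1 := hm (x + ρ • w) (closedBall_subset_ball (by linarith) hx)
    have h2 : ‖((-6 * (max (1 - ‖w‖ ^ 2) 0) ^ 2) • innerSL ℝ w) v‖ ≤ 6 * ‖v‖ := by
      simp only [smul_apply, innerSL_apply_apply, norm_smul, norm_mul, norm_neg]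
      have a1 : ‖(max (1 - ‖w‖ ^ 2) 0) ^ 2‖ ≤ 1 := by
        rw [norm_pow, Real.norm_eq_abs, abs_of_nonneg (le_max_right _ _)]
        refine pow_le_one₀ (le_max_right _ _) (max_le ?_ zero_le_one)
        nlinarith [sq_nonneg ‖w‖]
      have a2 : ‖⟪w, v⟫‖ ≤ ‖v‖ := by
        refine (norm_inner_le_norm w v).trans ?_
        nlinarith [norm_nonneg v]
      have a3 : ‖(6 : ℝ)‖ = 6 := by norm_num
      rw [a3]
      calc 6 * ‖(max (1 - ‖w‖ ^ 2) 0) ^ 2‖ * ‖⟪w, v⟫‖ ≤ 6 * 1 * ‖v‖ := by gcongr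
        _ = 6 * ‖v‖ := by ring
    calc _ ≤ m * (6 * ‖v‖) := mul_le_mul h1 h2 (norm_nonneg _) hm0
      _ = _ := by ring
  rw [ib, norm_neg, ← e1, ← m1, norm_mul, norm_mul, Real.norm_eq_abs, Real.norm_eq_abs,
    abs_of_pos hρ0, Real.norm_eq_abs, abs_of_pos (kr_integral_pos (n := n))] at bd
  have hk := kr_integral_pos (n := n)
  unfold CG0
  rw [le_div_iff₀ hr, div_mul_eq_mul_div, div_mul_eq_mul_div, le_div_iff₀ hk]
  rw [hρ] at bd
  linarith

noncomputable def CG (n : ℕ) : ℝ := 1 + 4 * CG0 n + 16 * CG0 n ^ 2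

lemma CG_ge : 1 ≤ CG n := by
  unfold CG; nlinarith [CG0_nonneg (n := n)]

lemma grad1 {f : EE n → ℝ} {x : EE n} {r m : ℝ} (hf : Hm f (ball x r))
    (hm : ∀ z ∈ ball x r, |f z| ≤ m) (hr : 0 < r) (v : EE n) :
    |fderiv ℝ f x v| ≤ CG n * m * ‖v‖ / r := by
  refine (grad0 hf hm hr v).trans ?_
  have hm0 : 0 ≤ m := (abs_nonneg _).trans (hm x (mem_ball_self hr))
  have : CG0 n ≤ CG n := by unfold CG; nlinarith [CG0_nonneg (n := n)]
  gcongr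

lemma ball_sub_aux {x y : EE n} {r s : ℝ} (h : ‖y - x‖ + s ≤ r) : ball y s ⊆ ball x r := by
  intro z hz
  rw [mem_ball, dist_eq_norm] at *
  have : z - x = (z - y) + (y - x) := by abel
  rw [this]
  linarith [norm_add_le (z - y) (y - x)]

lemma grad_half {f : EE n → ℝ} {x : EE n} {r m : ℝ} (hf : Hm f (ball x r))
    (hm : ∀ z ∈ ball x r, |f z| ≤ m) (hr : 0 < r) (v y : EE n) (hy : ‖y - x‖ ≤ r / 2) :
    |fderiv ℝ f y v| ≤ 2 * CG0 n * m * ‖v‖ / r := by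
  have hsub : ball y (r / 2) ⊆ ball x r := ball_sub_aux (by linarith)
  have := grad0 (hf.mono isOpen_ball hsub) (fun z hz => hm z (hsub hz)) (by positivity) v
  refine this.trans (le_of_eq ?_)
  field_simp

lemma osc1 {f : EE n → ℝ} {x : EE n} {r m : ℝ} (hf : Hm f (ball x r))
    (hm : ∀ z ∈ ball x r, |f z| ≤ m) (hr : 0 < r) {y : EE n} (hy : ‖y - x‖ ≤ r / 2) :
    |f y - f x| ≤ CG n * m * ‖y - x‖ / r := by
  have hm0 : 0 ≤ m := (abs_nonneg _).trans (hm x (mem_ball_self hr))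
  have hC := CG0_nonneg (n := n)
  have := Convex.norm_image_sub_le_of_norm_fderiv_le (𝕜 := ℝ) (f := f) (s := closedBall x (r / 2))
    (C := 2 * CG0 n * m / r) (x := x) (y := y) ?_ ?_ (convex_closedBall _ _)
    (mem_closedBall_self (by positivity)) (by rw [mem_closedBall, dist_eq_norm]; exact hy)
  · rw [Real.norm_eq_abs] at this
    refine this.trans ?_
    have : 2 * CG0 n ≤ CG n := by unfold CG; nlinarith
    rw [div_mul_eq_mul_div]
    gcongr
  · intro z hz
    exact smooth_diffAt isOpen_ball hf.2.1 (closedBall_subset_ball (by linarith) hz)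
  · intro z hz
    refine ContinuousLinearMap.opNorm_le_bound _ (by positivity) fun v => ?_
    rw [mem_closedBall, dist_eq_norm] at hz
    refine (grad_half hf hm hr v z hz).trans (le_of_eq ?_)
    ring

lemma taylor1 {f : EE n → ℝ} {x : EE n} {r m : ℝ} (hf : Hm f (ball x r))
    (hm : ∀ z ∈ ball x r, |f z| ≤ m) (hr : 0 < r) {y : EE n} (hy : ‖y - x‖ ≤ r / 4) :
    |f y - f x - fderiv ℝ f x (y - x)| ≤ CG n * m * ‖y - x‖ ^ 2 / r ^ 2 := by
  have hm0 : 0 ≤ m := (abs_nonneg _).trans (hm x (mem_ball_self hr))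
  have hC := CG0_nonneg (n := n)
  set d := ‖y - x‖ with hd
  have hd0 : 0 ≤ d := norm_nonneg _
  have hsub : ball x (r / 2) ⊆ ball x r := ball_subset_ball (by linarith)
  -- second derivative bound
  have h2 : ∀ v z, ‖z - x‖ ≤ r / 4 →
      |fderiv ℝ f z v - fderiv ℝ f x v| ≤ 8 * CG0 n ^ 2 * m * ‖v‖ * ‖z - x‖ / r ^ 2 * 2 := by
    intro v z hz
    have hv : ∀ z ∈ ball x (r / 2), |fderiv ℝ f z v| ≤ 2 * CG0 n * m * ‖v‖ / r := by
      intro z hz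
      rw [mem_ball, dist_eq_norm] at hz
      exact grad_half hf hm hr v z hz.le
    have hvH := (hf.dir v).mono isOpen_ball hsub
    have := Convex.norm_image_sub_le_of_norm_fderiv_le (𝕜 := ℝ) (f := fun z => fderiv ℝ f z v)
      (s := closedBall x (r / 4))
      (C := 2 * CG0 n * (2 * CG0 n * m * ‖v‖ / r) / (r / 2)) (x := x) (y := z) ?_ ?_
      (convex_closedBall _ _)
      (mem_closedBall_self (by positivity)) (by rw [mem_closedBall, dist_eq_norm]; exact hz)
    · rw [Real.norm_eq_abs] at this
      refine this.trans ?_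
      have e : 2 * CG0 n * (2 * CG0 n * m * ‖v‖ / r) / (r / 2) * ‖z - x‖
        = 8 * CG0 n ^ 2 * m * ‖v‖ * ‖z - x‖ / r ^ 2 := by field_simp; ring
      rw [e]
      have : 0 ≤ 8 * CG0 n ^ 2 * m * ‖v‖ * ‖z - x‖ / r ^ 2 := by positivity
      linarith
    · intro z hz
      exact smooth_diffAt isOpen_ball hvH.2.1 (closedBall_subset_ball (by linarith) hz)
    · intro z hz
      refine ContinuousLinearMap.opNorm_le_bound _ (by positivity) fun w => ?_
      rw [mem_closedBall, dist_eq_norm] at hz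
      refine (grad_half hvH hv (by positivity) w z (by linarith)).trans (le_of_eq ?_)
      ring
  have := Convex.norm_image_sub_le_of_norm_fderiv_le' (𝕜 := ℝ) (f := f) (s := closedBall x d)
    (C := 16 * CG0 n ^ 2 * m * d / r ^ 2) (x := x) (y := y) (φ := fderiv ℝ f x) ?_ ?_
    (convex_closedBall _ _)
    (mem_closedBall_self hd0) (by rw [mem_closedBall, dist_eq_norm])
  · rw [Real.norm_eq_abs] at this
    refine this.trans ?_
    have : 16 * CG0 n ^ 2 ≤ CG n := by unfold CG; nlinarith
    rw [div_mul_eq_mul_div, ← hd, mul_assoc _ d d, ← sq d]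
    gcongr
  · intro z hz
    exact smooth_diffAt isOpen_ball hf.2.1 (closedBall_subset_ball (by linarith) hz)
  · intro z hz
    rw [mem_closedBall, dist_eq_norm] at hz
    refine ContinuousLinearMap.opNorm_le_bound _ (by positivity) fun v => ?_
    refine (h2 v z (by linarith)).trans ?_
    have : 8 * CG0 n ^ 2 * m * ‖v‖ * ‖z - x‖ / r ^ 2 ≤ 8 * CG0 n ^ 2 * m * ‖v‖ * d / r ^ 2 := by
      gcongr
    refine (mul_le_mul_of_nonneg_right this zero_le_two).trans (le_of_eq ?_)
    ring

end harnack

open MeasureTheory Metric Set Filter ENNReal NNReal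
open scoped Topology ContDiff RealInnerProductSpace

section fb
variable {n : ℕ}

lemma oneD_up {g g' : ℝ → ℝ} {a b M : ℝ} (hab : a ≤ b) (hM : 0 ≤ M) (hc : ContinuousOn g (Icc a b))
    (ha : g a ≤ 0) (hd : ∀ t ∈ Ioo a b, 0 < g t → HasDerivAt g (g' t) t ∧ g' t ≤ M) :
    g b ≤ M * (b - a) := by
  by_contra hcon
  push Not at hcon
  have hgb : 0 < g b := lt_of_le_of_lt (mul_nonneg hM (by linarith)) hcon
  set Z := {t ∈ Icc a b | g t ≤ 0} with hZ
  have hZc : IsCompact Z := by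
    have : IsClosed Z := hc.preimage_isClosed_of_isClosed isClosed_Icc isClosed_Iic
    exact isCompact_Icc.of_isClosed_subset this (fun t ht => ht.1)
  obtain ⟨T, hT, hmax⟩ := hZc.exists_isGreatest ⟨a, ⟨le_rfl, hab⟩, ha⟩
  have hTb : T < b := lt_of_le_of_ne hT.1.2 (by rintro rfl; linarith [hT.2])
  have hpos : ∀ t ∈ Ioo T b, 0 < g t := by
    intro t ht
    by_contra h
    push Not at h
    have := hmax ⟨⟨hT.1.1.trans ht.1.le, ht.2.le⟩, h⟩
    linarith [ht.1]
  obtain ⟨c, hc1, hc2⟩ := exists_hasDerivAt_eq_slope g g' hTb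
    (hc.mono (Icc_subset_Icc_left hT.1.1))
    (fun t ht => (hd t ⟨lt_of_le_of_lt hT.1.1 ht.1, ht.2⟩ (hpos t ht)).1)
  have h1 := (hd c ⟨lt_of_le_of_lt hT.1.1 hc1.1, hc1.2⟩ (hpos c hc1)).2
  rw [hc2, div_le_iff₀ (by linarith)] at h1
  have := hT.2
  have := hT.1.1
  nlinarith

lemma oneD_low {g g' : ℝ → ℝ} {a b m : ℝ} (hab : a ≤ b) (hm : 0 ≤ m)
    (hc : ContinuousOn g (Icc a b))
    (ha : 0 < g a) (hd : ∀ t ∈ Ioo a b, 0 < g t → HasDerivAt g (g' t) t ∧ m ≤ g' t) :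
    g a + m * (b - a) ≤ g b := by
  set Z := {t ∈ Icc a b | g t ≤ 0} with hZ
  have hZc : IsCompact Z := by
    have : IsClosed Z := hc.preimage_isClosed_of_isClosed isClosed_Icc isClosed_Iic
    exact isCompact_Icc.of_isClosed_subset this (fun t ht => ht.1)
  have key : ∀ T, a < T → T ≤ b → (∀ t ∈ Ioo a T, 0 < g t) → g a + m * (T - a) ≤ g T := by
    intro T haT hTb hpos
    obtain ⟨c, hc1, hc2⟩ := exists_hasDerivAt_eq_slope g g' haT
      (hc.mono (Icc_subset_Icc_right hTb))
      (fun t ht => (hd t ⟨ht.1, ht.2.trans_le hTb⟩ (hpos t ht)).1)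
    have h1 := (hd c ⟨hc1.1, hc1.2.trans_le hTb⟩ (hpos c hc1)).2
    rw [hc2, le_div_iff₀ (by linarith)] at h1
    linarith
  have hZe : Z = ∅ := by
    by_contra hne
    obtain ⟨T, hT, hmin⟩ := hZc.exists_isLeast (nonempty_iff_ne_empty.2 hne)
    have haT : a < T := lt_of_le_of_ne hT.1.1 (by rintro rfl; linarith [hT.2])
    have hpos : ∀ t ∈ Ioo a T, 0 < g t := by
      intro t ht
      by_contra h
      push Not at h
      have := hmin ⟨⟨ht.1.le, ht.2.le.trans hT.1.2⟩, h⟩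
      linarith [ht.2]
    have := key T haT hT.1.2 hpos
    have := hT.2
    nlinarith
  rcases hab.eq_or_lt with h | h
  · subst h; simp
  · refine key b h le_rfl fun t ht => ?_
    by_contra hcon
    push Not at hcon
    have : t ∈ Z := ⟨⟨ht.1.le, ht.2.le⟩, hcon⟩
    rw [hZe] at this
    exact this

/-- unpacked solution -/
structure Sol (u : EE n → ℝ) (G : EE n → EE n) : Prop where
  cont : ContinuousOn u (ball 0 1)
  nonneg : ∀ x ∈ ball (0 : EE n) 1, 0 ≤ u x
  harm : Hm u (ball 0 1 ∩ {x | 0 < u x})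
  Gcont : ContinuousOn G (ball 0 1 ∩ closure {x | 0 < u x})
  Ggrad : ∀ x ∈ ball (0 : EE n) 1, 0 < u x → ∀ v, fderiv ℝ u x v = ⟪G x, v⟫
  Gfb : ∀ x ∈ ball (0 : EE n) 1, x ∈ closure {x | 0 < u x} → u x = 0 → ‖G x‖ = 1

lemma OnePhaseSolution.sol {u : EE n → ℝ} (h : OnePhaseSolution u) : ∃ G, Sol u G := by
  obtain ⟨h1, h2, h3, h4, G, h5, h6, h7⟩ := h
  have hop : IsOpen (ball (0 : EE n) 1 ∩ {x | 0 < u x}) :=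
    h1.isOpen_inter_preimage isOpen_ball isOpen_Ioi
  refine ⟨G, h1, h2, ⟨hop, h3, h4⟩, h5, ?_, ?_⟩
  · intro x hx hu v
    rw [h6 x ⟨hx, hu⟩]
    exact inner_gradient_left.symm
  · intro x hx hc hu
    refine h7 x ⟨hx, hc, fun hi => ?_⟩
    have := interior_subset hi
    simp only [mem_ofPred_eq] at this
    linarith

namespace Sol
variable {u : EE n → ℝ} {G : EE n → EE n}

lemma contAt (h : Sol u G) {x : EE n} (hx : x ∈ ball (0 : EE n) 1) : ContinuousAt u x :=
  h.cont.continuousAt (isOpen_ball.mem_nhds hx)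

lemma hasDeriv_line (h : Sol u G) (x v : EE n) {t : ℝ} (hx : x + t • v ∈ ball (0 : EE n) 1)
    (hp : 0 < u (x + t • v)) :
    HasDerivAt (fun t : ℝ => u (x + t • v)) ⟪G (x + t • v), v⟫ t := by
  have h1 : HasDerivAt (fun s : ℝ => x + s • v) v t := by
    simpa using ((hasDerivAt_id t).smul_const v).const_add x
  have h2 := (smooth_diffAt h.harm.1 h.harm.2.1 ⟨hx, hp⟩).hasFDerivAt.comp_hasDerivAt t h1
  rwa [h.Ggrad _ hx hp] at h2

lemma cont_line (h : Sol u G) (x v : EE n) {S : Set ℝ}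
    (hx : ∀ t ∈ S, x + t • v ∈ ball (0 : EE n) 1) :
    ContinuousOn (fun t : ℝ => u (x + t • v)) S :=
  h.cont.comp (by fun_prop) hx

/-- growth along a direction -/
lemma line_low (h : Sol u G) (x v : EE n) {T m : ℝ} (hT : 0 ≤ T) (hm : 0 ≤ m)
    (hx : ∀ t ∈ Icc 0 T, x + t • v ∈ ball (0 : EE n) 1) (hux : 0 < u x)
    (hG : ∀ t ∈ Ioo 0 T, 0 < u (x + t • v) → m ≤ ⟪G (x + t • v), v⟫) :
    u x + m * T ≤ u (x + T • v) := by
  have := oneD_low (g := fun t : ℝ => u (x + t • v)) (g' := fun t => ⟪G (x + t • v), v⟫)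
    hT hm (h.cont_line x v hx) (by simpa using hux)
    (fun t ht hp => ⟨h.hasDeriv_line x v (hx t ⟨ht.1.le, ht.2.le⟩) hp, hG t ht hp⟩)
  simpa using this

lemma line_up (h : Sol u G) (x v : EE n) {T M : ℝ} (hT : 0 ≤ T) (hM : 0 ≤ M)
    (hx : ∀ t ∈ Icc 0 T, x + t • v ∈ ball (0 : EE n) 1) (hux : u x ≤ 0)
    (hG : ∀ t ∈ Ioo 0 T, 0 < u (x + t • v) → ⟪G (x + t • v), v⟫ ≤ M) :
    u (x + T • v) ≤ M * T := by
  have := oneD_up (g := fun t : ℝ => u (x + t • v)) (g' := fun t => ⟪G (x + t • v), v⟫)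
    hT hM (h.cont_line x v hx) (by simpa using hux)
    (fun t ht hp => ⟨h.hasDeriv_line x v (hx t ⟨ht.1.le, ht.2.le⟩) hp, hG t ht hp⟩)
  simpa using this

lemma fb1 (h : Sol u G) {x0 : EE n} (hx0 : x0 ∈ ball (0 : EE n) 1) (hu : u x0 = 0) {η : ℝ}
    (hη : 0 < η) : ∃ δ > 0, ∀ x, ‖x - x0‖ < δ → u x ≤ (1 + η) * ‖x - x0‖ := by
  obtain ⟨δ, hδ, hball, hG⟩ : ∃ δ > 0, ball x0 δ ⊆ ball 0 1 ∧
      ∀ x ∈ ball x0 δ, 0 < u x → ‖G x‖ ≤ 1 + η := by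
    obtain ⟨δ0, hδ0, hb0⟩ := Metric.isOpen_iff.1 isOpen_ball x0 hx0
    by_cases hc : x0 ∈ closure {x | 0 < u x}
    · have h1 := (h.Gcont.norm x0 ⟨hx0, hc⟩)
      have h2 : {y : ℝ | y < 1 + η} ∈ 𝓝 ‖G x0‖ := by
        rw [h.Gfb x0 hx0 hc hu]; exact Iio_mem_nhds (by linarith)
      have h3 := h1 h2
      obtain ⟨δ1, hδ1, hb1⟩ := Metric.mem_nhdsWithin_iff.1 h3
      refine ⟨min δ0 δ1, lt_min hδ0 hδ1,
        (ball_subset_ball (min_le_left _ _)).trans hb0, fun x hx hp => ?_⟩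
      have := hb1 ⟨ball_subset_ball (min_le_right _ _) hx,
        hb0 (ball_subset_ball (min_le_left _ _) hx), subset_closure hp⟩
      exact le_of_lt this
    · have : (closure {x | 0 < u x})ᶜ ∈ 𝓝 x0 := isClosed_closure.isOpen_compl.mem_nhds hc
      obtain ⟨δ1, hδ1, hb1⟩ := Metric.mem_nhds_iff.1 this
      refine ⟨min δ0 δ1, lt_min hδ0 hδ1,
        (ball_subset_ball (min_le_left _ _)).trans hb0, fun x hx hp => ?_⟩
      exact absurd (subset_closure (show x ∈ {x | 0 < u x} from hp))
        (hb1 (ball_subset_ball (min_le_right _ _) hx))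
  refine ⟨δ, hδ, fun x hx => ?_⟩
  have hmem : ∀ t ∈ Icc (0 : ℝ) 1, x0 + t • (x - x0) ∈ ball x0 δ := by
    intro t ht
    rw [mem_ball, dist_eq_norm, add_sub_cancel_left, norm_smul, Real.norm_eq_abs,
      abs_of_nonneg ht.1]
    nlinarith [ht.2, norm_nonneg (x - x0)]
  have := h.line_up x0 (x - x0) (T := 1) (M := (1 + η) * ‖x - x0‖) zero_le_one (by positivity)
    (fun t ht => hball (hmem t ht)) hu.le (fun t ht hp => by
      refine (real_inner_le_norm _ _).trans ?_
      exact mul_le_mul_of_nonneg_right (hG _ (hmem t ⟨ht.1.le, ht.2.le⟩) hp) (norm_nonneg _))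
  simpa using this

lemma fbup (h : Sol u G) {y0 d : EE n} (hy0 : y0 ∈ ball (0 : EE n) 1)
    (hc : y0 ∈ closure {x | 0 < u x}) {a : ℝ} (ha : 0 ≤ a) (hd : a < ⟪G y0, d⟫) :
    ∃ δ > 0, ∀ t, 0 ≤ t → t < δ → a * t ≤ u (y0 + t • d) := by
  obtain ⟨δ0, hδ0, hb0⟩ := Metric.isOpen_iff.1 isOpen_ball y0 hy0
  have h1 : ContinuousWithinAt (fun x => ⟪G x, d⟫) (ball 0 1 ∩ closure {x | 0 < u x}) y0 :=
    (h.Gcont y0 ⟨hy0, hc⟩).inner continuousWithinAt_const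
  have h3 := h1 (Ioi_mem_nhds hd)
  obtain ⟨δ1, hδ1, hb1⟩ := Metric.mem_nhdsWithin_iff.1 h3
  set δ := min δ0 δ1 with hδ
  have hδp : 0 < δ := lt_min hδ0 hδ1
  refine ⟨δ / 2 / (‖d‖ + 1), by positivity, fun t ht0 ht => ?_⟩
  have htd : t * ‖d‖ < δ / 2 := by
    rw [lt_div_iff₀ (by positivity)] at ht
    nlinarith
  have hmem : ∀ y ∈ ball y0 (δ / 2), ∀ s ∈ Icc 0 t, y + s • d ∈ ball y0 δ := by
    intro y hy s hs
    rw [mem_ball, dist_eq_norm] at *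
    have : y + s • d - y0 = (y - y0) + s • d := by abel
    rw [this]
    have h5 := norm_add_le (y - y0) (s • d)
    rw [norm_smul, Real.norm_eq_abs, abs_of_nonneg hs.1] at h5
    have : s * ‖d‖ ≤ t * ‖d‖ := mul_le_mul_of_nonneg_right hs.2 (norm_nonneg _)
    linarith
  have hne : (𝓝[{x | 0 < u x}] y0).NeBot := mem_closure_iff_nhdsWithin_neBot.1 hc
  have hb : y0 + t • d ∈ ball (0 : EE n) 1 :=
    hb0 (ball_subset_ball (min_le_left _ _)
      (hmem y0 (mem_ball_self (by positivity)) t ⟨ht0, le_rfl⟩))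
  have hcont : Tendsto (fun y => u (y + t • d)) (𝓝[{x | 0 < u x}] y0) (𝓝 (u (y0 + t • d))) := by
    have : Tendsto (fun y => u (y + t • d)) (𝓝 y0) (𝓝 (u (y0 + t • d))) :=
      (h.contAt hb).tendsto.comp
        ((continuous_id.add continuous_const).tendsto' y0 (y0 + t • d) rfl)
    exact this.mono_left nhdsWithin_le_nhds
  refine ge_of_tendsto hcont ?_
  have : ∀ᶠ y in 𝓝[{x | 0 < u x}] y0, y ∈ ball y0 (δ / 2) :=
    nhdsWithin_le_nhds (ball_mem_nhds _ (by positivity))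
  filter_upwards [this, self_mem_nhdsWithin] with y hy hp
  have hp' : 0 < u y := hp
  have := h.line_low y d ht0 ha
    (fun s hs => hb0 (ball_subset_ball (min_le_left _ _) (hmem y hy s hs))) hp
    (fun s hs hps => by
      have hm := hmem y hy s ⟨hs.1.le, hs.2.le⟩
      have := hb1 ⟨ball_subset_ball (min_le_right _ _) hm,
        hb0 (ball_subset_ball (min_le_left _ _) hm), subset_closure hps⟩
      exact le_of_lt this)
  linarith

lemma fb2 (h : Sol u G) {y0 ν : EE n} {r0 : ℝ} (hr0 : 0 < r0) (hν : ‖ν‖ = 1)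
    (hy0 : y0 ∈ ball (0 : EE n) 1) (hu : u y0 = 0)
    (hc : y0 ∈ closure {x | 0 < u x})
    (hz : ∀ y ∈ ball (y0 - r0 • ν) r0, u y ≤ 0) : G y0 = ν := by
  have hg := h.Gfb y0 hy0 hc hu
  by_contra hne
  have hlt : ⟪G y0, ν⟫ < 1 := by
    refine lt_of_le_of_ne ?_ ?_
    · have := real_inner_le_norm (G y0) ν; rwa [hg, hν, one_mul] at this
    · intro h1
      exact hne ((inner_eq_one_iff_of_norm_eq_one hg hν).1 h1)
  set d := G y0 - ν with hd
  have h1 : ⟪G y0, d⟫ = 1 - ⟪G y0, ν⟫ := by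
    rw [hd, inner_sub_right, real_inner_self_eq_norm_sq, hg]; norm_num
  have h2 : ⟪ν, d⟫ = ⟪G y0, ν⟫ - 1 := by
    rw [hd, inner_sub_right, real_inner_self_eq_norm_sq, hν, real_inner_comm]; norm_num
  set b := 1 - ⟪G y0, ν⟫ with hb
  have hbp : 0 < b := by linarith
  obtain ⟨δ, hδ, hup⟩ := h.fbup hy0 hc (a := b / 2) (by positivity) (d := d) (by linarith)
  set t := min (δ / 2) (r0 * b / (‖d‖ ^ 2 + 1)) with ht
  have htp : 0 < t := lt_min (by positivity) (by positivity)
  have htδ : t < δ := (min_le_left _ _).trans_lt (by linarith)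
  have h3 := hup t htp.le htδ
  have h4 := hz (y0 + t • d) ?_
  · have : 0 < b / 2 * t := by positivity
    linarith
  · rw [mem_ball, dist_eq_norm]
    have e : y0 + t • d - (y0 - r0 • ν) = r0 • ν + t • d := by abel
    rw [e]
    refine lt_of_pow_lt_pow_left₀ 2 hr0.le ?_
    rw [norm_add_sq_real, norm_smul, norm_smul, inner_smul_left, inner_smul_right, hν]
    simp only [Real.norm_eq_abs, abs_of_pos hr0, abs_of_pos htp, conj_trivial]
    rw [h2]
    have h5 : t * (‖d‖ ^ 2 + 1) ≤ r0 * b := by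
      rw [← le_div_iff₀ (by positivity)]; exact min_le_right _ _
    nlinarith [mul_pos htp hr0, mul_pos (mul_pos htp hr0) hbp, mul_pos htp htp]

lemma fb2' (h : Sol u G) {y0 ν : EE n} {r0 : ℝ} (hr0 : 0 < r0) (hν : ‖ν‖ = 1)
    (hy0 : y0 ∈ ball (0 : EE n) 1) (hu : u y0 = 0)
    (hc : y0 ∈ closure {x | 0 < u x})
    (hz : ∀ y ∈ ball (y0 - r0 • ν) r0, u y ≤ 0) {η : ℝ} (hη : 0 < η) (hη1 : η ≤ 1) :
    ∃ δ > 0, ∀ t, 0 ≤ t → t < δ → (1 - η) * t ≤ u (y0 + t • ν) := by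
  have hg := h.fb2 hr0 hν hy0 hu hc hz
  refine h.fbup hy0 hc (by linarith) ?_
  rw [hg, real_inner_self_eq_norm_sq, hν]; linarith

end Sol
end fb

open MeasureTheory Metric Set Filter ENNReal NNReal
open scoped Topology ContDiff RealInnerProductSpace

section touch
variable {n : ℕ}

lemma rot {a b : EE n} (ha : ‖a‖ = 1) (hb : ‖b‖ = 1) (hab : 0 ≤ ⟪a, b⟫) :
    ∃ R : EE n ≃ₗᵢ[ℝ] EE n, R a = b ∧ ∀ x, ‖R x - x‖ ≤ 2 * ‖a - b‖ * ‖x‖ := by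
  set c := ⟪a, b⟫ with hc
  have hc1 : 0 < 1 + c := by linarith
  let L : EE n →ₗ[ℝ] EE n :=
    { toFun := fun x => x - ((⟪a, x⟫ + ⟪b, x⟫) / (1 + c)) • (a + b) + (2 * ⟪a, x⟫) • b
      map_add' := by
        intro x y
        simp only [inner_add_right]
        module
      map_smul' := by
        intro k x
        simp only [inner_smul_right, RingHom.id_apply]
        module }
  have hL : ∀ x, L x = x - ((⟪a, x⟫ + ⟪b, x⟫) / (1 + c)) • (a + b) + (2 * ⟪a, x⟫) • b :=
    fun x => rfl
  have haa : ⟪a, a⟫ = 1 := by rw [real_inner_self_eq_norm_sq, ha]; norm_num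
  have hbb : ⟪b, b⟫ = 1 := by rw [real_inner_self_eq_norm_sq, hb]; norm_num
  have hba : ⟪b, a⟫ = c := by rw [real_inner_comm]
  have hdiff : ∀ x, ‖L x - x‖ ^ 2 = 2 * (⟪a, x⟫ + ⟪b, x⟫) ^ 2 / (1 + c) - 4 * ⟪a, x⟫ * ⟪b, x⟫ := by
    intro x
    have e : L x - x = (2 * ⟪a, x⟫) • b - ((⟪a, x⟫ + ⟪b, x⟫) / (1 + c)) • (a + b) := by
      rw [hL]; abel
    rw [e, ← real_inner_self_eq_norm_sq]
    simp only [inner_sub_left, inner_sub_right, inner_smul_left, inner_smul_right, inner_add_left,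
      inner_add_right, haa, hbb, hba, conj_trivial, ← hc]
    field_simp
    ring
  have hnorm : ∀ x, ‖L x‖ = ‖x‖ := by
    intro x
    have e : ‖L x‖ ^ 2 = ‖x‖ ^ 2 := by
      have : L x = x + (L x - x) := by abel
      rw [this, norm_add_sq_real, hdiff]
      have e2 : ⟪x, L x - x⟫ = 2 * ⟪a, x⟫ * ⟪b, x⟫ - (⟪a, x⟫ + ⟪b, x⟫) ^ 2 / (1 + c) := by
        have e : L x - x = (2 * ⟪a, x⟫) • b - ((⟪a, x⟫ + ⟪b, x⟫) / (1 + c)) • (a + b) := by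
          rw [hL]; abel
        rw [e]
        simp only [inner_sub_right, inner_smul_right, inner_add_right, real_inner_comm x]
        ring
      rw [e2]
      ring
    exact (sq_eq_sq₀ (norm_nonneg _) (norm_nonneg _)).1 e
  let Li : EE n →ₗᵢ[ℝ] EE n := ⟨L, hnorm⟩
  refine ⟨Li.toLinearIsometryEquiv rfl, ?_, fun x => ?_⟩
  · change L a = b
    rw [hL, haa, hba, div_self hc1.ne']
    module
  · change ‖L x - x‖ ≤ _
    refine abs_le_of_sq_le_sq' ?_ (by positivity) |>.2
    rw [hdiff]
    have h1 : ‖a - b‖ ^ 2 = 2 - 2 * c := by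
      rw [norm_sub_sq_real, ha, hb, ← hc]; ring
    have h2 : (⟪a, x⟫ - ⟪b, x⟫) ^ 2 ≤ ‖a - b‖ ^ 2 * ‖x‖ ^ 2 := by
      rw [← inner_sub_left, ← mul_pow]
      exact sq_le_sq' (by linarith [neg_le_of_abs_le (abs_real_inner_le_norm (a - b) x)])
        (real_inner_le_norm _ _)
    have h3 : ⟪a, x⟫ ^ 2 ≤ ‖x‖ ^ 2 := by
      have := abs_real_inner_le_norm a x
      rw [ha, one_mul] at this
      exact sq_le_sq' (by linarith [neg_le_of_abs_le this]) (le_of_abs_le this)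
    have h4 : ⟪b, x⟫ ^ 2 ≤ ‖x‖ ^ 2 := by
      have := abs_real_inner_le_norm b x
      rw [hb, one_mul] at this
      exact sq_le_sq' (by linarith [neg_le_of_abs_le this]) (le_of_abs_le this)
    have hc2 : c ≤ 1 := by
      have := sq_nonneg ‖a - b‖; linarith
    rw [mul_pow, mul_pow, h1]
    rw [h1] at h2
    rw [sub_le_iff_le_add, div_le_iff₀ hc1]
    nlinarith [mul_nonneg hc1.le (mul_nonneg (sub_nonneg.2 hc2) (sq_nonneg ‖x‖)),
      sq_nonneg (⟪a, x⟫ - ⟪b, x⟫), mul_nonneg (mul_nonneg (sub_nonneg.2 hc2) hab) (sq_nonneg ‖x‖),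
      mul_nonneg (sub_nonneg.2 hc2) (sub_nonneg.2 h3), mul_nonneg (sub_nonneg.2 hc2) (sub_nonneg.2 h4)]

lemma second_test {φ φ' : ℝ → ℝ} {L : ℝ} (hmax : IsLocalMax φ 0)
    (h1 : ∀ᶠ t in 𝓝 0, HasDerivAt φ (φ' t) t) (h2 : HasDerivAt φ' L 0) : L ≤ 0 := by
  by_contra hL
  push Not at hL
  have e1 : deriv φ =ᶠ[𝓝 0] φ' := by
    filter_upwards [h1] with t ht using ht.deriv
  have e2 : deriv (deriv φ) 0 = L := by rw [e1.deriv_eq]; exact h2.deriv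
  have e0 : deriv φ 0 = 0 := hmax.deriv_eq_zero
  have hc : ContinuousAt φ 0 := h1.self_of_nhds.continuousAt
  have hmin := isLocalMin_of_deriv_deriv_pos (by rw [e2]; exact hL) e0 hc
  have hconst : φ =ᶠ[𝓝 0] fun _ => φ 0 := by
    filter_upwards [hmin, hmax] with t ha hb
    exact le_antisymm hb ha
  have e3 : deriv φ =ᶠ[𝓝 0] fun _ => 0 := by
    filter_upwards [hconst.eventuallyEq_nhds] with t ht
    rw [ht.deriv_eq]; simp
  rw [e3.deriv_eq] at e2
  simp at e2
  linarith

lemma curve2 {f : EE n → ℝ} {s : Set (EE n)} (hs : IsOpen s)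
    (hf : ContDiffOn ℝ (⊤ : ℕ∞) f s) {y0 : EE n} (hy : y0 ∈ s) (a b : EE n) :
    (∀ᶠ t in 𝓝 (0 : ℝ), HasDerivAt (fun t : ℝ => f (y0 + t • a + (t ^ 2) • b))
      (fderiv ℝ f (y0 + t • a + (t ^ 2) • b) (a + (2 * t) • b)) t) ∧
    HasDerivAt (fun t : ℝ => fderiv ℝ f (y0 + t • a + (t ^ 2) • b) (a + (2 * t) • b))
      (fderiv ℝ (fun y => fderiv ℝ f y a) y0 a + 2 * fderiv ℝ f y0 b) 0 := by
  have hγ : ∀ t : ℝ, HasDerivAt (fun t : ℝ => y0 + t • a + (t ^ 2) • b) (a + (2 * t) • b) t := by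
    intro t
    have h1 : HasDerivAt (fun t : ℝ => y0 + t • a) a t := by
      simpa using ((hasDerivAt_id t).smul_const a).const_add y0
    have h2 : HasDerivAt (fun t : ℝ => (t ^ 2) • b) ((2 * t) • b) t := by
      simpa using (hasDerivAt_pow 2 t).smul_const b
    exact h1.add h2
  have hc : ContinuousAt (fun t : ℝ => y0 + t • a + (t ^ 2) • b) 0 := (hγ 0).continuousAt
  have h0 : y0 + (0 : ℝ) • a + ((0 : ℝ) ^ 2) • b = y0 := by simp
  constructor
  · have : ∀ᶠ t in 𝓝 (0 : ℝ), y0 + t • a + (t ^ 2) • b ∈ s := by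
      apply hc.eventually_mem
      rw [h0]; exact hs.mem_nhds hy
    filter_upwards [this] with t ht
    exact (smooth_diffAt hs hf ht).hasFDerivAt.comp_hasDerivAt t (hγ t)
  · have hd : DifferentiableAt ℝ (fderiv ℝ f) y0 := by
      have h2 : ContDiffOn ℝ (⊤ : ℕ∞) (fderiv ℝ f) s := hf.fderiv_of_isOpen hs (by simp)
      exact (h2.contDiffAt (hs.mem_nhds hy)).differentiableAt (by simp)
    have h1 : HasDerivAt (fun t : ℝ => fderiv ℝ f (y0 + t • a + (t ^ 2) • b))
        (fderiv ℝ (fderiv ℝ f) y0 a) 0 := by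
      have hg := hγ 0
      have hd' : HasFDerivAt (fderiv ℝ f) (fderiv ℝ (fderiv ℝ f) y0)
        (y0 + (0 : ℝ) • a + ((0 : ℝ) ^ 2) • b) := by rw [h0]; exact hd.hasFDerivAt
      have := hd'.comp_hasDerivAt (0 : ℝ) hg
      have e : a + (2 * (0 : ℝ)) • b = a := by simp
      rw [e] at this
      exact this
    have h2 : HasDerivAt (fun t : ℝ => a + (2 * t) • b) ((2 : ℝ) • b) 0 := by
      have := (((hasDerivAt_id (0 : ℝ)).const_mul 2).smul_const b).const_add a
      simpa using this
    have := h1.clm_apply h2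
    rw [smooth_snd hs hf hy]
    simpa using this


set_option maxHeartbeats 1000000 in
lemma touch_interior (hn : 1 ≤ n) {u U : EE n → ℝ} {su sU : Set (EE n)} (hu : Hm u su)
    (hU : Hm U sU) {x0 y0 : EE n} (hy0 : y0 ∈ su) (hx0 : x0 ∈ sU) {e : EE n} (he : ‖e‖ = 1)
    {r : EE n → ℝ} {p : EE n} {k s κ : ℝ}
    (hr : ∀ h, r (x0 + h) = r x0 + ⟪p, h⟫ + k * (-‖h‖ ^ 2 + (n + 1) * ⟪e, h⟫ ^ 2))
    (hrp : 0 < r x0) (hp : ‖p‖ ≤ 1 / 2) (hpk : 25 * n * ‖p‖ ^ 2 < 2 * r x0 * k) (hκ : 0 < κ)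
    (hc : ‖y0 - (x0 - s • e)‖ ≤ r x0) {δ : ℝ} (hδ : 0 < δ)
    (hmax : ∀ x y, ‖x - x0‖ < δ → ‖y - y0‖ < δ → ‖y - (x - s • e)‖ ≤ r x →
      u y - U x + κ * ‖x‖ ^ 2 ≤ u y0 - U x0 + κ * ‖x0‖ ^ 2) : False := by
  have hn0 : (0 : ℝ) < n := by exact_mod_cast hn
  let E0 := EuclideanSpace.basisFun (Fin n) ℝ
  have hE0 : ∀ i, ‖E0 i‖ = 1 := fun i => E0.orthonormal.1 i
  -- general second order inequality along admissible curves
  have gen : ∀ i (a b : EE n), (∀ᶠ t in 𝓝 (0 : ℝ),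
      ‖(y0 + t • a + (t ^ 2) • b) - ((x0 + t • E0 i) - s • e)‖ ≤ r (x0 + t • E0 i)) →
      fderiv ℝ (fun y => fderiv ℝ u y a) y0 a + 2 * fderiv ℝ u y0 b
        - fderiv ℝ (fun y => fderiv ℝ U y (E0 i)) x0 (E0 i) + 2 * κ ≤ 0 := by
    intro i a b hadm
    obtain ⟨c1, c2⟩ := curve2 hu.1 hu.2.1 hy0 a b
    obtain ⟨d1, d2⟩ := curve2 hU.1 hU.2.1 hx0 (E0 i) 0
    have k1 : ∀ t : ℝ, HasDerivAt (fun t : ℝ => κ * ‖x0 + t • E0 i‖ ^ 2)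
        (κ * (2 * ⟪x0, E0 i⟫ + 2 * t)) t := by
      intro t
      have e1 : (fun t : ℝ => κ * ‖x0 + t • E0 i‖ ^ 2) =
        fun t : ℝ => κ * (‖x0‖ ^ 2 + 2 * ⟪x0, E0 i⟫ * t + t ^ 2) := by
        ext t
        rw [norm_add_sq_real, inner_smul_right, norm_smul, hE0, Real.norm_eq_abs, mul_one, sq_abs]
        ring
      rw [e1]
      refine HasDerivAt.const_mul _ ?_
      have := (((hasDerivAt_id t).const_mul (2 * ⟪x0, E0 i⟫)).const_add (‖x0‖ ^ 2)).add
        (hasDerivAt_pow 2 t)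
      refine (HasDerivAt.congr_deriv this ?_)
      simp
    have k2 : HasDerivAt (fun t : ℝ => κ * (2 * ⟪x0, E0 i⟫ + 2 * t)) (2 * κ) 0 := by
      have := (((hasDerivAt_id (0 : ℝ)).const_mul 2).const_add (2 * ⟪x0, E0 i⟫)).const_mul κ
      simpa [mul_comm] using this
    simp only [smul_zero, add_zero, map_zero, mul_zero] at d1 d2
    have := second_test (φ := fun t : ℝ => u (y0 + t • a + (t ^ 2) • b) - U (x0 + t • E0 i) +
        κ * ‖x0 + t • E0 i‖ ^ 2)
      (φ' := fun t => fderiv ℝ u (y0 + t • a + (t ^ 2) • b) (a + (2 * t) • b) -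
        fderiv ℝ U (x0 + t • E0 i) (E0 i) + κ * (2 * ⟪x0, E0 i⟫ + 2 * t))
      (L := fderiv ℝ (fun y => fderiv ℝ u y a) y0 a + 2 * fderiv ℝ u y0 b
        - fderiv ℝ (fun y => fderiv ℝ U y (E0 i)) x0 (E0 i) + 2 * κ) ?_ ?_ ?_
    · exact this
    · have t1 : ∀ᶠ t in 𝓝 (0 : ℝ), x0 + t • E0 i ∈ ball x0 δ := by
        have : ContinuousAt (fun t : ℝ => x0 + t • E0 i) 0 := by fun_prop
        apply this.eventually_mem
        simpa using ball_mem_nhds x0 hδ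
      have t2 : ∀ᶠ t in 𝓝 (0 : ℝ), y0 + t • a + (t ^ 2) • b ∈ ball y0 δ := by
        have : ContinuousAt (fun t : ℝ => y0 + t • a + (t ^ 2) • b) 0 := by fun_prop
        apply this.eventually_mem
        simpa using ball_mem_nhds y0 hδ
      filter_upwards [t1, t2, hadm] with t ht1 ht2 ht3
      rw [mem_ball, dist_eq_norm] at ht1 ht2
      have := hmax _ _ ht1 ht2 ht3
      simpa using this
    · filter_upwards [c1, d1] with t hc hd
      exact (hc.sub hd).add (k1 t)
    · exact (c2.sub d2).add k2
  have hlapU : ∑ i, fderiv ℝ (fun y => fderiv ℝ U y (E0 i)) x0 (E0 i) = 0 := by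
    rw [← lap_basis hU.1 hU.2.1 hx0 E0]; exact hU.2.2 x0 hx0
  rcases hc.lt_or_eq with hlt | heq
  · have h1 : ∀ i, fderiv ℝ (fun y => fderiv ℝ u y (E0 i)) y0 (E0 i)
        - fderiv ℝ (fun y => fderiv ℝ U y (E0 i)) x0 (E0 i) + 2 * κ ≤ 0 := by
      intro i
      have := gen i (E0 i) 0 ?_
      · simpa using this
      · have hcont : ContinuousAt (fun t : ℝ => r x0 + ⟪p, t • E0 i⟫ +
            k * (-‖t • E0 i‖ ^ 2 + (n + 1) * ⟪e, t • E0 i⟫ ^ 2)) 0 := by fun_prop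
        have : ∀ᶠ t in 𝓝 (0 : ℝ), ‖y0 - (x0 - s • e)‖ < r x0 + ⟪p, t • E0 i⟫ +
            k * (-‖t • E0 i‖ ^ 2 + (n + 1) * ⟪e, t • E0 i⟫ ^ 2) := by
          exact hcont.eventually_const_lt (by simpa using hlt)
        filter_upwards [this] with t ht
        rw [hr]
        have e1 : y0 + t • E0 i + t ^ 2 • (0 : EE n) - (x0 + t • E0 i - s • e) =
          y0 - (x0 - s • e) := by rw [smul_zero]; abel
        rw [e1]
        exact ht.le
    have h2 := Finset.sum_le_sum (fun i (_ : i ∈ Finset.univ) => h1 i)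
    rw [Finset.sum_add_distrib, Finset.sum_sub_distrib, hlapU,
      ← lap_basis hu.1 hu.2.1 hy0 E0, hu.2.2 y0 hy0] at h2
    simp at h2
    have := mul_pos hn0 hκ
    linarith
  · set r0 := r x0 with hr0
    set ν := r0⁻¹ • (y0 - (x0 - s • e)) with hν
    have hν1 : ‖ν‖ = 1 := by
      rw [hν, norm_smul, heq, norm_inv, Real.norm_eq_abs, abs_of_pos hrp, inv_mul_cancel₀ hrp.ne']
    have hw0 : y0 - (x0 - s • e) = r0 • ν := by
      rw [hν, smul_smul, mul_inv_cancel₀ hrp.ne', one_smul]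
    -- normal derivative is nonneg
    have hnu : 0 ≤ fderiv ℝ u y0 ν := by
      have hd : HasDerivAt (fun t : ℝ => u (y0 + t • (-ν))) (fderiv ℝ u y0 (-ν)) 0 := by
        have h1 : HasDerivAt (fun t : ℝ => y0 + t • (-ν)) (-ν) 0 := by
          simpa using ((hasDerivAt_id (0 : ℝ)).smul_const (-ν)).const_add y0
        have h2 : HasFDerivAt u (fderiv ℝ u y0) (y0 + (0 : ℝ) • (-ν)) := by
          simpa using (smooth_diffAt hu.1 hu.2.1 hy0).hasFDerivAt
        exact h2.comp_hasDerivAt (0 : ℝ) h1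
      have ht := hd.tendsto_slope_zero_right
      have hle : fderiv ℝ u y0 (-ν) ≤ 0 := by
        refine le_of_tendsto ht ?_
        have m1 : ∀ᶠ t in 𝓝[>] (0 : ℝ), t < min δ r0 :=
          nhdsWithin_le_nhds (Iio_mem_nhds (lt_min hδ hrp))
        filter_upwards [m1, self_mem_nhdsWithin] with t ht htp
        have htp : 0 < t := htp
        have hlt1 := lt_min_iff.1 ht
        have := hmax x0 (y0 + t • (-ν)) (by simpa using hδ) (by
          rw [add_sub_cancel_left, norm_smul, norm_neg, hν1, Real.norm_eq_abs, abs_of_pos htp]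
          linarith) (by
          have e1 : y0 + t • (-ν) - (x0 - s • e) = (r0 - t) • ν := by
            rw [show y0 + t • (-ν) - (x0 - s • e) = (y0 - (x0 - s • e)) - t • ν by
              rw [smul_neg]; abel, hw0, sub_smul]
          rw [e1, norm_smul, hν1, Real.norm_eq_abs, abs_of_pos (by linarith)]
          linarith)
        simp only [zero_add, zero_smul, add_zero, smul_eq_mul]
        refine mul_nonpos_of_nonneg_of_nonpos (by positivity) (by linarith)
      rw [map_neg] at hle
      linarith
    -- rotation
    set μ := ‖ν + p‖ with hμ
    have hμ1 : |μ - 1| ≤ ‖p‖ := by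
      have := abs_norm_sub_norm_le (ν + p) ν
      rwa [hν1, add_sub_cancel_left] at this
    have hμp : 0 < μ := by linarith [neg_le_of_abs_le hμ1]
    set a := μ⁻¹ • (ν + p) with ha
    have ha1 : ‖a‖ = 1 := by
      rw [ha, norm_smul, norm_inv, Real.norm_eq_abs, abs_of_pos hμp, inv_mul_cancel₀ hμp.ne']
    have hμa : μ • a = ν + p := by rw [ha, smul_smul, mul_inv_cancel₀ hμp.ne', one_smul]
    have haν : 0 ≤ ⟪a, ν⟫ := by
      rw [ha, inner_smul_left, inner_add_left, real_inner_self_eq_norm_sq, hν1]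
      have h1 := neg_le_of_abs_le (abs_real_inner_le_norm p ν)
      rw [hν1, mul_one] at h1
      simp only [conj_trivial]
      have : 0 ≤ 1 ^ 2 + ⟪p, ν⟫ := by linarith
      positivity
    obtain ⟨R, hRa, hRx⟩ := rot ha1 hν1 haν
    have haνn : μ * ‖a - ν‖ ≤ 2 * ‖p‖ := by
      have e1 : μ * ‖a - ν‖ = ‖μ • (a - ν)‖ := by
        rw [norm_smul, Real.norm_eq_abs, abs_of_pos hμp]
      rw [e1, smul_sub, hμa]
      have e2 : ν + p - μ • ν = p - (μ - 1) • ν := by rw [sub_smul, one_smul]; abel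
      rw [e2]
      refine (norm_sub_le _ _).trans ?_
      rw [norm_smul, hν1, Real.norm_eq_abs]
      linarith
    set A : Fin n → EE n := fun i => μ • R (E0 i) with hA
    have hAE : ∀ i, ‖A i - E0 i‖ ≤ 5 * ‖p‖ := by
      intro i
      have e1 : A i - E0 i = μ • (R (E0 i) - E0 i) + (μ - 1) • E0 i := by
        simp only [hA]; rw [smul_sub, sub_smul, one_smul]; abel
      rw [e1]
      refine (norm_add_le _ _).trans ?_
      rw [norm_smul, norm_smul, hE0, Real.norm_eq_abs, Real.norm_eq_abs, abs_of_pos hμp, mul_one]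
      have := hRx (E0 i)
      rw [hE0, mul_one] at this
      have h3 : μ * ‖R (E0 i) - E0 i‖ ≤ μ * (2 * ‖a - ν‖) := by gcongr
      linarith
    have hνA : ∀ i, ⟪ν, A i - E0 i⟫ = ⟪p, E0 i⟫ := by
      intro i
      have e1 : ⟪ν, A i⟫ = ⟪ν + p, E0 i⟫ := by
        simp only [hA]
        have e0 : ⟪ν, R (E0 i)⟫ = ⟪a, E0 i⟫ := by
          calc ⟪ν, R (E0 i)⟫ = ⟪R a, R (E0 i)⟫ := by rw [hRa]
            _ = _ := R.inner_map_map _ _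
        rw [inner_smul_right, e0, ← hμa]
        exact (real_inner_smul_left a (E0 i) μ).symm
      rw [inner_sub_right, e1, inner_add_left]; ring
    set H : Fin n → ℝ := fun i => k * (-1 + (n + 1) * ⟪e, E0 i⟫ ^ 2) with hH
    have hHsum : ∑ i, H i = k := by
      simp only [hH]
      rw [← Finset.mul_sum, Finset.sum_add_distrib, ← Finset.mul_sum]
      have : ∑ i, ⟪e, E0 i⟫ ^ 2 = 1 := by
        have := E0.sum_sq_norm_inner_left e
        simp only [Real.norm_eq_abs, sq_abs, he] at this
        simpa using this
      rw [this]; simp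
    set ηη := (2 * r0 * k - 25 * n * ‖p‖ ^ 2) / n with hηη
    have hηp : 0 < ηη := by
      rw [hηη]; apply div_pos _ hn0; linarith
    set β : Fin n → ℝ := fun i => (⟪p, E0 i⟫ ^ 2 + 2 * r0 * H i - ‖A i - E0 i‖ ^ 2 - ηη) / (2 * r0)
      with hβ
    have hβi : ∀ i, 2 * r0 * β i = ⟪p, E0 i⟫ ^ 2 + 2 * r0 * H i - ‖A i - E0 i‖ ^ 2 - ηη := by
      intro i; simp only [hβ]; field_simp
    have h1 : ∀ i, fderiv ℝ (fun y => fderiv ℝ u y (A i)) y0 (A i) + 2 * fderiv ℝ u y0 (β i • ν)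
        - fderiv ℝ (fun y => fderiv ℝ U y (E0 i)) x0 (E0 i) + 2 * κ ≤ 0 := by
      intro i
      apply gen i
      have hpos : ∀ᶠ t in 𝓝 (0 : ℝ), 0 < r (x0 + t • E0 i) := by
        have hcont : ContinuousAt (fun t : ℝ => r x0 + ⟪p, t • E0 i⟫ +
            k * (-‖t • E0 i‖ ^ 2 + (n + 1) * ⟪e, t • E0 i⟫ ^ 2)) 0 := by fun_prop
        simp_rw [hr]
        exact hcont.eventually_const_lt (by simpa using hrp)
      have hsmall : ∀ᶠ t in 𝓝 (0 : ℝ), 0 < ηη + (2 * ⟪p, E0 i⟫ * H i - 2 * β i * ⟪p, E0 i⟫) * t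
          + (H i ^ 2 - β i ^ 2) * t ^ 2 := by
        have hcont : ContinuousAt (fun t : ℝ => ηη + (2 * ⟪p, E0 i⟫ * H i -
          2 * β i * ⟪p, E0 i⟫) * t + (H i ^ 2 - β i ^ 2) * t ^ 2) 0 := by fun_prop
        exact hcont.eventually_const_lt (by simpa using hηp)
      filter_upwards [hpos, hsmall] with t ht1 ht2
      refine abs_le_of_sq_le_sq' ?_ ht1.le |>.2
      have e1 : y0 + t • A i + t ^ 2 • β i • ν - (x0 + t • E0 i - s • e) =
          (r0 + t ^ 2 * β i) • ν + t • (A i - E0 i) := by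
        rw [show y0 + t • A i + t ^ 2 • β i • ν - (x0 + t • E0 i - s • e) =
          (y0 - (x0 - s • e)) + t ^ 2 • β i • ν + t • (A i - E0 i) by rw [smul_sub]; abel, hw0]
        module
      have e2 : r (x0 + t • E0 i) = r0 + t * ⟪p, E0 i⟫ + t ^ 2 * H i := by
        rw [hr, inner_smul_right, inner_smul_right, norm_smul, hE0, Real.norm_eq_abs, mul_one,
          sq_abs]
        simp only [hH]
        ring
      have q1 : ‖(r0 + t ^ 2 * β i) • ν‖ ^ 2 = (r0 + t ^ 2 * β i) ^ 2 := by
        rw [norm_smul, hν1, mul_one, Real.norm_eq_abs, sq_abs]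
      have q2 : ‖t • (A i - E0 i)‖ ^ 2 = t ^ 2 * ‖A i - E0 i‖ ^ 2 := by
        rw [norm_smul, mul_pow, Real.norm_eq_abs, sq_abs]
      have q3 : ⟪(r0 + t ^ 2 * β i) • ν, t • (A i - E0 i)⟫ =
          (r0 + t ^ 2 * β i) * (t * ⟪p, E0 i⟫) := by
        rw [inner_smul_left, inner_smul_right, hνA]; simp
      rw [e1, e2, norm_add_sq_real, q1, q2, q3]
      have hb := hβi i
      have key : (r0 + t * ⟪p, E0 i⟫ + t ^ 2 * H i) ^ 2 - ((r0 + t ^ 2 * β i) ^ 2 +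
        2 * ((r0 + t ^ 2 * β i) * (t * ⟪p, E0 i⟫)) + t ^ 2 * ‖A i - E0 i‖ ^ 2) =
        t ^ 2 * (ηη + (2 * ⟪p, E0 i⟫ * H i - 2 * β i * ⟪p, E0 i⟫) * t
          + (H i ^ 2 - β i ^ 2) * t ^ 2) := by
        linear_combination (-t ^ 2) * hb
      have := mul_nonneg (sq_nonneg t) ht2.le
      linarith
    have hlapu : ∑ i, fderiv ℝ (fun y => fderiv ℝ u y (A i)) y0 (A i) = 0 := by
      have e1 : ∀ i, fderiv ℝ (fun y => fderiv ℝ u y (A i)) y0 (A i) =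
          μ ^ 2 * fderiv ℝ (fun y => fderiv ℝ u y (E0.map R i)) y0 (E0.map R i) := by
        intro i
        rw [smooth_snd hu.1 hu.2.1 hy0, smooth_snd hu.1 hu.2.1 hy0]
        simp only [hA, OrthonormalBasis.map_apply, map_smul, smul_apply, smul_eq_mul]
        ring
      rw [Finset.sum_congr rfl fun i _ => e1 i, ← Finset.mul_sum,
        ← lap_basis hu.1 hu.2.1 hy0 (E0.map R), hu.2.2 y0 hy0, mul_zero]
    have h2 := Finset.sum_le_sum (fun i (_ : i ∈ Finset.univ) => h1 i)
    rw [Finset.sum_add_distrib, Finset.sum_sub_distrib, Finset.sum_add_distrib, hlapU, hlapu] at h2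
    have hβs : 0 ≤ ∑ i, β i := by
      have e1 : 2 * r0 * ∑ i, β i = ∑ i, ⟪p, E0 i⟫ ^ 2 + 2 * r0 * k
          - ∑ i, ‖A i - E0 i‖ ^ 2 - n * ηη := by
        rw [Finset.mul_sum, Finset.sum_congr rfl fun i _ => hβi i, Finset.sum_sub_distrib,
          Finset.sum_sub_distrib, Finset.sum_add_distrib, ← Finset.mul_sum, hHsum]
        simp
      have e2 : n * ηη = 2 * r0 * k - 25 * n * ‖p‖ ^ 2 := by rw [hηη]; field_simp
      have e3 : ∑ i, ‖A i - E0 i‖ ^ 2 ≤ ∑ _i : Fin n, 25 * ‖p‖ ^ 2 := by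
        refine Finset.sum_le_sum fun i _ => ?_
        have := hAE i
        have := norm_nonneg (A i - E0 i)
        nlinarith
      simp only [Finset.sum_const, Finset.card_univ, Fintype.card_fin, nsmul_eq_mul] at e3
      have e4 : 0 ≤ ∑ i, ⟪p, E0 i⟫ ^ 2 := Finset.sum_nonneg fun i _ => sq_nonneg _
      have : 0 ≤ 2 * r0 * ∑ i, β i := by rw [e1, e2]; linarith
      exact (mul_nonneg_iff_of_pos_left (by positivity)).1 this
    simp only [map_smul, smul_eq_mul] at h2
    have e5 : ∑ i, 2 * (β i * fderiv ℝ u y0 ν) = 2 * (∑ i, β i) * fderiv ℝ u y0 ν := by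
      rw [Finset.mul_sum, Finset.sum_mul]
      refine Finset.sum_congr rfl fun i _ => by ring
    rw [e5] at h2
    simp at h2
    have := mul_nonneg hβs hnu
    have := mul_pos hn0 hκ
    linarith

end touch

open MeasureTheory Metric Set Filter ENNReal NNReal
open scoped Topology ContDiff RealInnerProductSpace

section strip
variable {n : ℕ}

/-- square of the tangential part -/
noncomputable def qf (e w : EE n) : ℝ := ‖w‖ ^ 2 - ⟪e, w⟫ ^ 2

lemma qf_nonneg {e : EE n} (he : ‖e‖ = 1) (w : EE n) : 0 ≤ qf e w := by
  have := abs_real_inner_le_norm e w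
  rw [he, one_mul] at this
  have := sq_le_sq' (by linarith [neg_le_of_abs_le this]) (le_of_abs_le this)
  unfold qf; linarith

lemma qf_cont (e : EE n) : Continuous (qf e) := by unfold qf; fun_prop

/-- strip barrier -/
noncomputable def chi (e z : EE n) (ℓ K : ℝ) (x : EE n) : ℝ :=
  1 - (qf e (x - z) / ℓ ^ 2 + n * (4 - (⟪e, x - z⟫ / ℓ + 1) ^ 2)) / K ^ 2

noncomputable def gchi (e z : EE n) (ℓ K : ℝ) (x : EE n) : EE n :=
  (2 / (K ^ 2 * ℓ ^ 2)) • (-(x - z - ⟪e, x - z⟫ • e) + (n * ℓ * (⟪e, x - z⟫ / ℓ + 1)) • e)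

def Qs (e z : EE n) (ℓ K : ℝ) : Set (EE n) :=
  {x | qf e (x - z) ≤ (2 * K * ℓ) ^ 2 ∧ |⟪e, x - z⟫| ≤ ℓ / 2}

lemma chi_cont (e z : EE n) (ℓ K : ℝ) : Continuous (chi e z ℓ K) := by
  unfold chi qf; fun_prop

lemma chi_add {e : EE n} (he : ‖e‖ = 1) (z : EE n) {ℓ K : ℝ} (hℓ : 0 < ℓ) (hK : 0 < K)
    (x h : EE n) : chi e z ℓ K (x + h) = chi e z ℓ K x + ⟪gchi e z ℓ K x, h⟫ +
      1 / (K ^ 2 * ℓ ^ 2) * (-‖h‖ ^ 2 + (n + 1) * ⟪e, h⟫ ^ 2) := by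
  unfold chi gchi qf
  have e1 : x + h - z = (x - z) + h := by abel
  rw [e1]
  generalize x - z = w
  rw [norm_add_sq_real, inner_add_right, inner_smul_left, inner_add_left, inner_neg_left,
    inner_sub_left, inner_smul_left, inner_smul_left]
  simp only [conj_trivial]
  field_simp
  ring

lemma gchi_sq {e : EE n} (he : ‖e‖ = 1) (z : EE n) {ℓ K : ℝ} (hℓ : 0 < ℓ) (hK : 0 < K) (x : EE n) :
    ‖gchi e z ℓ K x‖ ^ 2 = (2 / (K ^ 2 * ℓ ^ 2)) ^ 2 *
      (qf e (x - z) + (n * ℓ * (⟪e, x - z⟫ / ℓ + 1)) ^ 2) := by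
  unfold gchi qf
  generalize x - z = w
  rw [norm_smul, mul_pow, Real.norm_eq_abs, sq_abs, norm_add_sq_real, norm_neg, norm_sub_sq_real,
    inner_neg_left, inner_sub_left, norm_smul, norm_smul, inner_smul_right, inner_smul_right,
    inner_smul_left, inner_smul_right, he, real_inner_self_eq_norm_sq, he, mul_one, mul_one,
    Real.norm_eq_abs, Real.norm_eq_abs, sq_abs, sq_abs, real_inner_comm e w]
  simp only [conj_trivial]
  ring

lemma Qs_closed (e z : EE n) (ℓ K : ℝ) : IsClosed (Qs e z ℓ K) := by
  unfold Qs qf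
  have h1 : IsClosed {x : EE n | ‖x - z‖ ^ 2 - ⟪e, x - z⟫ ^ 2 ≤ (2 * K * ℓ) ^ 2} :=
    isClosed_le (by fun_prop) (by fun_prop)
  have h2 : IsClosed {x : EE n | |⟪e, x - z⟫| ≤ ℓ / 2} := isClosed_le (by fun_prop) (by fun_prop)
  exact h1.inter h2

lemma chi_le {e z : EE n} (_he : ‖e‖ = 1) {ℓ K : ℝ} (hℓ : 0 < ℓ) (hK : 0 < K) {x : EE n}
    (hx : |⟪e, x - z⟫| ≤ ℓ / 2) : chi e z ℓ K x ≤ 1 - qf e (x - z) / (K ^ 2 * ℓ ^ 2) := by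
  unfold chi
  have h1 := abs_le.1 hx
  have h2 : ⟪e, x - z⟫ / ℓ ≤ 1 / 2 := by rw [div_le_iff₀ hℓ]; linarith
  have h3 : -(1 / 2) ≤ ⟪e, x - z⟫ / ℓ := by rw [le_div_iff₀ hℓ]; linarith
  have h4 : (0:ℝ) ≤ n * (4 - (⟪e, x - z⟫ / ℓ + 1) ^ 2) := by
    apply mul_nonneg (by positivity); nlinarith
  have h5 : qf e (x - z) / (K ^ 2 * ℓ ^ 2) = qf e (x - z) / ℓ ^ 2 / K ^ 2 := by
    rw [div_div, mul_comm]
  rw [h5]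
  gcongr
  linarith

lemma chi_le_one {e z : EE n} (he : ‖e‖ = 1) {ℓ K : ℝ} (hℓ : 0 < ℓ) (hK : 0 < K) {x : EE n}
    (hx : |⟪e, x - z⟫| ≤ ℓ / 2) : chi e z ℓ K x ≤ 1 := by
  have := chi_le he hℓ hK hx
  have : 0 ≤ qf e (x - z) / (K ^ 2 * ℓ ^ 2) := div_nonneg (qf_nonneg he _) (by positivity)
  linarith

structure SLH (u U : EE n → ℝ) (Gu GU : EE n → EE n) (e z : EE n) (ℓ K s R τ A β : ℝ) : Prop where
  hn : 1 ≤ n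
  su : Sol u Gu
  sU : Sol U GU
  he : ‖e‖ = 1
  hℓ : 0 < ℓ
  hK : 3 * (n : ℝ) ≤ K
  hs : 0 < s
  hsℓ : s ≤ ℓ
  hA : 0 < A
  hA1 : A * (130 * n) ≤ 1
  hβ : 1 / 2 ≤ β
  hβ1 : β ≤ 1
  hR : 0 < R
  hR2 : R ≤ 2 * s
  hτ : 0 ≤ τ
  hτ1 : τ * (160 * K ^ 2) ≤ 1
  hQ : ∀ x ∈ Qs e z ℓ K, closedBall x (8 * s) ⊆ ball (0 : EE n) 1
  hdom : ∀ x ∈ Qs e z ℓ K, ∀ y, ‖y - (x - s • e)‖ ≤ s * β → u y ≤ U x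
  htop : ∀ x ∈ Qs e z ℓ K, ℓ / 4 ≤ |⟪e, x - z⟫| → ∀ y, ‖y - (x - s • e)‖ ≤ s * (β + A) → u y ≤ U x
  hMon : ∀ x ∈ Qs e z ℓ K, ∀ w ∈ closedBall x (8 * s), ∀ y, ‖y - (w - R • e)‖ ≤ R * (1 - τ) →
    u y ≤ u w

namespace SLH
variable {u U : EE n → ℝ} {Gu GU : EE n → EE n} {e z : EE n} {ℓ K s R τ A β : ℝ}

lemma n1 (h : SLH u U Gu GU e z ℓ K s R τ A β) : (1 : ℝ) ≤ n := by exact_mod_cast h.hn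
lemma K3 (h : SLH u U Gu GU e z ℓ K s R τ A β) : 3 ≤ K := by linarith [h.n1, h.hK]
lemma A1 (h : SLH u U Gu GU e z ℓ K s R τ A β) : A ≤ 1 / 130 := by
  have := h.hA1; have := h.n1; have := h.hA; nlinarith

lemma mem_ball (h : SLH u U Gu GU e z ℓ K s R τ A β) {x y : EE n} (_hx : x ∈ Qs e z ℓ K)
    (hy : ‖y - (x - s • e)‖ ≤ 2 * s) : ‖y - x‖ ≤ 3 * s := by
  have e1 : y - x = (y - (x - s • e)) + (-(s • e)) := by abel
  rw [e1]
  refine (norm_add_le _ _).trans ?_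
  rw [norm_neg, norm_smul, h.he, Real.norm_eq_abs, abs_of_pos h.hs]; linarith

lemma mem_ball1 (h : SLH u U Gu GU e z ℓ K s R τ A β) {x y : EE n} (hx : x ∈ Qs e z ℓ K)
    (hy : ‖y - x‖ ≤ 8 * s) : y ∈ ball (0 : EE n) 1 :=
  h.hQ x hx (by rw [mem_closedBall, dist_eq_norm]; exact hy)

lemma mem_ball0 (h : SLH u U Gu GU e z ℓ K s R τ A β) {x : EE n} (hx : x ∈ Qs e z ℓ K) :
    x ∈ ball (0 : EE n) 1 := h.mem_ball1 hx (by simp; exact h.hs.le)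

set_option maxHeartbeats 1000000 in
lemma stepA (h : SLH u U Gu GU e z ℓ K s R τ A β) {x1 y1 : EE n} (hx1 : x1 ∈ Qs e z ℓ K)
    (hm : ‖y1 - (x1 - s • e)‖ ≤ s * (β + A * chi e z ℓ K x1)) (hbad : U x1 < u y1) :
    ∃ x0 y0, qf e (x0 - z) ≤ (K * ℓ) ^ 2 ∧ |⟪e, x0 - z⟫| ≤ ℓ / 4 ∧ ‖y0 - (x0 - s • e)‖ ≤ 2 * s ∧
      U x0 = 0 ∧ 0 < u y0 ∧ ‖y0 - (x0 - s • e)‖ - s * (β + A * chi e z ℓ K x0) ≤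
      ‖y1 - (x1 - s • e)‖ - s * (β + A * chi e z ℓ K x1) := by
  have hs := h.hs
  have hℓ := h.hℓ
  have hK : 0 < K := by linarith [h.K3]
  have hA := h.hA
  set r : EE n → ℝ := fun x => s * (β + A * chi e z ℓ K x) +
    (‖y1 - (x1 - s • e)‖ - s * (β + A * chi e z ℓ K x1)) with hr
  have hrle : ∀ x ∈ Qs e z ℓ K, r x ≤ s * (β + A) := by
    intro x hx
    have := chi_le_one h.he hℓ hK hx.2
    have h2 : s * (β + A * chi e z ℓ K x) ≤ s * (β + A * 1) := by gcongr
    simp only [hr]; linarith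
  have hr2 : ∀ x ∈ Qs e z ℓ K, r x ≤ 2 * s := by
    intro x hx
    have h1 := hrle x hx
    have h2 : s * (β + A) ≤ s * 2 := by gcongr; linarith [h.hβ1, h.A1]
    linarith
  have hrc : Continuous r := by
    simp only [hr]; have := chi_cont e z ℓ K; fun_prop
  set Kc : Set (EE n × EE n) := {p | p.1 ∈ Qs e z ℓ K ∧ ‖p.2 - (p.1 - s • e)‖ ≤ r p.1} with hKc
  have hKcl : IsClosed Kc := by
    have h1 : IsClosed {p : EE n × EE n | ‖p.2 - (p.1 - s • e)‖ ≤ r p.1} :=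
      isClosed_le (by fun_prop) (by fun_prop)
    exact ((Qs_closed e z ℓ K).preimage continuous_fst).inter h1
  have hsub1 : ∀ p ∈ Kc, p.1 ∈ ball (0 : EE n) 1 := fun p hp => h.mem_ball0 hp.1
  have hsub2 : ∀ p ∈ Kc, p.2 ∈ ball (0 : EE n) 1 := fun p hp =>
    h.mem_ball1 hp.1 (by linarith [h.mem_ball hp.1 (hp.2.trans (hr2 _ hp.1))])
  have hKco : IsCompact Kc := by
    refine Metric.isCompact_of_isClosed_isBounded hKcl ?_
    refine (isBounded_ball.prod isBounded_ball).subset (s := Kc)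
      (t := ball (0 : EE n) 1 ×ˢ ball (0 : EE n) 1) fun p hp => ⟨hsub1 p hp, hsub2 p hp⟩
  set κ := (u y1 - U x1) / 2 with hκ
  have hκp : 0 < κ := by rw [hκ]; linarith
  have hp1 : (x1, y1) ∈ Kc := ⟨hx1, by simp only [hr]; linarith⟩
  obtain ⟨⟨x0, y0⟩, hp0, hmax⟩ := hKco.exists_isMaxOn ⟨_, hp1⟩
    (f := fun p : EE n × EE n => u p.2 - U p.1 + κ * ‖p.1‖ ^ 2) (by
      refine ((h.su.cont.comp (by fun_prop) hsub2).sub (h.sU.cont.comp (by fun_prop) hsub1)).add ?_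
      fun_prop)
  obtain ⟨hx0Q, hy0r⟩ : x0 ∈ Qs e z ℓ K ∧ ‖y0 - (x0 - s • e)‖ ≤ r x0 := id hp0
  have hx0b : x0 ∈ ball (0 : EE n) 1 := hsub1 (x0, y0) hp0
  have hy0b : y0 ∈ ball (0 : EE n) 1 := hsub2 (x0, y0) hp0
  have hbad0 : U x0 < u y0 := by
    have h1 : u y1 - U x1 + κ * ‖x1‖ ^ 2 ≤ u y0 - U x0 + κ * ‖x0‖ ^ 2 := hmax hp1
    have h2 : ‖x0‖ < 1 := by simpa using hx0b
    have h3 : κ * ‖x0‖ ^ 2 ≤ κ * 1 := by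
      gcongr; nlinarith [norm_nonneg x0]
    have h4 : 0 ≤ κ * ‖x1‖ ^ 2 := by positivity
    have h5 : u y1 - U x1 = 2 * κ := by rw [hκ]; ring
    linarith
  have hr0 : s * β < r x0 := by
    by_contra hc
    push Not at hc
    exact absurd (h.hdom x0 hx0Q y0 (hy0r.trans hc)) (not_le.2 hbad0)
  have hchi : 0 < chi e z ℓ K x0 := by
    simp only [hr] at hr0
    have : 0 < s * (A * chi e z ℓ K x0) := by
      have : s * (β + A * chi e z ℓ K x0) = s * β + s * (A * chi e z ℓ K x0) := by ring
      linarith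
    exact (mul_pos_iff_of_pos_left hA).1 ((mul_pos_iff_of_pos_left hs).1 this)
  have hq : qf e (x0 - z) < (K * ℓ) ^ 2 := by
    have h1 := chi_le h.he hℓ hK hx0Q.2
    have h2 : qf e (x0 - z) / (K ^ 2 * ℓ ^ 2) < 1 := by linarith
    rw [div_lt_one (by positivity)] at h2
    linarith [mul_pow K ℓ 2]
  have hX : |⟪e, x0 - z⟫| < ℓ / 4 := by
    by_contra hc
    push Not at hc
    exact absurd (h.htop x0 hx0Q hc y0 (hy0r.trans (hrle _ hx0Q))) (not_le.2 hbad0)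
  have hU0 := h.sU.nonneg x0 hx0b
  have hu0 : 0 < u y0 := lt_of_le_of_lt hU0 hbad0
  refine ⟨x0, y0, hq.le, hX.le, hy0r.trans (hr2 _ hx0Q), ?_, hu0, ?_⟩
  · by_contra hne
    have hUp : 0 < U x0 := lt_of_le_of_ne hU0 (Ne.symm hne)
    obtain ⟨δ, hδ, hδQ⟩ : ∃ δ > 0, ∀ x, ‖x - x0‖ < δ → x ∈ Qs e z ℓ K := by
      have h1 : ∀ᶠ x in 𝓝 x0, qf e (x - z) < (K * ℓ) ^ 2 := by
        have : ContinuousAt (fun x => qf e (x - z)) x0 := by unfold qf; fun_prop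
        exact this.eventually_lt_const hq
      have h2 : ∀ᶠ x in 𝓝 x0, |⟪e, x - z⟫| < ℓ / 4 := by
        have : ContinuousAt (fun x => |⟪e, x - z⟫|) x0 := by fun_prop
        exact this.eventually_lt_const hX
      obtain ⟨δ, hδ, hb⟩ := Metric.eventually_nhds_iff.1 (h1.and h2)
      refine ⟨δ, hδ, fun x hx => ?_⟩
      have := hb (y := x) (by rwa [dist_eq_norm])
      refine ⟨this.1.le.trans ?_, by linarith [this.2]⟩
      gcongr
      linarith
    have hg : ‖gchi e z ℓ K x0‖ ^ 2 ≤ 5 / (K ^ 2 * ℓ ^ 2) := by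
      rw [gchi_sq h.he z hℓ hK]
      have h1 := abs_lt.1 hX
      have h2 : ⟪e, x0 - z⟫ / ℓ ≤ 1 / 4 := by rw [div_le_iff₀ hℓ]; linarith
      have h3 : -(1 / 4) ≤ ⟪e, x0 - z⟫ / ℓ := by rw [le_div_iff₀ hℓ]; linarith
      have h4 : (n * ℓ * (⟪e, x0 - z⟫ / ℓ + 1)) ^ 2 ≤ (K ^ 2 * ℓ ^ 2) * (1 / 4) := by
        have h5 : (n * ℓ * (⟪e, x0 - z⟫ / ℓ + 1)) ≤ (K / 3) * ℓ * (5 / 4) := by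
          gcongr <;> linarith [h.hK]
        have h6 : 0 ≤ n * ℓ * (⟪e, x0 - z⟫ / ℓ + 1) := by
          have : 0 ≤ ⟪e, x0 - z⟫ / ℓ + 1 := by linarith
          positivity
        calc _ ≤ ((K / 3) * ℓ * (5 / 4)) ^ 2 := by gcongr
          _ ≤ _ := by have : 0 ≤ K ^ 2 * ℓ ^ 2 := by positivity
                      nlinarith
      calc _ ≤ (2 / (K ^ 2 * ℓ ^ 2)) ^ 2 * ((K ^ 2 * ℓ ^ 2) * (5 / 4)) := by
            gcongr; rw [mul_pow] at hq; linarith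
        _ = _ := by field_simp; norm_num
    have hn1 := h.n1
    have hr0' : s / 2 < r x0 := by nlinarith [h.hβ]
    have hps : ‖(s * A) • gchi e z ℓ K x0‖ ^ 2 ≤ (s * A) ^ 2 * (5 / (K ^ 2 * ℓ ^ 2)) := by
      rw [norm_smul, mul_pow, Real.norm_eq_abs, sq_abs]; gcongr
    refine touch_interior h.hn h.su.harm h.sU.harm ⟨hy0b, hu0⟩ ⟨hx0b, hUp⟩ h.he (r := r)
      (p := (s * A) • gchi e z ℓ K x0) (k := s * A / (K ^ 2 * ℓ ^ 2)) (s := s) (κ := κ) ?_ ?_ ?_ ?_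
      hκp hy0r hδ ?_
    · intro w
      simp only [hr]
      rw [chi_add h.he z hℓ hK, inner_smul_left]
      simp only [conj_trivial]
      field_simp
      ring
    · linarith
    · refine abs_le_of_sq_le_sq' (hps.trans ?_) (by norm_num) |>.2
      have : (s * A) ^ 2 * (5 / (K ^ 2 * ℓ ^ 2)) ≤ (ℓ * (1 / 130)) ^ 2 * (5 / (3 ^ 2 * ℓ ^ 2)) := by
        gcongr
        · exact h.hsℓ
        · exact h.A1
        · exact h.K3
      refine this.trans (le_of_eq_of_le ?_ (show (5 / (130 ^ 2 * 9) : ℝ) ≤ (1 / 2) ^ 2 by norm_num))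
      field_simp; norm_num
    · have e1 : 2 * r x0 * (s * A / (K ^ 2 * ℓ ^ 2)) = 2 * r x0 * (s * A) / (K ^ 2 * ℓ ^ 2) := by ring
      have e2 : 25 * n * ((s * A) ^ 2 * (5 / (K ^ 2 * ℓ ^ 2))) =
        (125 * n * (s * A)) * (s * A) / (K ^ 2 * ℓ ^ 2) := by ring
      have h1 : 25 * (n:ℝ) * ‖(s * A) • gchi e z ℓ K x0‖ ^ 2 ≤
        25 * n * ((s * A) ^ 2 * (5 / (K ^ 2 * ℓ ^ 2))) := by gcongr
      refine lt_of_le_of_lt h1 ?_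
      rw [e1, e2]
      have : 125 * n * (s * A) < 2 * r x0 := by
        have h2 : s * (A * (130 * n)) ≤ s * 1 := by gcongr; exact h.hA1
        have h3 : 0 < s * A * n := by positivity
        nlinarith
      gcongr
    · intro x y hx hy hxy
      exact hmax (show (x, y) ∈ Kc from ⟨hδQ x hx, hxy⟩)
  · simp only [hr] at hy0r; linarith

end SLH
end strip

open MeasureTheory Metric Set Filter ENNReal NNReal
open scoped Topology ContDiff RealInnerProductSpace

section strip2
variable {n : ℕ}

/-- two balls with centres closer than the sum of radii meet -/
lemma balls_meet {a b : EE n} {r t : ℝ} (hr : 0 < r) (ht : 0 ≤ t) (h : ‖a - b‖ < r + t) :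
    ∃ w, ‖w - a‖ < r ∧ ‖w - b‖ ≤ t := by
  refine ⟨b + (t / (r + t)) • (a - b), ?_, ?_⟩
  · have e1 : b + (t / (r + t)) • (a - b) - a = (-(r / (r + t))) • (a - b) := by
      have : r / (r + t) = 1 - t / (r + t) := by field_simp; ring
      rw [this]; module
    rw [e1, norm_smul, norm_neg, Real.norm_eq_abs, abs_of_nonneg (by positivity)]
    calc r / (r + t) * ‖a - b‖ < r / (r + t) * (r + t) := by gcongr
      _ = r := by field_simp
  · rw [add_sub_cancel_left, norm_smul, Real.norm_eq_abs, abs_of_nonneg (by positivity)]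
    calc t / (r + t) * ‖a - b‖ ≤ t / (r + t) * (r + t) := by gcongr
      _ = t := by field_simp

lemma gchi_inner_pos {e z : EE n} (hn : 1 ≤ n) (he : ‖e‖ = 1) {ℓ K τ : ℝ} (hℓ : 0 < ℓ) (hK : 3 ≤ K)
    (hτ : 0 ≤ τ) (hτ1 : τ * (160 * K ^ 2) ≤ 1) {x ν : EE n} (hν : ‖ν‖ = 1)
    (hq : qf e (x - z) ≤ (K * ℓ) ^ 2) (hX : |⟪e, x - z⟫| ≤ ℓ / 4) (htilt : 1 - 5 * τ ≤ ⟪ν, e⟫) :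
    0 < ⟪gchi e z ℓ K x, ν⟫ := by
  have hn1 : (1 : ℝ) ≤ n := by exact_mod_cast hn
  unfold gchi
  unfold qf at hq
  rw [inner_smul_left]
  simp only [conj_trivial]
  apply _root_.mul_pos (by positivity)
  rw [inner_add_left, inner_neg_left, inner_smul_left]
  simp only [conj_trivial]
  have hc : ⟪e, ν⟫ = ⟪ν, e⟫ := real_inner_comm _ _
  rw [hc]
  set w := x - z
  set w' := w - ⟪e, w⟫ • e with hw'
  have hτs : τ ≤ 1 / 1440 := by
    have h1 : (9 : ℝ) ≤ K ^ 2 := by nlinarith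
    nlinarith [mul_le_mul_of_nonneg_left h1 hτ]
  have hle : ⟪ν, e⟫ ≤ 1 := by have := real_inner_le_norm ν e; rwa [hν, he, one_mul] at this
  have hw'e : ⟪w', e⟫ = 0 := by
    rw [hw', inner_sub_left, inner_smul_left, real_inner_self_eq_norm_sq, he, real_inner_comm]; simp
  have hw'n : ‖w'‖ ^ 2 = ‖w‖ ^ 2 - ⟪e, w⟫ ^ 2 := by
    rw [hw', norm_sub_sq_real, inner_smul_right, norm_smul, he, real_inner_comm, mul_one,
      Real.norm_eq_abs, sq_abs]; ring
  have hpn : ‖ν - ⟪ν, e⟫ • e‖ ^ 2 = 1 - ⟪ν, e⟫ ^ 2 := by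
    rw [norm_sub_sq_real, inner_smul_right, norm_smul, he, hν, mul_one,
      Real.norm_eq_abs, sq_abs]; ring
  have hin : ⟪w', ν⟫ = ⟪w', ν - ⟪ν, e⟫ • e⟫ := by
    rw [inner_sub_right, inner_smul_right, hw'e]; simp
  have hw1 : ‖w'‖ ≤ K * ℓ := by
    refine abs_le_of_sq_le_sq' (by rw [hw'n]; exact hq) (by positivity) |>.2
  have hp1 : ‖ν - ⟪ν, e⟫ • e‖ ≤ 1 / (4 * K) := by
    refine abs_le_of_sq_le_sq' ?_ (by positivity) |>.2
    rw [hpn]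
    have h1 : 1 - ⟪ν, e⟫ ^ 2 ≤ 10 * τ := by nlinarith
    have h2 : 10 * τ ≤ (1 / (4 * K)) ^ 2 := by
      rw [div_pow, le_div_iff₀ (by positivity)]; nlinarith
    linarith
  have h3 : ⟪w', ν⟫ ≤ ℓ / 4 := by
    rw [hin]
    refine (real_inner_le_norm _ _).trans ?_
    calc _ ≤ (K * ℓ) * (1 / (4 * K)) := by gcongr
      _ = ℓ / 4 := by field_simp
  have h1 := abs_le.1 hX
  have h2 : -(1 / 4) ≤ ⟪e, w⟫ / ℓ := by rw [le_div_iff₀ hℓ]; linarith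
  have h4 : 1 * ℓ * (3 / 4) * (1 / 2) ≤ n * ℓ * (⟪e, w⟫ / ℓ + 1) * ⟪ν, e⟫ := by
    have h5 : (3 / 4 : ℝ) ≤ ⟪e, w⟫ / ℓ + 1 := by linarith
    have h6 : 0 ≤ n * ℓ * (⟪e, w⟫ / ℓ + 1) := by positivity
    gcongr
    linarith
  linarith

namespace SLH
variable {u U : EE n → ℝ} {Gu GU : EE n → EE n} {e z : EE n} {ℓ K s R τ A β : ℝ}

set_option maxHeartbeats 1000000 in
theorem strip (h : SLH u U Gu GU e z ℓ K s R τ A β) {x1 y1 : EE n} (hx1 : x1 ∈ Qs e z ℓ K)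
    (hm : ‖y1 - (x1 - s • e)‖ ≤ s * (β + A * chi e z ℓ K x1)) : u y1 ≤ U x1 := by
  by_contra hbad
  push Not at hbad
  have hs := h.hs
  have hℓ := h.hℓ
  have hK : 0 < K := by linarith [h.K3]
  have hA := h.hA
  set m : EE n × EE n → ℝ := fun p => ‖p.2 - (p.1 - s • e)‖ - s * (β + A * chi e z ℓ K p.1) with hmdef
  have hmc : Continuous m := by
    simp only [hmdef]; have := chi_cont e z ℓ K; fun_prop
  set W : Set (EE n × EE n) := {p | (qf e (p.1 - z) ≤ (K * ℓ) ^ 2 ∧ |⟪e, p.1 - z⟫| ≤ ℓ / 4 ∧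
    ‖p.2 - (p.1 - s • e)‖ ≤ 2 * s) ∧ U p.1 = 0 ∧ 0 < u p.2} with hW
  have hstep : ∀ x y, x ∈ Qs e z ℓ K → m (x, y) ≤ 0 → U x < u y → ∃ p ∈ W, m p ≤ m (x, y) := by
    intro x y hx hmm hb
    obtain ⟨x0, y0, a1, a2, a3, a4, a5, a6⟩ := h.stepA hx (by simp only [hmdef] at hmm; linarith) hb
    exact ⟨(x0, y0), ⟨⟨a1, a2, a3⟩, a4, a5⟩, a6⟩
  obtain ⟨p1, hp1W, hp1m⟩ := hstep x1 y1 hx1 (by simp only [hmdef]; linarith) hbad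
  have hp1m0 : m p1 ≤ 0 := hp1m.trans (by simp only [hmdef]; linarith)
  have hQof : ∀ x, qf e (x - z) ≤ (K * ℓ) ^ 2 → |⟪e, x - z⟫| ≤ ℓ / 4 → x ∈ Qs e z ℓ K := by
    intro x h1 h2
    refine ⟨h1.trans ?_, by linarith⟩
    gcongr; linarith
  -- closed superset
  set W1 : Set (EE n × EE n) := {p | qf e (p.1 - z) ≤ (K * ℓ) ^ 2 ∧ |⟪e, p.1 - z⟫| ≤ ℓ / 4 ∧
    ‖p.2 - (p.1 - s • e)‖ ≤ 2 * s ∧ s * β ≤ ‖p.2 - (p.1 - s • e)‖} with hW1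
  have hW1c : IsClosed W1 := by
    have c1 : IsClosed {p : EE n × EE n | qf e (p.1 - z) ≤ (K * ℓ) ^ 2} := by
      unfold qf; exact isClosed_le (by fun_prop) (by fun_prop)
    have c2 : IsClosed {p : EE n × EE n | |⟪e, p.1 - z⟫| ≤ ℓ / 4} :=
      isClosed_le (by fun_prop) (by fun_prop)
    have c3 : IsClosed {p : EE n × EE n | ‖p.2 - (p.1 - s • e)‖ ≤ 2 * s} :=
      isClosed_le (by fun_prop) (by fun_prop)
    have c4 : IsClosed {p : EE n × EE n | s * β ≤ ‖p.2 - (p.1 - s • e)‖} :=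
      isClosed_le (by fun_prop) (by fun_prop)
    exact c1.inter (c2.inter (c3.inter c4))
  have hWW1 : W ⊆ W1 := by
    rintro p ⟨⟨a1, a2, a3⟩, a4, a5⟩
    refine ⟨a1, a2, a3, ?_⟩
    by_contra hc
    push Not at hc
    have := h.hdom p.1 (hQof _ a1 a2) p.2 hc.le
    linarith
  have hclW1 : closure W ⊆ W1 := closure_minimal hWW1 hW1c
  have hsub1 : ∀ p ∈ W1, p.1 ∈ ball (0 : EE n) 1 := fun p hp => h.mem_ball0 (hQof _ hp.1 hp.2.1)
  have hsub2 : ∀ p ∈ W1, ‖p.2 - p.1‖ ≤ 3 * s := fun p hp =>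
    h.mem_ball (hQof _ hp.1 hp.2.1) hp.2.2.1
  have hsub3 : ∀ p ∈ W1, p.2 ∈ ball (0 : EE n) 1 := fun p hp =>
    h.mem_ball1 (hQof _ hp.1 hp.2.1) (by linarith [hsub2 p hp])
  have hco : IsCompact (closure W) := by
    refine Metric.isCompact_of_isClosed_isBounded isClosed_closure ?_
    refine (isBounded_ball.prod isBounded_ball).subset (s := closure W)
      (t := ball (0 : EE n) 1 ×ˢ ball (0 : EE n) 1) fun p hp => ⟨hsub1 p (hclW1 hp), hsub3 p (hclW1 hp)⟩
  obtain ⟨⟨x0, y0⟩, hp0, hmin⟩ := hco.exists_isMinOn ⟨p1, subset_closure hp1W⟩ hmc.continuousOn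
  set m1 := m (x0, y0) with hm1
  have hm10 : m1 ≤ 0 := le_trans (hmin (subset_closure hp1W)) hp1m0
  obtain ⟨hq0, hX0, hd0, hd0'⟩ := hclW1 hp0
  have hx0Q : x0 ∈ Qs e z ℓ K := hQof _ hq0 hX0
  have hx0b : x0 ∈ ball (0 : EE n) 1 := hsub1 (x0, y0) (hclW1 hp0)
  have hy0b : y0 ∈ ball (0 : EE n) 1 := hsub3 (x0, y0) (hclW1 hp0)
  have hy0x : ‖y0 - x0‖ ≤ 3 * s := hsub2 (x0, y0) (hclW1 hp0)
  simp only at hq0 hX0 hd0 hd0'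
  have hgood : ∀ x y, x ∈ Qs e z ℓ K → m (x, y) < m1 → u y ≤ U x := by
    intro x y hx hlt
    by_contra hb
    push Not at hb
    obtain ⟨p, hp, hpm⟩ := hstep x y hx (by linarith) hb
    have := hmin (subset_closure hp)
    simp only [mem_ofPred_eq] at this
    linarith
  have hU0 : U x0 = 0 := by
    have h1 : Tendsto (fun p : EE n × EE n => U p.1) (𝓝[W] (x0, y0)) (𝓝 (U x0)) := by
      have : ContinuousAt (fun p : EE n × EE n => U p.1) (x0, y0) :=
        ContinuousAt.comp (f := fun p : EE n × EE n => p.1)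
          (h.sU.cont.continuousAt (isOpen_ball.mem_nhds hx0b)) continuousAt_fst
      exact this.mono_left nhdsWithin_le_nhds
    have : (𝓝[W] (x0, y0)).NeBot := mem_closure_iff_nhdsWithin_neBot.1 hp0
    refine tendsto_nhds_unique h1 (tendsto_const_nhds.congr' ?_)
    filter_upwards [self_mem_nhdsWithin] with p hp using hp.2.1.symm
  have hycl : y0 ∈ closure {x | 0 < u x} := by
    have h1 : MapsTo Prod.snd W {x | 0 < u x} := fun p hp => hp.2.2
    exact h1.closure continuous_snd hp0
  set r0 := ‖y0 - (x0 - s • e)‖ with hr0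
  have hr0s : s / 2 ≤ r0 := by nlinarith [h.hβ]
  have hr0p : 0 < r0 := by linarith
  have hm1' : m1 = r0 - s * (β + A * chi e z ℓ K x0) := rfl
  set ν := r0⁻¹ • (y0 - (x0 - s • e)) with hν
  have hν1 : ‖ν‖ = 1 := by
    rw [hν, norm_smul, ← hr0, norm_inv, Real.norm_eq_abs, abs_of_pos hr0p, inv_mul_cancel₀ hr0p.ne']
  have hw0 : y0 - (x0 - s • e) = r0 • ν := by
    rw [hν, smul_smul, mul_inv_cancel₀ hr0p.ne', one_smul]
  have hctr : y0 - r0 • ν = x0 - s • e := by rw [← hw0]; abel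
  have hzero : ∀ y ∈ ball (y0 - r0 • ν) r0, u y ≤ 0 := by
    intro y hy
    rw [hctr, Metric.mem_ball, dist_eq_norm] at hy
    rw [← hU0]
    apply hgood x0 y hx0Q
    rw [hm1']
    simp only [hmdef]; linarith
  have hu0 : u y0 = 0 := by
    refine le_antisymm ?_ (h.su.nonneg y0 hy0b)
    have hcl : y0 ∈ closure (ball (y0 - r0 • ν) r0) := by
      rw [closure_ball _ hr0p.ne', mem_closedBall, dist_eq_norm, _root_.sub_sub_cancel, norm_smul, hν1,
        Real.norm_eq_abs, abs_of_pos hr0p, mul_one]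
    have h1 : Tendsto u (𝓝[ball (y0 - r0 • ν) r0] y0) (𝓝 (u y0)) :=
      (h.su.cont.continuousAt (isOpen_ball.mem_nhds hy0b)).mono_left nhdsWithin_le_nhds
    have : (𝓝[ball (y0 - r0 • ν) r0] y0).NeBot := mem_closure_iff_nhdsWithin_neBot.1 hcl
    refine le_of_tendsto h1 ?_
    filter_upwards [self_mem_nhdsWithin] with y hy using hzero y hy
  have hτ1 : τ ≤ 1 := by
    have := h.hτ1; have := h.K3; have := h.hτ; nlinarith [sq_nonneg K]
  have hR := h.hR
  have hR2 := h.hR2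
  -- tilt
  have hdist : r0 + R * (1 - τ) ≤ ‖r0 • ν + R • e‖ := by
    have hcl : ∀ᶠ y in 𝓝[{x | 0 < u x}] y0, r0 + R * (1 - τ) ≤ ‖(x0 - s • e) - (y + R • e)‖ := by
      filter_upwards [self_mem_nhdsWithin, nhdsWithin_le_nhds (ball_mem_nhds y0 hs)] with y hy hyb
      by_contra hc
      push Not at hc
      obtain ⟨w, hw1, hw2⟩ := balls_meet hr0p (mul_nonneg hR.le (sub_nonneg.2 hτ1)) hc
      have hwle : u w ≤ 0 := hzero w (by rw [hctr, Metric.mem_ball, dist_eq_norm]; exact hw1)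
      have hy' : 0 < u y := hy
      rw [Metric.mem_ball, dist_eq_norm] at hyb
      have := h.hMon x0 hx0Q w ?_ y ?_
      · linarith
      · rw [mem_closedBall, dist_eq_norm]
        have e1 : w - x0 = (w - (y + R • e)) + R • e + (y - y0) + (y0 - x0) := by abel
        rw [e1]
        have n1 : ‖R • e‖ = R := by rw [norm_smul, h.he, Real.norm_eq_abs, abs_of_pos hR, mul_one]
        have n2 : R * (1 - τ) ≤ R * 1 := by gcongr; linarith [h.hτ]
        refine (norm_add_le _ _).trans ?_
        have n3 := norm_add_le ((w - (y + R • e)) + R • e) (y - y0)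
        have n4 := norm_add_le (w - (y + R • e)) (R • e)
        linarith
      · rw [show y - (w - R • e) = -(w - (y + R • e)) by abel, norm_neg]; exact hw2
    have h1 : Tendsto (fun y => ‖(x0 - s • e) - (y + R • e)‖) (𝓝[{x | 0 < u x}] y0)
        (𝓝 ‖(x0 - s • e) - (y0 + R • e)‖) := by
      have : ContinuousAt (fun y => ‖(x0 - s • e) - (y + R • e)‖) y0 := by fun_prop
      exact this.mono_left nhdsWithin_le_nhds
    have : (𝓝[{x | 0 < u x}] y0).NeBot := mem_closure_iff_nhdsWithin_neBot.1 hycl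
    have h2 := ge_of_tendsto h1 hcl
    rwa [show (x0 - s • e) - (y0 + R • e) = -((y0 - (x0 - s • e)) + R • e) by abel, norm_neg, hw0]
      at h2
  have htilt : 1 - 5 * τ ≤ ⟪ν, e⟫ := by
    have h1 : (r0 + R * (1 - τ)) ^ 2 ≤ r0 ^ 2 + 2 * (r0 * R * ⟪ν, e⟫) + R ^ 2 := by
      have h2 : (r0 + R * (1 - τ)) ^ 2 ≤ ‖r0 • ν + R • e‖ ^ 2 := by
        have : 0 ≤ R * (1 - τ) := mul_nonneg hR.le (sub_nonneg.2 hτ1)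
        gcongr
      have h3 : ‖r0 • ν‖ ^ 2 = r0 ^ 2 := by
        rw [norm_smul, hν1, mul_one, Real.norm_eq_abs, sq_abs]
      have h4 : ‖R • e‖ ^ 2 = R ^ 2 := by
        rw [norm_smul, h.he, mul_one, Real.norm_eq_abs, sq_abs]
      rw [norm_add_sq_real, inner_smul_left, inner_smul_right, h3, h4] at h2
      simp only [conj_trivial] at h2
      linarith
    have h3 : (2 * r0 * R) * (1 - τ) - 2 * R * R * τ ≤ (2 * r0 * R) * ⟪ν, e⟫ := by
      nlinarith [sq_nonneg (R * τ)]
    have h4 : R * R * τ ≤ R * (4 * r0) * τ := by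
      have := h.hτ
      gcongr; linarith
    have h5 : (2 * r0 * R) * (1 - 5 * τ) ≤ (2 * r0 * R) * ⟪ν, e⟫ := by nlinarith
    exact le_of_mul_le_mul_left h5 (by positivity)
  have hγ := gchi_inner_pos h.hn h.he hℓ h.K3 h.hτ h.hτ1 hν1 hq0 hX0 htilt
  set γ := ⟪gchi e z ℓ K x0, ν⟫ with hγd
  set k := 1 / (K ^ 2 * ℓ ^ 2) with hk
  have hkp : 0 < k := by rw [hk]; positivity
  set a := s * A * γ / 4 with ha
  have hap : 0 < a := by positivity
  set η := a / (2 * (2 + a)) with hη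
  have hηp : 0 < η := by positivity
  have hη1 : η ≤ 1 := by rw [hη, div_le_one (by positivity)]; linarith
  obtain ⟨δ1, hδ1, hf1⟩ := h.sU.fb1 hx0b hU0 hηp
  obtain ⟨δ2, hδ2, hf2⟩ := h.su.fb2' hr0p hν1 hy0b hu0 hycl hzero hηp hη1
  have hev : ∀ᶠ t in 𝓝 (0 : ℝ), x0 + t • ν ∈ Qs e z ℓ K := by
    have h1 : ∀ᶠ x in 𝓝 (0 : ℝ), qf e (x0 + x • ν - z) < (2 * K * ℓ) ^ 2 := by
      have : ContinuousAt (fun x : ℝ => qf e (x0 + x • ν - z)) 0 := by unfold qf; fun_prop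
      refine this.eventually_lt_const ?_
      simp only [zero_smul, add_zero]
      refine lt_of_le_of_lt hq0 ?_
      gcongr; linarith
    have h2 : ∀ᶠ x in 𝓝 (0 : ℝ), |⟪e, x0 + x • ν - z⟫| < ℓ / 2 := by
      have : ContinuousAt (fun x : ℝ => |⟪e, x0 + x • ν - z⟫|) 0 := by fun_prop
      refine this.eventually_lt_const ?_
      simp only [zero_smul, add_zero]
      linarith
    filter_upwards [h1, h2] with t h1 h2 using ⟨h1.le, h2.le⟩
  obtain ⟨δ3, hδ3, hf3⟩ := Metric.eventually_nhds_iff.1 hev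
  obtain ⟨t, ht0, ht⟩ := exists_between (show (0 : ℝ) < min (min δ1 (δ2 / (1 + a))) (min δ3 (γ / (2 * k)))
    by positivity)
  obtain ⟨⟨ht1, ht2⟩, ht3, ht4⟩ : (t < δ1 ∧ t < δ2 / (1 + a)) ∧ t < δ3 ∧ t < γ / (2 * k) := by
    simpa only [lt_min_iff] using ht
  have hxt := hf3 (y := t) (by rw [dist_zero_right, Real.norm_eq_abs, abs_of_pos ht0]; exact ht3)
  have hut := hf1 (x0 + t • ν) (by
    rw [add_sub_cancel_left, norm_smul, hν1, Real.norm_eq_abs, abs_of_pos ht0]; linarith)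
  rw [add_sub_cancel_left, norm_smul, hν1, Real.norm_eq_abs, abs_of_pos ht0, mul_one] at hut
  have hyt := hf2 ((1 + a) * t) (by positivity) (by
    rw [lt_div_iff₀ (by positivity)] at ht2; linarith)
  have hcmp : u (y0 + ((1 + a) * t) • ν) ≤ U (x0 + t • ν) := by
    apply hgood _ _ hxt
    rw [hm1']
    simp only [hmdef]
    have e1 : y0 + ((1 + a) * t) • ν - (x0 + t • ν - s • e) = (r0 + a * t) • ν := by
      rw [show y0 + ((1 + a) * t) • ν - (x0 + t • ν - s • e) =
        (y0 - (x0 - s • e)) + (((1 + a) * t) • ν - t • ν) by abel, hw0]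
      module
    rw [e1, norm_smul, hν1, Real.norm_eq_abs, abs_of_pos (by positivity), chi_add h.he z hℓ hK,
      inner_smul_right, norm_smul, hν1, Real.norm_eq_abs, abs_of_pos ht0, ← hγd, ← hk]
    have h1 : 0 ≤ (n + 1) * ⟪e, t • ν⟫ ^ 2 := by positivity
    have h2 : k * t < γ / 2 := by
      rw [lt_div_iff₀ (by positivity)] at ht4; linarith
    have h3 : k * (-(t * 1) ^ 2) ≤ k * (-(t * 1) ^ 2 + (n + 1) * ⟪e, t • ν⟫ ^ 2) := by
      gcongr; linarith
    have h5 : t * (γ / 2) ≤ t * γ + k * (-(t * 1) ^ 2 + (n + 1) * ⟪e, t • ν⟫ ^ 2) := by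
      have : t * (k * t) ≤ t * (γ / 2) := by gcongr
      nlinarith
    have h6 : s * A * (t * (γ / 2)) ≤
      s * A * (t * γ + k * (-(t * 1) ^ 2 + (n + 1) * ⟪e, t • ν⟫ ^ 2)) := by gcongr
    have h7 : a * t < s * A * (t * (γ / 2)) := by
      rw [ha]; have : 0 < s * A * γ * t := by positivity
      linarith
    linarith
  have hfin : (1 - η) * ((1 + a) * t) ≤ (1 + η) * t := hyt.trans (hcmp.trans hut)
  have h8 : (1 - η) * (1 + a) ≤ 1 + η := by
    have : ((1 - η) * (1 + a)) * t ≤ (1 + η) * t := by linarith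
    exact le_of_mul_le_mul_right this ht0
  have h9 : η * (2 + a) = a / 2 := by rw [hη]; field_simp
  linarith

end SLH
end strip2

open MeasureTheory Metric Set Filter ENNReal NNReal
open scoped Topology ContDiff RealInnerProductSpace

section geom
variable {n : ℕ}

noncomputable def Pe (e x : EE n) : EE n := x - ⟪e, x⟫ • e

lemma Pe_add (e x y : EE n) : Pe e (x + y) = Pe e x + Pe e y := by
  unfold Pe; rw [inner_add_right, add_smul]; abel
lemma Pe_sub (e x y : EE n) : Pe e (x - y) = Pe e x - Pe e y := by
  unfold Pe; rw [inner_sub_right, sub_smul]; abel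
lemma Pe_smul (e x : EE n) (t : ℝ) : Pe e (t • x) = t • Pe e x := by
  unfold Pe; rw [inner_smul_right, smul_sub, smul_smul]
lemma Pe_self {e : EE n} (he : ‖e‖ = 1) (t : ℝ) : Pe e (t • e) = 0 := by
  unfold Pe; rw [inner_smul_right, real_inner_self_eq_norm_sq, he]; simp
lemma inner_e_self {e : EE n} (he : ‖e‖ = 1) (t : ℝ) : ⟪e, t • e⟫ = t := by
  rw [inner_smul_right, real_inner_self_eq_norm_sq, he]; simp
lemma norm_te {e : EE n} (he : ‖e‖ = 1) {t : ℝ} (ht : 0 ≤ t) : ‖t • e‖ = t := by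
  rw [norm_smul, he, mul_one, Real.norm_eq_abs, abs_of_nonneg ht]
lemma Pe_cont (e : EE n) : Continuous (Pe e) := by unfold Pe; fun_prop

lemma Pe_sq {e : EE n} (he : ‖e‖ = 1) (x : EE n) : ‖Pe e x‖ ^ 2 = qf e x := by
  unfold Pe qf
  rw [norm_sub_sq_real, inner_smul_right, norm_smul, he, real_inner_comm, mul_one,
      Real.norm_eq_abs, sq_abs]; ring

lemma norm_sq_Pe {e : EE n} (he : ‖e‖ = 1) (x : EE n) : ‖x‖ ^ 2 = ‖Pe e x‖ ^ 2 + ⟪e, x⟫ ^ 2 := by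
  rw [Pe_sq he]; unfold qf; ring

lemma Pe_le {e : EE n} (he : ‖e‖ = 1) (x : EE n) : ‖Pe e x‖ ≤ ‖x‖ := by
  refine abs_le_of_sq_le_sq' ?_ (norm_nonneg _) |>.2
  rw [norm_sq_Pe he x]; linarith [sq_nonneg ⟪e, x⟫]

lemma inner_e_le {e : EE n} (he : ‖e‖ = 1) (x : EE n) : |⟪e, x⟫| ≤ ‖x‖ := by
  have := abs_real_inner_le_norm e x; rwa [he, one_mul] at this

lemma norm_le_Pe {e : EE n} (he : ‖e‖ = 1) (x : EE n) : ‖x‖ ≤ ‖Pe e x‖ + |⟪e, x⟫| := by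
  refine abs_le_of_sq_le_sq' ?_ (by positivity) |>.2
  rw [norm_sq_Pe he x, add_sq, sq_abs]
  have : 0 ≤ 2 * ‖Pe e x‖ * |⟪e, x⟫| := by positivity
  linarith

lemma qf_le_iff {e : EE n} (he : ‖e‖ = 1) (x : EE n) {c : ℝ} (hc : 0 ≤ c) :
    qf e x ≤ c ^ 2 ↔ ‖Pe e x‖ ≤ c := by
  rw [← Pe_sq he]; exact sq_le_sq₀ (norm_nonneg _) hc

def Cy (e : EE n) (R : ℝ) : Set (EE n) := {x | ‖Pe e x‖ < R ∧ |⟪e, x⟫| < 1 / 4}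

lemma Cy_mono {e : EE n} {R R' : ℝ} (h : R ≤ R') : Cy e R ⊆ Cy e R' :=
  fun _ hx => ⟨lt_of_lt_of_le hx.1 h, hx.2⟩

lemma Cy_convex (e : EE n) (R : ℝ) : Convex ℝ (Cy e R) := by
  intro x hx y hy a b ha hb hab
  rcases ha.eq_or_lt with h0 | ha'
  · have : b = 1 := by linarith
    rw [← h0, this]; simpa using hy
  refine ⟨?_, ?_⟩
  · rw [Pe_add, Pe_smul, Pe_smul]
    refine lt_of_le_of_lt (norm_add_le _ _) ?_
    rw [norm_smul, norm_smul, Real.norm_eq_abs, Real.norm_eq_abs, abs_of_nonneg ha, abs_of_nonneg hb]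
    have h1 : a * ‖Pe e x‖ < a * R := by gcongr; exact hx.1
    have h2 : b * ‖Pe e y‖ ≤ b * R := by gcongr; exact hy.1.le
    have : a * R + b * R = R := by rw [← add_mul, hab, one_mul]
    linarith
  · rw [inner_add_right, inner_smul_right, inner_smul_right]
    have h1 := abs_lt.1 hx.2
    have h2 := abs_lt.1 hy.2
    rw [abs_lt]
    constructor <;> nlinarith

lemma Cy_near {e : EE n} (he : ‖e‖ = 1) {R : ℝ} (hR : R ≤ 9 / 10) {x y : EE n} (hx : x ∈ Cy e R)
    (hy : ‖y - x‖ ≤ 1 / 16) : y ∈ ball (0 : EE n) 1 := by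
  rw [mem_ball_zero_iff]
  have h1 : ‖x‖ ≤ 15 / 16 - 1 / 1000 := by
    refine abs_le_of_sq_le_sq' ?_ (by norm_num) |>.2
    rw [norm_sq_Pe he x]
    have h2 := hx.1
    have h3 := abs_lt.1 hx.2
    have : ‖Pe e x‖ ^ 2 ≤ (9 / 10) ^ 2 := by gcongr; linarith
    nlinarith
  have : ‖y‖ ≤ ‖x‖ + ‖y - x‖ := by
    have := norm_add_le x (y - x); rwa [add_sub_cancel] at this
  linarith

lemma Cy_ball {e : EE n} (he : ‖e‖ = 1) {R : ℝ} (hR : R ≤ 9 / 10) {x : EE n} (hx : x ∈ Cy e R) :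
    x ∈ ball (0 : EE n) 1 := Cy_near he hR hx (by simp)

/-- one-point domination -/
def DomAt (u U : EE n → ℝ) (e : EE n) (s b : ℝ) (x : EE n) : Prop :=
  ∀ y, ‖y - (x - s • e)‖ ≤ s * b → u y ≤ U x

lemma DomAt.mono {u U : EE n → ℝ} {e : EE n} {s b b' : ℝ} {x : EE n} (h : DomAt u U e s b x)
    (hs : 0 ≤ s) (hb : b' ≤ b) : DomAt u U e s b' x := fun y hy =>
  h y (hy.trans (by gcongr))

lemma DomAt.half {u U : EE n → ℝ} {e : EE n} (he : ‖e‖ = 1) {t τ : ℝ} {x : EE n}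
    (h : DomAt u U e t (1 - τ) x) (ht : 0 ≤ t) : DomAt u U e (t / 2) (1 - 2 * τ) x := fun y hy => by
  apply h y
  have e1 : y - (x - t • e) = (y - (x - (t / 2) • e)) + (t / 2) • e := by
    have : t • e = (t / 2) • e + (t / 2) • e := by rw [← add_smul]; ring_nf
    rw [this]; abel
  rw [e1]
  refine (norm_add_le _ _).trans ?_
  rw [norm_te he (by linarith)]; nlinarith

def Flat (e : EE n) (ε : ℝ) (u : EE n → ℝ) : Prop :=
  ∀ x ∈ ball (0 : EE n) 1, max (⟪e, x⟫ - ε) 0 ≤ u x ∧ u x ≤ max (⟪e, x⟫ + ε) 0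

/-- geometry of `y ∈ B(x - s e, s b)` -/
lemma dom_geom {e : EE n} (he : ‖e‖ = 1) {s b : ℝ} (hs : 0 ≤ s) (hb : b ≤ 1) {x y : EE n}
    (hy : ‖y - (x - s • e)‖ ≤ s * b) : ‖y - x‖ ≤ 2 * s ∧ ⟪e, y⟫ ≤ ⟪e, x⟫ - s * (1 - b) := by
  have hsb : s * b ≤ s := by nlinarith
  constructor
  · have e1 : y - x = (y - (x - s • e)) + (-(s • e)) := by abel
    rw [e1]
    refine (norm_add_le _ _).trans ?_
    rw [norm_neg, norm_te he hs]; linarith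
  · have h1 := (abs_le.1 ((inner_e_le he (y - (x - s • e))).trans hy)).2
    rw [inner_sub_right, inner_sub_right, inner_e_self he] at h1
    linarith

lemma Flat.start {e : EE n} (he : ‖e‖ = 1) {ε : ℝ} {u : EE n → ℝ} (h : Flat e ε u) {R t τ : ℝ}
    (hR : R ≤ 9 / 10) (ht : 0 ≤ t) (ht1 : t ≤ 1 / 32) (hτ : 0 ≤ τ) (htτ : 2 * ε ≤ t * τ) {x : EE n}
    (hx : x ∈ Cy e R) : DomAt u u e t (1 - τ) x := by
  intro y hy
  obtain ⟨h1, h2⟩ := dom_geom he ht (by linarith) hy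
  have h3 := (h y (Cy_near he hR hx (by linarith))).2
  have h4 := (h x (Cy_ball he hR hx)).1
  have : ⟪e, y⟫ + ε ≤ ⟪e, x⟫ - ε := by linarith
  exact h3.trans ((max_le_max this le_rfl).trans h4)

lemma Flat.zero {e : EE n} {ε : ℝ} {u : EE n → ℝ} (h : Flat e ε u) {x : EE n}
    (hx : x ∈ ball (0 : EE n) 1) (hxe : ⟪e, x⟫ ≤ -ε) : u x = 0 := by
  have h1 := h x hx
  rw [max_eq_right (by linarith : ⟪e, x⟫ + ε ≤ 0)] at h1
  exact le_antisymm h1.2 ((le_max_right _ _).trans h1.1)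

lemma Flat.pos {e : EE n} {ε : ℝ} {u : EE n → ℝ} (h : Flat e ε u) {x : EE n}
    (hx : x ∈ ball (0 : EE n) 1) (hxe : ε < ⟪e, x⟫) : 0 < u x := by
  have h1 := (h x hx).1
  have := le_max_left (⟪e, x⟫ - ε) 0
  linarith

lemma Flat.close {e : EE n} {ε : ℝ} {u : EE n → ℝ} (h : Flat e ε u) {x : EE n}
    (hx : x ∈ ball (0 : EE n) 1) (hxe : -ε ≤ ⟪e, x⟫) : |u x - ⟪e, x⟫| ≤ ε := by
  have h1 := h x hx
  rw [max_eq_left (by linarith : 0 ≤ ⟪e, x⟫ + ε)] at h1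
  have := le_max_left (⟪e, x⟫ - ε) 0
  rw [abs_le]; constructor <;> linarith

lemma Flat.far {e : EE n} (he : ‖e‖ = 1) {ε : ℝ} {u : EE n → ℝ} {G : EE n → EE n} (hu : Sol u G)
    (h : Flat e ε u) {R s τ : ℝ} (hε : 0 ≤ ε) (hε1 : ε < 1 / 32)
    (hR : R ≤ 9 / 10) (hs : 0 ≤ s) (hs1 : s ≤ 1 / 64) (hτ : 0 ≤ τ) (hετ : 32 * CG n * ε ≤ τ) {x : EE n}
    (hx : x ∈ Cy e R) (hfar : 1 / 8 ≤ |⟪e, x⟫|) : DomAt u u e s (1 - τ) x := by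
  intro y hy
  obtain ⟨h1, h2⟩ := dom_geom he hs (by linarith) hy
  have hxb := Cy_ball he hR hx
  have hyb := Cy_near he hR hx (y := y) (by linarith)
  have hsτ : 0 ≤ s * τ := by positivity
  rcases le_abs.1 hfar with hf | hf
  · have hm : ∀ z ∈ ball x (1 / 16), z ∈ ball (0 : EE n) 1 ∧ ε < ⟪e, z⟫ := by
      intro z hz
      rw [mem_ball, dist_eq_norm] at hz
      refine ⟨Cy_near he hR hx hz.le, ?_⟩
      have := (abs_le.1 ((inner_e_le he (z - x)).trans hz.le)).1
      rw [inner_sub_right] at this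
      linarith
    have hH : Hm (fun z => u z - ⟪e, z⟫) (ball x (1 / 16)) := by
      refine Hm.sub (hu.harm.mono isOpen_ball ?_) (Hm.inner e isOpen_ball)
      intro z hz
      exact ⟨(hm z hz).1, h.pos (hm z hz).1 (hm z hz).2⟩
    have := osc1 hH (m := ε) (fun z hz => h.close (hm z hz).1 (by linarith [(hm z hz).2]))
      (by norm_num) (y := y) (by linarith)
    have h3 : CG n * ε * ‖y - x‖ / (1 / 16) ≤ s * τ := by
      have hc := CG_ge (n := n)
      have : CG n * ε * ‖y - x‖ ≤ CG n * ε * (2 * s) := by gcongr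
      rw [div_le_iff₀ (by norm_num)]
      nlinarith
    have h4 := (abs_le.1 this).2
    linarith
  · rw [h.zero hyb (by linarith)]
    exact hu.nonneg x hxb

/-- cone lemma -/
lemma cone {u : EE n → ℝ} {e : EE n} (he : ‖e‖ = 1) {S : Set (EE n)} (hS : Convex ℝ S) {t τ : ℝ}
    (ht : 0 < t) (hmon : ∀ x ∈ S, DomAt u u e t (1 - τ) x) (hτ : 0 ≤ τ) (hτ1 : τ ≤ 1) {x v : EE n}
    (hx : x ∈ S) (hxv : x - v ∈ S) (htv : t ≤ ‖v‖) (hv0 : 0 < ⟪e, v⟫)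
    (hv : 4 * τ * ‖v‖ ^ 2 ≤ ⟪e, v⟫ ^ 2) : u (x - v) ≤ u x := by
  have hvp : 0 < ‖v‖ := by linarith
  have hc1 := (le_abs_self _).trans (inner_e_le he v)
  set c := ⟪e, v⟫ with hc
  set B := ‖v‖ ^ 2 / (c * t) with hB
  have hB1 : 1 ≤ B := by
    rw [hB, le_div_iff₀ (by positivity)]
    nlinarith
  set j := ⌈B⌉₊ with hj
  have hj1 : B ≤ j := Nat.le_ceil B
  have hj2 : (j : ℝ) ≤ 2 * B := by
    have := (Nat.ceil_lt_add_one (by linarith : 0 ≤ B)).le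
    linarith
  have hjp : (0 : ℝ) < j := by linarith
  have hstep : ‖t • e - (1 / (j : ℝ)) • v‖ ≤ t * (1 - τ) := by
    refine abs_le_of_sq_le_sq' ?_ (mul_nonneg ht.le (by linarith)) |>.2
    rw [norm_sub_sq_real, inner_smul_left, inner_smul_right, norm_te he ht.le, norm_smul, ← hc]
    simp only [conj_trivial, Real.norm_eq_abs]
    rw [abs_of_pos (by positivity)]
    have h1 : ‖v‖ ^ 2 ≤ j * (c * t) := by rwa [hB, div_le_iff₀ (by positivity)] at hj1
    have h2 : j * (c * t) ≤ 2 * ‖v‖ ^ 2 := by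
      have : 2 * B * (c * t) = 2 * ‖v‖ ^ 2 := by rw [hB]; field_simp
      rw [← this]; gcongr
    -- (‖v‖² - j c t)(‖v‖²-...)...
    have h3 : (1 / (j:ℝ) * ‖v‖) ^ 2 - 2 * (t * (1 / j * c)) + 2 * τ * t ^ 2 ≤ 0 := by
      have e1 : (1 / (j:ℝ) * ‖v‖) ^ 2 - 2 * (t * (1 / j * c)) + 2 * τ * t ^ 2 =
        (‖v‖ ^ 2 - 2 * (j * (c * t)) + 2 * τ * t ^ 2 * j ^ 2) / j ^ 2 := by field_simp
      rw [e1]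
      apply div_nonpos_of_nonpos_of_nonneg _ (by positivity)
      have h4 : τ * t ^ 2 * j ^ 2 * (4 * ‖v‖ ^ 2) ≤ (j * (c * t)) ^ 2 := by
        have : (j * t) ^ 2 * (4 * τ * ‖v‖ ^ 2) ≤ (j * t) ^ 2 * c ^ 2 := by gcongr
        nlinarith
      have h5 : (j * (c * t)) ^ 2 ≤ (2 * ‖v‖ ^ 2) * (j * (c * t)) := by
        rw [sq]; gcongr
      have h6 : τ * t ^ 2 * j ^ 2 ≤ (j * (c * t)) / 2 := by
        have : (τ * t ^ 2 * j ^ 2) * (4 * ‖v‖ ^ 2) ≤ ((j * (c * t)) / 2) * (4 * ‖v‖ ^ 2) := by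
          nlinarith
        exact le_of_mul_le_mul_right this (by positivity)
      linarith
    nlinarith [mul_nonneg (sq_nonneg t) (sq_nonneg τ)]
  have hind : ∀ i : ℕ, i ≤ j → u (x - ((i : ℝ) / j) • v) ≤ u x := by
    intro i
    induction i with
    | zero => intro _; simp
    | succ i ih =>
      intro hi
      refine le_trans ?_ (ih (by omega))
      have hmem : x - ((i : ℝ) / j) • v ∈ S := by
        have e1 : x - ((i : ℝ) / j) • v = (1 - (i : ℝ) / j) • x + ((i : ℝ) / j) • (x - v) := by
          module
        rw [e1]
        have : (i : ℝ) / j ≤ 1 := by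
          rw [div_le_one hjp]; exact_mod_cast (by omega : i ≤ j)
        exact hS hx hxv (by linarith) (by positivity) (by ring)
      apply hmon _ hmem
      have e2 : x - (((i + 1 : ℕ) : ℝ) / j) • v - (x - ((i : ℝ) / j) • v - t • e) =
        t • e - (1 / (j : ℝ)) • v := by
        push_cast; rw [add_div]; module
      rw [e2]; exact hstep
  have := hind j le_rfl
  rwa [div_self hjp.ne', one_smul] at this

end geom

open MeasureTheory Metric Set Filter ENNReal NNReal
open scoped Topology ContDiff RealInnerProductSpace

section loss
variable {n : ℕ}

noncomputable def LC (n : ℕ) : ℝ := 2560 * CH n * CG n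

lemma LC_ge : 30720 ≤ LC n := by
  unfold LC; nlinarith [CH_ge (n := n), CG_ge (n := n)]

/-- linear-algebra end of the loss lemma -/
lemma loss_alg {u : EE n → ℝ} {e a x : EE n} (he : ‖e‖ = 1) {t τ η γ s σ : ℝ} (ht : 0 < t)
    (hτ : 0 ≤ τ) (hτ1 : τ ≤ 1) (hη : 0 ≤ η) (hη1 : 16 * η ≤ σ - τ) (hσ : σ ≤ 1) (hγ : 0 ≤ γ)
    (hγt : γ * t = u x - u (x - t • e))
    (htay : ∀ h : EE n, ‖h‖ ≤ 2 * t → |u (x + h) - u x - ⟪a, h⟫| ≤ η * γ * ‖h‖ ^ 2 / t)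
    (hmon : DomAt u u e t (1 - τ) x) (hs : 0 < s) (hst : s ≤ t) : DomAt u u e s (1 - σ) x := by
  have key1 : (1 - τ) * ‖a‖ ≤ ⟪e, a⟫ + 4 * η * γ := by
    set h : EE n := t • (-e + ((1 - τ) * ‖a‖⁻¹) • a) with hh
    have hb : ‖((1 - τ) * ‖a‖⁻¹) • a‖ ≤ 1 - τ := by
      rw [norm_smul, Real.norm_eq_abs, abs_of_nonneg (by have : 0 ≤ 1 - τ := by linarith
                                                         positivity)]
      rw [mul_assoc]
      have : ‖a‖⁻¹ * ‖a‖ ≤ 1 := inv_mul_le_one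
      have h1 : 0 ≤ 1 - τ := by linarith
      nlinarith
    have hn : ‖h‖ ≤ 2 * t := by
      rw [hh, norm_smul, Real.norm_eq_abs, abs_of_pos ht]
      have := norm_add_le (-e) (((1 - τ) * ‖a‖⁻¹) • a)
      rw [norm_neg, he] at this
      nlinarith
    have h1 := htay h hn
    have h2 : u (x + h) ≤ u x := by
      apply hmon
      have e1 : x + h - (x - t • e) = t • (((1 - τ) * ‖a‖⁻¹) • a) := by rw [hh]; module
      rw [e1, norm_smul, Real.norm_eq_abs, abs_of_pos ht]
      gcongr
    have h3 : ⟪a, h⟫ = t * (-⟪e, a⟫ + (1 - τ) * ‖a‖) := by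
      rw [hh, inner_smul_right, inner_add_right, inner_neg_right, inner_smul_right,
        real_inner_self_eq_norm_sq, real_inner_comm]
      rcases eq_or_ne ‖a‖ 0 with h0 | h0
      · rw [h0]; simp
      · field_simp
    have h4 : η * γ * ‖h‖ ^ 2 / t ≤ 4 * η * γ * t := by
      rw [div_le_iff₀ ht]
      have : ‖h‖ ^ 2 ≤ (2 * t) ^ 2 := by gcongr
      have h5 := mul_le_mul_of_nonneg_left this (mul_nonneg hη hγ)
      nlinarith
    have h5 := (abs_le.1 h1).1
    rw [h3] at h5
    have : t * ((1 - τ) * ‖a‖) ≤ t * (⟪e, a⟫ + 4 * η * γ) := by nlinarith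
    exact le_of_mul_le_mul_left this ht
  have haN : ⟪e, a⟫ ≤ ‖a‖ := (le_abs_self _).trans (inner_e_le he a)
  have key2 : γ ≤ 2 * ‖a‖ := by
    have hn : ‖-(t • e)‖ = t := by rw [norm_neg, norm_te he ht.le]
    have h1 := htay (-(t • e)) (by rw [hn]; linarith)
    rw [hn, inner_neg_right, inner_smul_right, real_inner_comm, ← sub_eq_add_neg] at h1
    have h2 := (abs_le.1 h1).1
    have e1 : η * γ * t ^ 2 / t = η * γ * t := by field_simp
    rw [e1] at h2
    have h3 : t * (γ - η * γ) ≤ t * ⟪e, a⟫ := by nlinarith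
    have h4 := le_of_mul_le_mul_left h3 ht
    nlinarith
  intro y hy
  have hy2 := (dom_geom he hs.le (by linarith : 1 - σ ≤ 1) hy).1
  have h1 := (abs_le.1 (htay (y - x) (by linarith))).2
  rw [add_sub_cancel] at h1
  have h2 : ⟪a, y - x⟫ ≤ -s * ⟪e, a⟫ + ‖a‖ * (s * (1 - σ)) := by
    have e1 : y - x = (y - (x - s • e)) - s • e := by abel
    rw [e1, inner_sub_right, inner_smul_right, real_inner_comm e a]
    have := (real_inner_le_norm a (y - (x - s • e))).trans
      (mul_le_mul_of_nonneg_left hy (norm_nonneg a))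
    linarith
  have h3 : η * γ * ‖y - x‖ ^ 2 / t ≤ 4 * η * γ * s := by
    rw [div_le_iff₀ ht]
    have : ‖y - x‖ ^ 2 ≤ (2 * s) ^ 2 := by gcongr
    have h5 := mul_le_mul_of_nonneg_left this (mul_nonneg hη hγ)
    have h6 : (η * γ) * (s * s) ≤ (η * γ) * (s * t) := by gcongr
    nlinarith
  have h4 : η * γ ≤ η * (2 * ‖a‖) := by gcongr
  have h5 : 16 * η * ‖a‖ ≤ (σ - τ) * ‖a‖ := by gcongr
  have h6 : s * (-⟪e, a⟫ + ‖a‖ * (1 - σ) + 4 * η * γ) ≤ s * 0 := by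
    gcongr; nlinarith
  nlinarith

lemma loss {u : EE n → ℝ} {G : EE n → EE n} (hu : Sol u G) {e x : EE n} (he : ‖e‖ = 1)
    {t d τ σ s : ℝ} (ht : 0 < t) (hd : ball x d ⊆ ball 0 1) (hpos : ∀ w ∈ ball x d, 0 < u w)
    (hmon : ∀ w ∈ ball x d, DomAt u u e t (1 - τ) w) (hτ : 0 ≤ τ) (hτ1 : τ ≤ 1 / 16)
    (hσ : σ ≤ 1) (hdt : LC n * t ≤ (σ - τ) * d) (hστ : τ ≤ σ) (hd0 : 0 < d)
    (hs : 0 < s) (hst : s ≤ t) :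
    DomAt u u e s (1 - σ) x := by
  have hLC := LC_ge (n := n)
  have hCH := CH_ge (n := n)
  have hCG := CG_ge (n := n)
  set ρ := d / 32 with hρ
  have hdρ : d = 32 * ρ := by rw [hρ]; ring
  have hρ0 : 0 < ρ := by positivity
  have htd : 30720 * t ≤ d := by
    have : 30720 * t ≤ LC n * t := by gcongr
    nlinarith
  have htρ : 8 * t ≤ ρ := by linarith
  set D : EE n → ℝ := fun w => u w - u (w - t • e) with hD
  have hin : ∀ w, ‖w - x‖ < d → w ∈ ball x d := fun w hw => by
    rwa [mem_ball, dist_eq_norm]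
  have hHu : Hm u (ball x d) := hu.harm.mono isOpen_ball (fun w hw => ⟨hd hw, hpos w hw⟩)
  have hsh : ∀ w ∈ ball x (d - t), w - t • e ∈ ball x d := by
    intro w hw
    rw [mem_ball, dist_eq_norm] at *
    have e1 : w - t • e - x = (w - x) - t • e := by abel
    rw [e1]
    have := norm_sub_le (w - x) (t • e)
    rw [norm_te he ht.le] at this; linarith
  have hHD : Hm D (ball x (d - t)) := by
    refine (hHu.mono isOpen_ball (ball_subset_ball (by linarith))).sub ?_
    have := (hHu.translate (-(t • e))).mono (isOpen_ball (x := x) (ε := d - t)) (fun w hw => by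
      have := hsh w hw
      rwa [sub_eq_add_neg] at this)
    simpa only [sub_eq_add_neg] using this
  have hDpos : ∀ w ∈ ball x (d - t), 0 ≤ D w := by
    intro w hw
    have hw' : w ∈ ball x d := ball_subset_ball (by linarith) hw
    have := hmon w hw' (w - t • e) (by
      rw [sub_self, norm_zero]
      exact mul_nonneg ht.le (by linarith))
    simp only [hD]; linarith
  have hDx : 0 ≤ D x := hDpos x (mem_ball_self (by linarith))
  have hDle : ∀ w, ‖w - x‖ ≤ 7 * ρ → D w ≤ CH n * D x := fun w hw =>
    harnack1 hHD hDpos (by linarith) (by linarith)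
  -- the chain
  set m := ⌈4 * ρ / t⌉₊ with hm
  have hm1 : 4 * ρ ≤ m * t := by
    have := Nat.le_ceil (4 * ρ / t)
    rwa [div_le_iff₀ ht] at this
  have hm2 : m * t ≤ 5 * ρ := by
    have := Nat.ceil_lt_add_one (by positivity : 0 ≤ 4 * ρ / t)
    have h2 : (m : ℝ) * t ≤ (4 * ρ / t + 1) * t := by gcongr
    have h3 : (4 * ρ / t + 1) * t = 4 * ρ + t := by field_simp
    linarith
  have hup : ∀ i : ℕ, i ≤ m → u (x + (i * t) • e) ≤ u x + i * (CH n * D x) := by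
    intro i
    induction i with
    | zero => intro _; simp
    | succ i ih =>
      intro hi
      have h1 := ih (by omega)
      have hit : ((i + 1 : ℕ) : ℝ) * t ≤ 5 * ρ := by
        refine le_trans ?_ hm2
        gcongr
      have h2 := hDle (x + (((i + 1 : ℕ) : ℝ) * t) • e) (by
        rw [add_sub_cancel_left, norm_te he (by positivity)]; linarith)
      have e1 : x + (((i + 1 : ℕ) : ℝ) * t) • e - t • e = x + (i * t) • e := by
        push_cast; module
      simp only [hD] at h2 h1 ⊢
      rw [e1] at h2
      push_cast at *
      linarith
  have hdn : ∀ i : ℕ, i ≤ m → u x - i * (CH n * D x) ≤ u (x - (i * t) • e) := by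
    intro i
    induction i with
    | zero => intro _; simp
    | succ i ih =>
      intro hi
      have h1 := ih (by omega)
      have hit : (i : ℝ) * t ≤ 5 * ρ := by
        refine le_trans ?_ hm2
        gcongr; omega
      have h2 := hDle (x - ((i : ℝ) * t) • e) (by
        rw [sub_sub_cancel_left, norm_neg, norm_te he (by positivity)]; linarith)
      have e1 : x - ((i : ℝ) * t) • e - t • e = x - (((i + 1 : ℕ) : ℝ) * t) • e := by
        push_cast; module
      simp only [hD] at h2 h1 ⊢
      rw [e1] at h2
      push_cast at *
      linarith
  have hnm : ‖((m : ℝ) * t) • e‖ = m * t := norm_te he (by positivity)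
  have hinx : ⟪e, ((m : ℝ) * t) • e⟫ = m * t := inner_e_self he _
  have hosc : ∀ w ∈ ball x ρ, |u w - u x| ≤ m * (CH n * D x) := by
    intro w hw
    rw [mem_ball, dist_eq_norm] at hw
    have hwe := abs_le.1 ((inner_e_le he (w - x)).trans hw.le)
    have hwd : w ∈ ball x d := hin w (by linarith)
    rw [abs_le]
    constructor
    · have := cone he (convex_ball x d) ht hmon hτ (by linarith) (x := w)
        (v := (w - x) + ((m : ℝ) * t) • e) hwd ?_ ?_ ?_ ?_
      · have e1 : w - (w - x + ((m : ℝ) * t) • e) = x - ((m : ℝ) * t) • e := by abel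
        rw [e1] at this
        linarith [hdn m le_rfl]
      · have e1 : w - (w - x + ((m : ℝ) * t) • e) = x - ((m : ℝ) * t) • e := by abel
        rw [e1]
        apply hin
        rw [sub_sub_cancel_left, norm_neg, hnm]; linarith
      · have := (le_abs_self _).trans (inner_e_le he (w - x + ((m : ℝ) * t) • e))
        rw [inner_add_right, hinx] at this
        linarith
      · rw [inner_add_right, hinx]; linarith
      · rw [inner_add_right, hinx]
        have h1 := norm_add_le (w - x) (((m : ℝ) * t) • e)
        rw [hnm] at h1
        have h2 : ‖w - x + ((m : ℝ) * t) • e‖ ^ 2 ≤ (6 * ρ) ^ 2 := by gcongr; linarith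
        have h3 : (3 * ρ) ^ 2 ≤ (⟪e, w - x⟫ + m * t) ^ 2 := by gcongr; linarith
        nlinarith
    · have := cone he (convex_ball x d) ht hmon hτ (by linarith) (x := x + ((m : ℝ) * t) • e)
        (v := x + ((m : ℝ) * t) • e - w) ?_ ?_ ?_ ?_ ?_
      · rw [_root_.sub_sub_cancel] at this
        linarith [hup m le_rfl]
      · apply hin
        rw [add_sub_cancel_left, hnm]; linarith
      · rwa [_root_.sub_sub_cancel]
      · have := (le_abs_self _).trans (inner_e_le he (x + ((m : ℝ) * t) • e - w))
        rw [inner_sub_right, inner_add_right, hinx] at this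
        rw [inner_sub_right] at hwe
        linarith
      · rw [inner_sub_right, inner_add_right, hinx]
        rw [inner_sub_right] at hwe
        linarith
      · have e1 : x + ((m : ℝ) * t) • e - w = -(w - x) + ((m : ℝ) * t) • e := by abel
        rw [e1, inner_add_right, hinx, inner_neg_right]
        have h1 := norm_add_le (-(w - x)) (((m : ℝ) * t) • e)
        rw [hnm, norm_neg] at h1
        have h2 : ‖-(w - x) + ((m : ℝ) * t) • e‖ ^ 2 ≤ (6 * ρ) ^ 2 := by gcongr; linarith
        have h3 : (3 * ρ) ^ 2 ≤ (-⟪e, w - x⟫ + m * t) ^ 2 := by gcongr; linarith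
        nlinarith
  have hρd : ball x ρ ⊆ ball x d := ball_subset_ball (by linarith)
  have hHf : Hm (fun w => u w - u x) (ball x ρ) :=
    (hHu.mono isOpen_ball hρd).sub (Hm.const _ isOpen_ball)
  have hxd : x ∈ ball x d := mem_ball_self hd0
  have hgrad : ∀ v, fderiv ℝ (fun w => u w - u x) x v = ⟪G x, v⟫ := by
    intro v
    rw [fderiv_sub_const]
    exact hu.Ggrad x (hd hxd) (hpos x hxd) v
  set η := 5 * CH n * CG n * t / ρ with hη
  refine loss_alg (a := G x) (η := η) (γ := D x / t) he ht hτ (by linarith) (by positivity) ?_ hσ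
    (by positivity) ?_ ?_ (hmon x hxd) hs hst
  · have e1 : η * d = 160 * CH n * CG n * t := by rw [hη, hdρ]; field_simp; ring
    have : 16 * η * d ≤ (σ - τ) * d := by
      have : LC n * t = 16 * (160 * CH n * CG n * t) := by unfold LC; ring
      linarith
    exact le_of_mul_le_mul_right this hd0
  · field_simp; simp only [hD]
  · intro h hh
    have := taylor1 hHf hosc hρ0 (y := x + h) (by rw [add_sub_cancel_left]; linarith)
    rw [hgrad, add_sub_cancel_left] at this
    simp only [sub_self, sub_zero] at this
    refine this.trans ?_
    have e1 : η * (D x / t) * ‖h‖ ^ 2 / t = (5 * ρ) * (CG n * CH n * D x * ‖h‖ ^ 2 / (t * ρ ^ 2)) := by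
      rw [hη]; field_simp
    have e2 : CG n * (m * (CH n * D x)) * ‖h‖ ^ 2 / ρ ^ 2 =
      (m * t) * (CG n * CH n * D x * ‖h‖ ^ 2 / (t * ρ ^ 2)) := by field_simp
    rw [e1, e2]
    gcongr

end loss

open MeasureTheory Metric Set Filter ENNReal NNReal
open scoped Topology ContDiff RealInnerProductSpace

section halfstep
variable {n : ℕ}

lemma inner_Pe {e : EE n} (he : ‖e‖ = 1) (x : EE n) : ⟪e, Pe e x⟫ = 0 := by
  unfold Pe; rw [inner_sub_right, inner_smul_right, real_inner_self_eq_norm_sq, he]; ring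

lemma Pe_Pe {e : EE n} (he : ‖e‖ = 1) (x : EE n) : Pe e (Pe e x) = Pe e x := by
  have := inner_Pe he x
  change Pe e x - ⟪e, Pe e x⟫ • e = Pe e x
  rw [this]; simp

lemma Pe_line {e : EE n} (he : ‖e‖ = 1) (x : EE n) (h : ℝ) : Pe e (Pe e x + h • e) = Pe e x := by
  rw [Pe_add, Pe_Pe he, Pe_self he, add_zero]

lemma inner_line {e : EE n} (he : ‖e‖ = 1) (x : EE n) (h : ℝ) : ⟪e, Pe e x + h • e⟫ = h := by
  rw [inner_add_right, inner_Pe he, inner_e_self he, zero_add]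

lemma line_eq (e x : EE n) : Pe e x + ⟪e, x⟫ • e = x := by unfold Pe; abel

lemma Flat.top_zero {e : EE n} (he : ‖e‖ = 1) {ε : ℝ} {u : EE n → ℝ} {G : EE n → EE n}
    (hu : Sol u G) (h : Flat e ε u) (hε0 : 0 ≤ ε) (hε : ε ≤ 1 / 8) {x : EE n} {R : ℝ} (hR : R ≤ 9 / 10)
    (hx : ‖Pe e x‖ < R) : ∃ z : EE n, Pe e z = Pe e x ∧ |⟪e, z⟫| ≤ ε ∧ u z = 0 ∧
      ∀ δ : ℝ, 0 < δ → ⟪e, z⟫ + δ < 1 / 4 → 0 < u (z + δ • e) := by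
  have hc : ∀ h' : ℝ, |h'| < 1 / 4 → Pe e x + h' • e ∈ ball (0 : EE n) 1 := fun h' hh =>
    Cy_ball he hR ⟨by rw [Pe_line he]; exact hx, by rw [inner_line he]; exact hh⟩
  have hcl : ContinuousOn (fun h' : ℝ => u (Pe e x + h' • e)) (Icc (-(1 / 8)) (1 / 8)) := by
    refine hu.cont.comp (by fun_prop) (fun h' hh => hc h' ?_)
    rw [abs_lt]; constructor <;> linarith [hh.1, hh.2]
  set Z := Icc (-(1 / 8) : ℝ) (1 / 8) ∩ (fun h' : ℝ => u (Pe e x + h' • e)) ⁻¹' {0} with hZ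
  have hZc : IsClosed Z := hcl.preimage_isClosed_of_isClosed isClosed_Icc isClosed_singleton
  have hZcpt : IsCompact Z := isCompact_Icc.of_isClosed_subset hZc inter_subset_left
  have hm : -ε ∈ Z := by
    refine ⟨⟨by linarith, by linarith⟩, ?_⟩
    refine h.zero (hc _ ?_) ?_
    · rw [abs_lt]; constructor <;> linarith
    · rw [inner_line he]
  have hs := hZcpt.sSup_mem ⟨_, hm⟩
  set s := sSup Z with hsdef
  have hle : ∀ t ∈ Z, t ≤ s := fun t ht => le_csSup hZcpt.bddAbove ht
  have hs1 : s ≤ ε := by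
    by_contra hcon
    push Not at hcon
    have hs2 := hs.1.2
    have h1 := h.pos (hc s (by rw [abs_lt]; constructor <;> linarith)) (by rw [inner_line he]; exact hcon)
    exact absurd hs.2 h1.ne'
  refine ⟨Pe e x + s • e, Pe_line he x s, ?_, hs.2, ?_⟩
  · rw [inner_line he, abs_le]; exact ⟨hle _ hm, hs1⟩
  · intro δ hδ hδ1
    rw [inner_line he] at hδ1
    have e1 : Pe e x + s • e + δ • e = Pe e x + (s + δ) • e := by module
    rw [e1]
    have hb := hc (s + δ) (by rw [abs_lt]; constructor <;> linarith [hle _ hm])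
    rcases lt_or_ge ε (s + δ) with h1 | h1
    · exact h.pos hb (by rw [inner_line he]; exact h1)
    · refine lt_of_le_of_ne (hu.nonneg _ hb) (fun h0 => ?_)
      have := hle (s + δ) ⟨⟨by linarith [hle _ hm], by linarith⟩, h0.symm⟩
      linarith

/-- data for the half step -/
structure HS (u : EE n → ℝ) (G : EE n → EE n) (e : EE n) (ε K R t τ σ ℓ : ℝ) : Prop where
  hn : 1 ≤ n
  hu : Sol u G
  he : ‖e‖ = 1
  hflat : Flat e ε u
  hε0 : 0 ≤ ε
  hε : ε ≤ 1 / 64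
  hK : 3 * (n : ℝ) ≤ K
  hR : R ≤ 9 / 10
  ht : 0 < t
  htℓ : 64 * t ≤ ℓ
  hℓ : ℓ ≤ 1 / 16
  hτ : 0 ≤ τ
  hτ1 : τ * (20000 * K ^ 2) ≤ 1
  hστ : τ ≤ σ
  hσ : σ ≤ 1 / 4
  hLC : 8 * (LC n * t) ≤ (σ - τ) * ℓ
  hεσ : 32 * CG n * ε ≤ σ
  hmon : ∀ x ∈ Cy e R, DomAt u u e t (1 - τ) x

lemma cone_alg {K ℓ τ p c : ℝ} (hK : 3 ≤ K) (hτ : 0 ≤ τ) (hτ1 : τ * (20000 * K ^ 2) ≤ 1)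
    (hℓ : 0 < ℓ) (hp0 : 0 ≤ p) (hp : p ≤ 3 * K * ℓ) (hc : ℓ / 16 ≤ c) : 4 * τ * (p ^ 2 + c ^ 2) ≤ c ^ 2 := by
  have h9 : 9 ≤ K ^ 2 := by nlinarith
  have hτs : τ ≤ 1 / 180000 := by nlinarith
  have h1 : p ^ 2 ≤ (3 * K * ℓ) ^ 2 := by gcongr
  have h2 : (ℓ / 16) ^ 2 ≤ c ^ 2 := by gcongr
  have h3 : τ * p ^ 2 ≤ τ * (3 * K * ℓ) ^ 2 := by gcongr
  have h4 : (τ * (20000 * K ^ 2)) * ℓ ^ 2 ≤ 1 * ℓ ^ 2 := by gcongr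
  nlinarith [sq_nonneg c]

namespace HS
variable {u : EE n → ℝ} {G : EE n → EE n} {e : EE n} {ε K R t τ σ ℓ : ℝ}

lemma n1 (h : HS u G e ε K R t τ σ ℓ) : (1 : ℝ) ≤ n := by exact_mod_cast h.hn
lemma K3 (h : HS u G e ε K R t τ σ ℓ) : 3 ≤ K := by linarith [h.n1, h.hK]
lemma ℓ0 (h : HS u G e ε K R t τ σ ℓ) : 0 < ℓ := by linarith [h.ht, h.htℓ]
lemma τs (h : HS u G e ε K R t τ σ ℓ) : τ ≤ 1 / 180000 := by
  have h9 : 9 ≤ K ^ 2 := by nlinarith [h.K3]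
  nlinarith [h.hτ1, h.hτ]

lemma cone' (h : HS u G e ε K R t τ σ ℓ) {x y : EE n} (hx : x ∈ Cy e R) (hy : y ∈ Cy e R)
    (hP : ‖Pe e (x - y)‖ ≤ 3 * K * ℓ) (hc : ℓ / 16 ≤ ⟪e, x - y⟫) : u y ≤ u x := by
  have hc1 := (le_abs_self _).trans (inner_e_le h.he (x - y))
  have := cone h.he (Cy_convex e R) h.ht h.hmon h.hτ (by linarith [h.τs]) (x := x) (v := x - y) hx
    (by rwa [_root_.sub_sub_cancel]) (by linarith [h.htℓ, h.ht]) (by linarith [h.ℓ0])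
    (by rw [norm_sq_Pe h.he]; exact cone_alg h.K3 h.hτ h.hτ1 h.ℓ0 (norm_nonneg _) hP hc)
  rwa [_root_.sub_sub_cancel] at this

lemma top (h : HS u G e ε K R t τ σ ℓ) {x z : EE n} (hzR : ‖Pe e z‖ < R - 3 * K * ℓ)
    (hz1 : |⟪e, z⟫| ≤ ε) (hz0 : u z = 0)
    (hzp : ∀ δ : ℝ, 0 < δ → ⟪e, z⟫ + δ < 1 / 4 → 0 < u (z + δ • e)) (hx : |⟪e, x⟫| ≤ 3 / 16)
    (hxz : ‖Pe e (x - z)‖ ≤ 2 * K * ℓ) (hc : ℓ / 4 ≤ |⟪e, x - z⟫|) :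
    DomAt u u e (t / 2) (1 - σ) x := by
  have he := h.he
  have hℓ0 := h.ℓ0
  have hK3 := h.K3
  have hKℓ : 3 * ℓ ≤ K * ℓ := by gcongr
  have hℓ := h.hℓ
  have ht := h.ht
  have htℓ := h.htℓ
  have hε := h.hε
  have hz2 := abs_le.1 hz1
  have hx2 := abs_le.1 hx
  -- points near x
  have hnear : ∀ w, ‖w - x‖ ≤ ℓ / 8 → w ∈ Cy e R ∧ ‖Pe e (w - z)‖ ≤ 3 * K * ℓ - ℓ := by
    intro w hw
    have h1 := (Pe_le he (w - x)).trans hw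
    have h2 := abs_le.1 ((inner_e_le he (w - x)).trans hw)
    rw [inner_sub_right] at h2
    have e1 : Pe e (w - z) = Pe e (w - x) + Pe e (x - z) := by rw [← Pe_add]; congr 1; abel
    have h3 : ‖Pe e (w - z)‖ ≤ ℓ / 8 + 2 * K * ℓ := by
      rw [e1]; exact (norm_add_le _ _).trans (by linarith)
    have h4 : ‖Pe e w‖ ≤ ‖Pe e z‖ + ‖Pe e (w - z)‖ := by
      have : Pe e w = Pe e z + Pe e (w - z) := by rw [← Pe_add]; congr 1; abel
      rw [this]; exact norm_add_le _ _
    refine ⟨⟨by linarith, ?_⟩, by linarith⟩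
    rw [abs_lt]; constructor <;> linarith
  have hzC : z ∈ Cy e R := ⟨by nlinarith, by rw [abs_lt]; constructor <;> linarith⟩
  rcases le_abs.1 hc with hc | hc
  · have hpos : ∀ w ∈ ball x (ℓ / 8), 0 < u w := by
      intro w hw
      rw [Metric.mem_ball, dist_eq_norm] at hw
      obtain ⟨h1, h2⟩ := hnear w hw.le
      have h3 := (abs_le.1 ((inner_e_le he (w - x)).trans hw.le)).1
      rw [inner_sub_right] at h3 hc
      refine lt_of_lt_of_le (hzp (ℓ / 16) (by positivity) (by linarith)) (h.cone' h1 ?_ ?_ ?_)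
      · refine ⟨?_, ?_⟩
        · rw [Pe_add, Pe_self he, add_zero]; exact hzC.1
        · rw [inner_add_right, inner_e_self he, abs_lt]; constructor <;> linarith
      · rw [← sub_sub, Pe_sub, Pe_self he, sub_zero]; linarith
      · rw [inner_sub_right, inner_add_right, inner_e_self he]; linarith
    refine loss h.hu he ht (d := ℓ / 8) (τ := τ) ?_ hpos ?_ h.hτ (by linarith [h.τs])
      (by linarith [h.hσ]) (by linarith [h.hLC]) h.hστ (by positivity) (by positivity) (by linarith)
    · intro w hw
      rw [Metric.mem_ball, dist_eq_norm] at hw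
      exact Cy_ball he h.hR (hnear w hw.le).1
    · intro w hw
      rw [Metric.mem_ball, dist_eq_norm] at hw
      exact h.hmon w (hnear w hw.le).1
  · intro y hy
    obtain ⟨h1, h2⟩ := dom_geom he (by positivity) (by linarith [h.hστ, h.hτ]) hy
    obtain ⟨h3, h4⟩ := hnear y (by linarith)
    have h5 : 0 ≤ (t / 2) * (1 - (1 - σ)) := mul_nonneg (by positivity) (by linarith [h.hστ, h.hτ])
    rw [inner_sub_right] at hc
    have := h.cone' hzC h3 (by rw [← norm_neg, ← neg_one_smul ℝ, ← Pe_smul, neg_one_smul, neg_sub]; linarith)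
      (by rw [inner_sub_right]; linarith)
    rw [hz0] at this
    exact this.trans (h.hu.nonneg x (Cy_ball he h.hR (hnear x (by simp; linarith)).1))

lemma half (h : HS u G e ε K R t τ σ ℓ) {R' a : ℝ} (hR' : R' ≤ R) (ha : a * (130 * n) ≤ 1)
    (hdom : ∀ x ∈ Cy e R', DomAt u u e (t / 2) (1 - a) x) :
    ∀ x ∈ Cy e (R' - 3 * K * ℓ), DomAt u u e (t / 2) (1 - (σ + a) / 2) x := by
  intro x hx
  have he := h.he
  have hℓ0 := h.ℓ0
  have hK3 := h.K3
  have hKℓ : 3 * ℓ ≤ K * ℓ := by gcongr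
  have hℓ := h.hℓ
  have ht := h.ht
  have htℓ := h.htℓ
  have hε := h.hε
  have hσ0 : 0 ≤ σ := h.hτ.trans h.hστ
  have hn1 := h.n1
  rcases le_or_gt a σ with haσ | haσ
  · exact (hdom x (Cy_mono (by nlinarith) hx)).mono (by positivity) (by linarith)
  have ha1 : a ≤ 1 / 130 := by nlinarith
  rcases le_or_gt (1 / 8) |⟪e, x⟫| with hf | hf
  · exact (Flat.far he h.hu h.hflat h.hε0 (by linarith) h.hR (by positivity) (by linarith) hσ0
      h.hεσ (Cy_mono (by nlinarith) hx) hf).mono (by positivity) (by linarith)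
  obtain ⟨z, hzP, hz1, hz0, hzp⟩ := h.hflat.top_zero he h.hu h.hε0 (by linarith)
    (by nlinarith [h.hR] : R' - 3 * K * ℓ ≤ 9 / 10) hx.1
  have hzR' : ‖Pe e z‖ < R' - 3 * K * ℓ := by rw [hzP]; exact hx.1
  have hzR : ‖Pe e z‖ < R - 3 * K * ℓ := by linarith
  have hPxz : Pe e (x - z) = 0 := by rw [Pe_sub, hzP, sub_self]
  have hz2 := abs_le.1 hz1
  rcases le_or_gt (ℓ / 4) |⟪e, x - z⟫| with hc | hc
  · exact (h.top hzR hz1 hz0 hzp (by linarith) (by rw [hPxz, norm_zero]; positivity) hc).mono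
      (by positivity) (by linarith)
  have hQ : ∀ w ∈ Qs e z ℓ K, ‖Pe e (w - z)‖ ≤ 2 * K * ℓ ∧ w ∈ Cy e R' ∧ |⟪e, w⟫| ≤ 3 / 16 ∧
      ∀ y ∈ closedBall w (8 * (t / 2)), y ∈ Cy e R := by
    intro w hw
    have h1 := (qf_le_iff he _ (by positivity)).1 hw.1
    have h2 := abs_le.1 hw.2
    rw [inner_sub_right] at h2
    have h4 : ‖Pe e w‖ ≤ ‖Pe e z‖ + ‖Pe e (w - z)‖ := by
      have : Pe e w = Pe e z + Pe e (w - z) := by rw [← Pe_add]; congr 1; abel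
      rw [this]; exact norm_add_le _ _
    refine ⟨h1, ⟨by linarith, by rw [abs_lt]; constructor <;> linarith⟩,
      by rw [abs_le]; constructor <;> linarith, ?_⟩
    intro y hy
    rw [mem_closedBall, dist_eq_norm] at hy
    have h5 := (Pe_le he (y - w)).trans hy
    have h6 := abs_le.1 ((inner_e_le he (y - w)).trans hy)
    rw [inner_sub_right] at h6
    have h7 : ‖Pe e y‖ ≤ ‖Pe e w‖ + ‖Pe e (y - w)‖ := by
      have : Pe e y = Pe e w + Pe e (y - w) := by rw [← Pe_add]; congr 1; abel
      rw [this]; exact norm_add_le _ _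
    exact ⟨by linarith, by rw [abs_lt]; constructor <;> linarith⟩
  have S : SLH u u G G e z ℓ K (t / 2) t τ (a - σ) (1 - a) := by
    refine ⟨h.hn, h.hu, h.hu, he, hℓ0, h.hK, by positivity, by linarith, by linarith, ?_, by linarith,
      by linarith, ht, by linarith, h.hτ, ?_, ?_, ?_, ?_, ?_⟩
    · nlinarith
    · have := h.hτ1; nlinarith [mul_nonneg h.hτ (sq_nonneg K)]
    · intro w hw y hy
      exact Cy_ball he h.hR ((hQ w hw).2.2.2 y hy)
    · intro w hw
      exact hdom w (hQ w hw).2.1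
    · intro w hw hwc
      have := h.top hzR hz1 hz0 hzp (hQ w hw).2.2.1 (hQ w hw).1 hwc
      have e1 : 1 - a + (a - σ) = 1 - σ := by ring
      rw [e1]; exact this
    · intro w hw y hy
      exact h.hmon y ((hQ w hw).2.2.2 y hy)
  have hqf : qf e (x - z) = 0 := by rw [← Pe_sq he, hPxz]; simp
  have hxQ : x ∈ Qs e z ℓ K := ⟨by rw [hqf]; positivity, by linarith⟩
  intro y hy
  refine S.strip hxQ (hy.trans ?_)
  have hchi : 1 / 2 ≤ chi e z ℓ K x := by
    unfold chi
    rw [hqf]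
    have : (0 / ℓ ^ 2 + n * (4 - (⟪e, x - z⟫ / ℓ + 1) ^ 2)) / K ^ 2 ≤ 1 / 2 := by
      rw [div_le_iff₀ (by positivity), zero_div, zero_add]
      have := mul_nonneg (by linarith : (0:ℝ) ≤ n) (sq_nonneg (⟪e, x - z⟫ / ℓ + 1))
      have hKn := h.hK
      nlinarith
    linarith
  gcongr
  nlinarith

end HS
end halfstep

open MeasureTheory Metric Set Filter ENNReal NNReal
open scoped Topology ContDiff RealInnerProductSpace

section iterate
variable {n : ℕ}

lemma HS.step {u : EE n → ℝ} {G : EE n → EE n} {e : EE n} {ε K R t τ σ ℓ : ℝ}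
    (h : HS u G e ε K R t τ σ ℓ) (ha : (σ + 2 * τ) * (130 * n) ≤ 1) (j : ℕ) :
    ∀ x ∈ Cy e (R - j * (3 * K * ℓ)), DomAt u u e (t / 2) (1 - (σ + 2 * τ / 2 ^ j)) x := by
  have hKl : 0 ≤ 3 * K * ℓ := by have := h.K3; have := h.ℓ0; positivity
  induction j with
  | zero =>
    intro x hx
    have := (h.hmon x (by simpa using hx)).half h.he h.ht.le
    refine this.mono (by linarith [h.ht]) ?_
    have := h.hτ; have := h.hστ
    rw [pow_zero, div_one]; linarith
  | succ j ih =>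
    have := h.half (R' := R - j * (3 * K * ℓ)) (a := σ + 2 * τ / 2 ^ j)
      (by have : 0 ≤ j * (3 * K * ℓ) := by positivity
          linarith) ?_ ih
    · intro x hx
      have e1 : R - ((j + 1 : ℕ) : ℝ) * (3 * K * ℓ) = R - j * (3 * K * ℓ) - 3 * K * ℓ := by
        push_cast; ring
      rw [e1] at hx
      have e2 : (σ + (σ + 2 * τ / 2 ^ j)) / 2 = σ + 2 * τ / 2 ^ (j + 1) := by
        rw [pow_succ]; field_simp; ring
      rw [← e2]
      exact this x hx
    · refine le_trans ?_ ha
      have h2 : (1 : ℝ) ≤ 2 ^ j := one_le_pow₀ (by norm_num)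
      have h3 : 2 * τ / 2 ^ j ≤ 2 * τ := div_le_self (by linarith [h.hτ]) h2
      gcongr

/-- the smallness scale -/
noncomputable def T0 (n : ℕ) (τ : ℝ) : ℝ := τ / (230400 * (3 * n) * LC n)
/-- the flatness threshold -/
noncomputable def eps0 (n : ℕ) (τ : ℝ) : ℝ := min (1 / 64) (min (τ / (64 * CG n)) (T0 n τ * τ / 8))

lemma T0_pos (hn : 1 ≤ n) {τ : ℝ} (hτ : 0 < τ) : 0 < T0 n τ := by
  have : (0 : ℝ) < n := by exact_mod_cast hn
  have := LC_ge (n := n)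
  unfold T0; positivity

lemma eps0_pos (hn : 1 ≤ n) {τ : ℝ} (hτ : 0 < τ) : 0 < eps0 n τ := by
  have := T0_pos hn hτ
  have := CG_ge (n := n)
  unfold eps0; positivity

set_option maxHeartbeats 1000000 in
lemma mon_iter (hn : 1 ≤ n) {τ : ℝ} (hτ : 0 < τ) (hτ1 : τ * (180000 * n ^ 2) ≤ 1) {ε : ℝ}
    (hε0 : 0 ≤ ε) (hε : ε ≤ eps0 n τ) {u : EE n → ℝ} {G : EE n → EE n} (hu : Sol u G) {e : EE n}
    (he : ‖e‖ = 1) (hfl : Flat e ε u) {t0 : ℝ} (ht0 : T0 n τ / 2 ≤ t0) (ht1 : t0 ≤ T0 n τ) (k : ℕ) :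
    ∀ x ∈ Cy e (85 / 100 + 5 / 100 * (5 / 6) ^ k),
      DomAt u u e (t0 / 2 ^ k) (1 - τ * (1 - 1 / 2 * (3 / 4) ^ k)) x := by
  have hn1 : (1 : ℝ) ≤ n := by exact_mod_cast hn
  have hL := LC_ge (n := n)
  have hG := CG_ge (n := n)
  have hT := T0_pos hn hτ
  have hn2 : (n : ℝ) ≤ n ^ 2 := by nlinarith
  have hτs : τ ≤ 1 / 180000 := by nlinarith
  have hTe : T0 n τ * (230400 * (3 * n) * LC n) = τ := by unfold T0; field_simp
  have ht0p : 0 < t0 := by linarith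
  have hε1 : ε ≤ 1 / 64 := hε.trans (min_le_left _ _)
  have hε2 : ε * (64 * CG n) ≤ τ := by
    have := hε.trans ((min_le_right _ _).trans (min_le_left _ _))
    rwa [le_div_iff₀ (by positivity)] at this
  have hε3 : ε ≤ T0 n τ * τ / 8 := hε.trans ((min_le_right _ _).trans (min_le_right _ _))
  have htL : t0 * LC n * n * 691200 ≤ τ := by
    have : t0 * (230400 * (3 * n) * LC n) ≤ τ := by rw [← hTe]; gcongr
    linarith
  have htL2 : t0 * LC n * 691200 ≤ τ := by
    have : t0 * LC n * 1 ≤ t0 * LC n * n := by gcongr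
    linarith
  induction k with
  | zero =>
    intro x hx
    refine Flat.start he hfl (R := 9 / 10) le_rfl (by positivity) ?_ (by norm_num; linarith) ?_
      (Cy_mono (by norm_num) hx)
    · rw [pow_zero, div_one]; nlinarith
    · rw [pow_zero, pow_zero, div_one]
      have : T0 n τ / 2 * τ ≤ t0 * τ := by gcongr
      linarith
  | succ k ih =>
    set q : ℝ := (3 / 4) ^ k with hq
    have hq0 : 0 < q := by positivity
    have hq1 : q ≤ 1 := pow_le_one₀ (by norm_num) (by norm_num)
    set r : ℝ := (5 / 6) ^ k with hr
    have hr0 : 0 < r := by positivity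
    have hr1 : r ≤ 1 := pow_le_one₀ (by norm_num) (by norm_num)
    have h2k : (1 : ℝ) ≤ 2 ^ k := one_le_pow₀ (by norm_num)
    set ℓ := 128 * LC n * (t0 / 2 ^ k) / (τ * q) with hℓ
    have hℓ0 : 0 < ℓ := by positivity
    have hℓq : ℓ * (τ * q) = 128 * LC n * (t0 / 2 ^ k) := by rw [hℓ]; field_simp
    -- bound `(k+5) ℓ`
    have hkℓ : ((k : ℝ) + 5) * ℓ ≤ 5 * (128 * LC n * t0 / τ) * r := by
      have hb : ((k : ℝ) + 5) ≤ 5 * (5 / 4) ^ k := by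
        have := one_add_mul_le_pow (a := (1 / 4 : ℝ)) (by norm_num) k
        have e1 : (1 + 1 / 4 : ℝ) = 5 / 4 := by norm_num
        rw [e1] at this
        have hk0 : (0 : ℝ) ≤ k := by positivity
        linarith
      have e2 : ℓ = (128 * LC n * t0 / τ) * (2 / 3) ^ k := by
        rw [hℓ, hq]
        have : (2 / 3 : ℝ) ^ k * 2 ^ k * (3 / 4) ^ k = 1 := by
          rw [← mul_pow, ← mul_pow]; norm_num
        field_simp
        linear_combination (-1 : ℝ) * this
      have e3 : (5 / 4 : ℝ) ^ k * (2 / 3) ^ k = r := by rw [hr, ← mul_pow]; norm_num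
      rw [e2, ← e3]
      have := mul_le_mul_of_nonneg_right hb (by positivity : 0 ≤ (128 * LC n * t0 / τ) * (2 / 3 : ℝ) ^ k)
      linarith
    have hB : 128 * LC n * t0 / τ * n ≤ 1 / 5400 := by
      rw [div_mul_eq_mul_div, div_le_iff₀ hτ]; linarith
    have hB1 : 128 * LC n * t0 / τ ≤ 1 / 5400 := by
      rw [div_le_iff₀ hτ]; linarith
    have hℓ1 : ℓ ≤ 1 / 16 := by
      have h1 : 5 * ℓ ≤ ((k : ℝ) + 5) * ℓ := by gcongr; linarith [(Nat.cast_nonneg k : (0:ℝ) ≤ k)]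
      have h2 : 5 * (128 * LC n * t0 / τ) * r ≤ 5 * (1 / 5400) * 1 := by gcongr
      linarith
    have hS : HS u G e ε (3 * n) (85 / 100 + 5 / 100 * r) (t0 / 2 ^ k) (τ * (1 - 1 / 2 * q))
        (τ * (1 - 1 / 2 * q) + τ * q / 16) ℓ := by
      have hτ0 : 0 ≤ τ * (1 - 1 / 2 * q) := mul_nonneg hτ.le (by linarith)
      have hτle : τ * (1 - 1 / 2 * q) ≤ τ := by nlinarith [mul_pos hτ hq0]
      have hτge : τ / 2 ≤ τ * (1 - 1 / 2 * q) := by nlinarith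
      have hτq : τ * q ≤ τ := by nlinarith
      have hτq0 : 0 < τ * q := by positivity
      refine ⟨hn, hu, he, hfl, hε0, hε1, le_rfl, by linarith, by positivity, ?_, hℓ1, hτ0, ?_,
        by linarith, by linarith, ?_, ?_, ih⟩
      · have : 64 * (t0 / 2 ^ k) * (τ * q) ≤ ℓ * (τ * q) := by
          rw [hℓq]
          have hp : 0 < t0 / 2 ^ k := by positivity
          have h3 : τ * q ≤ 1 := by linarith
          have h4 : (t0 / 2 ^ k) * (τ * q) ≤ (t0 / 2 ^ k) * 1 := by gcongr
          have h5 : 128 * (t0 / 2 ^ k) ≤ 128 * (t0 / 2 ^ k) * LC n := by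
            have : 1 ≤ LC n := by linarith
            exact le_mul_of_one_le_right (by positivity) this
          linarith
        exact le_of_mul_le_mul_right this hτq0
      · have : τ * (1 - 1 / 2 * q) * (20000 * (3 * n) ^ 2) ≤ τ * (20000 * (3 * n) ^ 2) := by gcongr
        nlinarith
      · have e1 : (τ * (1 - 1 / 2 * q) + τ * q / 16 - τ * (1 - 1 / 2 * q)) * ℓ = ℓ * (τ * q) / 16 := by ring
        rw [e1, hℓq]
        exact le_of_eq (by ring)
      · linarith
    have hst := hS.step (by
      have hτle : τ * (1 - 1 / 2 * q) ≤ τ := by nlinarith [mul_pos hτ hq0]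
      have hτq : τ * q ≤ τ := by nlinarith
      have : (τ * (1 - 1 / 2 * q) + τ * q / 16 + 2 * (τ * (1 - 1 / 2 * q))) * (130 * n) ≤
        (4 * τ) * (130 * n) := by gcongr; linarith
      nlinarith) (k + 5)
    intro x hx
    have hx' := hst x (Cy_mono ?_ hx)
    · have e1 : t0 / 2 ^ k / 2 = t0 / 2 ^ (k + 1) := by rw [pow_succ]; field_simp
      rw [e1] at hx'
      refine hx'.mono (by positivity) ?_
      have e2 : (3 / 4 : ℝ) ^ (k + 1) = q * (3 / 4) := pow_succ _ _
      have h6 : 2 * (τ * (1 - 1 / 2 * q)) / 2 ^ (k + 5) ≤ τ * q / 16 := by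
        rw [pow_add]
        have h7 : 1 ≤ 2 ^ k * q := by
          rw [hq, ← mul_pow]; exact one_le_pow₀ (by norm_num)
        rw [div_le_iff₀ (by positivity)]
        have h8 : τ * 1 ≤ τ * (2 ^ k * q) := by gcongr
        have h9 := mul_pos hτ hq0
        nlinarith
      rw [e2]; linarith
    · have e2 : (5 / 6 : ℝ) ^ (k + 1) = r * (5 / 6) := pow_succ _ _
      rw [e2]
      push_cast
      have h7 : ((k : ℝ) + 5) * (3 * (3 * n) * ℓ) = 9 * n * (((k : ℝ) + 5) * ℓ) := by ring
      have h8 : 9 * n * (((k : ℝ) + 5) * ℓ) ≤ 9 * n * (5 * (128 * LC n * t0 / τ) * r) := by gcongr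
      have h9 : (128 * LC n * t0 / τ * n) * r ≤ 1 / 5400 * r := by gcongr
      nlinarith

lemma mon_all (hn : 1 ≤ n) {τ : ℝ} (hτ : 0 < τ) (hτ1 : τ * (180000 * n ^ 2) ≤ 1) {ε : ℝ}
    (hε0 : 0 ≤ ε) (hε : ε ≤ eps0 n τ) {u : EE n → ℝ} {G : EE n → EE n} (hu : Sol u G) {e : EE n}
    (he : ‖e‖ = 1) (hfl : Flat e ε u) {s : ℝ} (hs : 0 < s) (hsT : s ≤ T0 n τ) :
    ∀ x ∈ Cy e (85 / 100), DomAt u u e s (1 - τ) x := by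
  intro x hx
  obtain ⟨k, hk1, hk2⟩ := exists_nat_pow_near (x := T0 n τ / s) (y := 2)
    (by rwa [le_div_iff₀ hs, one_mul]) (by norm_num)
  rw [le_div_iff₀ hs] at hk1
  rw [div_lt_iff₀ hs, pow_succ] at hk2
  have := mon_iter hn hτ hτ1 hε0 hε hu he hfl (t0 := 2 ^ k * s) (by linarith) hk1 k x
    (Cy_mono (by have : (0:ℝ) < (5 / 6) ^ k := by positivity
                 linarith) hx)
  have e1 : 2 ^ k * s / 2 ^ k = s := by field_simp
  rw [e1] at this
  refine this.mono hs.le ?_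
  have : (0:ℝ) < (3 / 4) ^ k := by positivity
  nlinarith

lemma cone_all (hn : 1 ≤ n) {τ : ℝ} (hτ : 0 < τ) (hτ1 : τ * (180000 * n ^ 2) ≤ 1) {ε : ℝ}
    (hε0 : 0 ≤ ε) (hε : ε ≤ eps0 n τ) {u : EE n → ℝ} {G : EE n → EE n} (hu : Sol u G) {e : EE n}
    (he : ‖e‖ = 1) (hfl : Flat e ε u) {x y : EE n} (hx : x ∈ Cy e (85 / 100))
    (hy : y ∈ Cy e (85 / 100)) (h0 : 0 ≤ ⟪e, x - y⟫) (hv : 4 * τ * ‖x - y‖ ^ 2 ≤ ⟪e, x - y⟫ ^ 2) :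
    u y ≤ u x := by
  have hn1 : (1 : ℝ) ≤ n := by exact_mod_cast hn
  have hn2 : (1 : ℝ) ≤ n ^ 2 := by nlinarith
  have hτs : τ ≤ 1 / 180000 := by nlinarith
  rcases h0.eq_or_lt with h0 | h0
  · rw [← h0] at hv
    have h1 : ‖x - y‖ ^ 2 ≤ 0 := by nlinarith [sq_nonneg ‖x - y‖]
    have h2 : ‖x - y‖ = 0 := by nlinarith [norm_nonneg (x - y)]
    rw [norm_sub_eq_zero_iff.1 h2]
  have hT := T0_pos hn hτ
  have hc1 := (le_abs_self _).trans (inner_e_le he (x - y))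
  have := cone he (Cy_convex e (85 / 100)) (t := min (T0 n τ) ‖x - y‖) (lt_min hT (by linarith))
    (fun w hw => mon_all hn hτ hτ1 hε0 hε hu he hfl (lt_min hT (by linarith)) (min_le_left _ _) w hw)
    hτ.le (by linarith) (x := x) (v := x - y) hx (by rwa [_root_.sub_sub_cancel]) (min_le_right _ _)
    h0 hv
  rwa [_root_.sub_sub_cancel] at this

end iterate

open MeasureTheory Metric Set Filter ENNReal NNReal
open scoped Topology ContDiff RealInnerProductSpace

section stripmax
variable {n : ℕ}

lemma strip_max {u : EE n → ℝ} {G : EE n → EE n} (hu : Sol u G) {e z : EE n}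
    (he : ‖e‖ = 1) {ℓ K : ℝ} (hℓ : 0 < ℓ) (hK : 0 < K) {f : EE n → ℝ}
    (hf : Hm f (ball 0 1 ∩ {x | 0 < u x})) (hfc : ContinuousOn f (ball 0 1 ∩ closure {x | 0 < u x}))
    (hQ : Qs e z ℓ K ⊆ ball 0 1) {a S : ℝ} (hS : 0 ≤ S)
    (hfb : ∀ x ∈ Qs e z ℓ K, x ∈ closure {x | 0 < u x} → u x = 0 → f x ≤ a)
    (htop : ∀ x ∈ Qs e z ℓ K, x ∈ closure {x | 0 < u x} → ℓ / 4 ≤ |⟪e, x - z⟫| → f x ≤ a)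
    (hall : ∀ x ∈ Qs e z ℓ K, x ∈ closure {x | 0 < u x} → f x ≤ a + S) :
    ∀ x ∈ Qs e z ℓ K, x ∈ closure {x | 0 < u x} → f x ≤ a + S * (1 - chi e z ℓ K x) := by
  intro x1 hx1 hx1c
  rcases hS.eq_or_lt with hS0 | hS0
  · have := hall x1 hx1 hx1c
    rw [← hS0] at this ⊢
    linarith
  by_contra hcon
  push Not at hcon
  set Kc := Qs e z ℓ K ∩ closure {x | 0 < u x} with hKc
  have hcpt : IsCompact Kc := by
    refine (isCompact_closedBall (0 : EE n) 1).of_isClosed_subset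
      ((Qs_closed e z ℓ K).inter isClosed_closure) ?_
    exact fun x hx => ball_subset_closedBall (hQ hx.1)
  set g : EE n → ℝ := fun x => f x + S * chi e z ℓ K x with hg
  have hgc : ContinuousOn g Kc := by
    refine (hfc.mono (fun x hx => ⟨hQ hx.1, hx.2⟩)).add ?_
    exact (continuous_const.mul (chi_cont e z ℓ K)).continuousOn
  obtain ⟨x0, hx0, hmax⟩ := hcpt.exists_isMaxOn ⟨x1, hx1, hx1c⟩ hgc
  have hg0 : a + S < g x0 := by
    have h1 : g x1 ≤ g x0 := hmax ⟨hx1, hx1c⟩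
    simp only [hg] at h1 ⊢
    nlinarith
  have hx0b := hQ hx0.1
  have hchi1 := chi_le_one he hℓ hK hx0.1.2
  have hfa : a < f x0 := by
    simp only [hg] at hg0
    nlinarith
  have hup : 0 < u x0 := by
    refine lt_of_le_of_ne (hu.nonneg x0 hx0b) (fun h => ?_)
    have := hfb x0 hx0.1 hx0.2 h.symm
    linarith
  have hlt : |⟪e, x0 - z⟫| < ℓ / 4 := by
    by_contra h
    push Not at h
    have := htop x0 hx0.1 hx0.2 h
    linarith
  have hlat : qf e (x0 - z) < (2 * K * ℓ) ^ 2 := by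
    have h1 := chi_le he hℓ hK hx0.1.2
    have h2 := hall x0 hx0.1 hx0.2
    have h3 : 0 < chi e z ℓ K x0 := by
      simp only [hg] at hg0
      by_contra h
      push Not at h
      nlinarith
    have h4 : qf e (x0 - z) / (K ^ 2 * ℓ ^ 2) < 1 := by linarith
    rw [div_lt_one (by positivity)] at h4
    nlinarith [mul_pos (pow_pos hK 2) (pow_pos hℓ 2)]
  have hΩo := hf.1
  have hnb : ∀ᶠ x in 𝓝 x0, x ∈ Kc := by
    have h1 : ∀ᶠ x in 𝓝 x0, qf e (x - z) < (2 * K * ℓ) ^ 2 := by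
      have : Continuous (fun x : EE n => qf e (x - z)) := by unfold qf; fun_prop
      exact this.continuousAt.eventually_lt_const hlat
    have h2 : ∀ᶠ x in 𝓝 x0, |⟪e, x - z⟫| < ℓ / 4 := by
      have : Continuous (fun x : EE n => |⟪e, x - z⟫|) := by fun_prop
      exact this.continuousAt.eventually_lt_const hlt
    filter_upwards [h1, h2, hΩo.mem_nhds ⟨hx0b, hup⟩] with x h1 h2 h3
    exact ⟨⟨h1.le, by linarith⟩, subset_closure h3.2⟩
  let E0 := EuclideanSpace.basisFun (Fin n) ℝ
  have hE0 : ∀ i, ‖E0 i‖ = 1 := fun i => E0.orthonormal.1 i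
  set k := 1 / (K ^ 2 * ℓ ^ 2) with hk
  have hk0 : 0 < k := by positivity
  have hi : ∀ i, fderiv ℝ (fun y => fderiv ℝ f y (E0 i)) x0 (E0 i) +
      S * (2 * k * (-1 + (n + 1) * ⟪e, E0 i⟫ ^ 2)) ≤ 0 := by
    intro i
    obtain ⟨c1, c2⟩ := curve2 hΩo hf.2.1 (y0 := x0) ⟨hx0b, hup⟩ (E0 i) 0
    simp only [smul_zero, add_zero, map_zero, mul_zero] at c1 c2
    have hchi : ∀ t : ℝ, chi e z ℓ K (x0 + t • E0 i) = chi e z ℓ K x0 + t * ⟪gchi e z ℓ K x0, E0 i⟫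
        + k * (-1 + (n + 1) * ⟪e, E0 i⟫ ^ 2) * t ^ 2 := by
      intro t
      rw [chi_add he z hℓ hK, inner_smul_right, inner_smul_right, norm_smul, hE0, Real.norm_eq_abs,
        mul_one, sq_abs]
      ring
    set A1 := ⟪gchi e z ℓ K x0, E0 i⟫
    set B1 := k * (-1 + (n + 1) * ⟪e, E0 i⟫ ^ 2) with hB1
    have := second_test (φ := fun t : ℝ => f (x0 + t • E0 i) + S * (chi e z ℓ K x0 + t * A1 + B1 * t ^ 2))
      (φ' := fun t : ℝ => fderiv ℝ f (x0 + t • E0 i) (E0 i) + S * (A1 + B1 * (2 * t)))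
      (L := fderiv ℝ (fun y => fderiv ℝ f y (E0 i)) x0 (E0 i) + S * (B1 * 2)) ?_ ?_ ?_
    · rw [hB1] at this; linarith
    · have hc : ContinuousAt (fun t : ℝ => x0 + t • E0 i) 0 := by fun_prop
      have hc' : Tendsto (fun t : ℝ => x0 + t • E0 i) (𝓝 0) (𝓝 x0) := by
        have := hc.tendsto; simpa using this
      filter_upwards [hc'.eventually hnb] with t ht
      have h1 : g (x0 + t • E0 i) ≤ g x0 := hmax ht
      simp only [hg] at h1
      rw [hchi] at h1
      simpa using h1
    · filter_upwards [c1] with t ht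
      refine ht.add (HasDerivAt.const_mul S ?_)
      have h1 : HasDerivAt (fun t : ℝ => chi e z ℓ K x0 + t * A1) A1 t := by
        simpa using ((hasDerivAt_id t).mul_const A1).const_add (chi e z ℓ K x0)
      have h2 : HasDerivAt (fun t : ℝ => B1 * t ^ 2) (B1 * (2 * t)) t := by
        simpa using (hasDerivAt_pow 2 t).const_mul B1
      exact h1.add h2
    · refine c2.add (HasDerivAt.const_mul S ?_)
      have h2 : HasDerivAt (fun t : ℝ => B1 * (2 * t)) (B1 * 2) 0 := by
        simpa using ((hasDerivAt_id (0:ℝ)).const_mul 2).const_mul B1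
      exact h2.const_add A1
  have hsum := Finset.sum_nonpos (s := Finset.univ) (fun i _ => hi i)
  have hxm : x0 ∈ ball (0:EE n) 1 ∩ {x | 0 < u x} := ⟨hx0b, hup⟩
  rw [Finset.sum_add_distrib, ← lap_basis hΩo hf.2.1 hxm E0,
    hf.2.2 x0 hxm, ← Finset.mul_sum, ← Finset.mul_sum, Finset.sum_add_distrib,
    ← Finset.mul_sum] at hsum
  have hpar : ∑ i, ⟪e, E0 i⟫ ^ 2 = 1 := by
    have := E0.sum_sq_norm_inner_left e
    simp only [Real.norm_eq_abs, sq_abs, he] at this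
    simpa using this
  rw [hpar] at hsum
  simp only [Finset.sum_const, Finset.card_univ, Fintype.card_fin, nsmul_eq_mul] at hsum
  have : 0 < S * (2 * k * 1) := by positivity
  nlinarith

/-- growth scheme -/
lemma growth {D : Set (EE n)} {f ρ : EE n → ℝ} {e : EE n} {p : ℕ} {B θ M0 R0 : ℝ}
    (hρ : ∀ x, ρ x = R0 - ‖Pe e x‖) (hρ0 : ∀ x ∈ D, 0 < ρ x) (hf0 : ∀ x ∈ D, 0 ≤ f x)
    (hM0 : ∀ x ∈ D, f x ≤ M0) (hB : 0 ≤ B) (hθ0 : 0 ≤ θ) (hθ : θ * 2 ^ p ≤ 1 / 2)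
    (hstep : ∀ x ∈ D, ∀ S, (∀ x' ∈ D, ‖Pe e (x' - x)‖ ≤ ρ x / 2 → f x' ≤ S) →
      f x * ρ x ^ p ≤ B + θ * S * ρ x ^ p) : ∀ x ∈ D, f x * ρ x ^ p ≤ 2 * B := by
  have key : ∀ k : ℕ, ∀ x ∈ D, f x * ρ x ^ p ≤ 2 * B + M0 * R0 ^ p * (1 / 2) ^ k := by
    intro k
    induction k with
    | zero =>
      intro x hx
      have h1 := hM0 x hx
      have h0 := hf0 x hx
      have h2 : ρ x ≤ R0 := by rw [hρ]; linarith [norm_nonneg (Pe e x)]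
      have h3 := hρ0 x hx
      have : f x * ρ x ^ p ≤ M0 * R0 ^ p := by gcongr; linarith
      simp; linarith
    | succ k ih =>
      intro x hx
      have h3 := hρ0 x hx
      set M := 2 * B + M0 * R0 ^ p * (1 / 2) ^ k with hM
      have := hstep x hx (M * (2 / ρ x) ^ p) (fun x' hx' hxx => by
        have h4 : ρ x / 2 ≤ ρ x' := by
          rw [hρ] at hxx ⊢; rw [hρ]
          have : Pe e x' = Pe e x + Pe e (x' - x) := by rw [← Pe_add]; congr 1; abel
          have h5 := norm_add_le (Pe e x) (Pe e (x' - x))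
          rw [← this] at h5
          linarith
        have h5 := ih x' hx'
        have h6 : f x' * (ρ x / 2) ^ p ≤ M := by
          refine le_trans ?_ h5
          have := hf0 x' hx'
          gcongr
        have h7 : (2 / ρ x) ^ p = ((ρ x / 2) ^ p)⁻¹ := by rw [← inv_pow, inv_div]
        rw [h7, ← div_eq_mul_inv, le_div_iff₀ (by positivity)]
        exact h6)
      have e1 : θ * (M * (2 / ρ x) ^ p) * ρ x ^ p = (θ * 2 ^ p) * M := by
        rw [div_pow]; field_simp
      rw [e1] at this
      have hM1 : 0 ≤ M := by
        have h5 := ih x hx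
        have := mul_nonneg (hf0 x hx) (pow_nonneg h3.le p)
        linarith
      have h8 : (θ * 2 ^ p) * M ≤ 1 / 2 * M := by gcongr
      rw [pow_succ]
      rw [hM] at h8
      linarith
  intro x hx
  have hlim : Tendsto (fun k : ℕ => 2 * B + M0 * R0 ^ p * (1 / 2 : ℝ) ^ k) atTop
      (𝓝 (2 * B + M0 * R0 ^ p * 0)) :=
    ((_root_.tendsto_pow_atTop_nhds_zero_of_lt_one (by norm_num) (by norm_num)).const_mul _).const_add _
  have := ge_of_tendsto' hlim (fun k => key k x hx)
  simpa using this

lemma Sol.line_up' {u : EE n → ℝ} {G : EE n → EE n} (h : Sol u G) (x v : EE n) {T M : ℝ} (hT : 0 ≤ T)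
    (hM : 0 ≤ M) (hx : ∀ t ∈ Icc 0 T, x + t • v ∈ ball (0 : EE n) 1)
    (hG : ∀ t ∈ Ioo 0 T, 0 < u (x + t • v) → ⟪G (x + t • v), v⟫ ≤ M) :
    u (x + T • v) ≤ u x + M * T := by
  have h0 : 0 ≤ u x := h.nonneg x (by simpa using hx 0 ⟨le_rfl, hT⟩)
  have := oneD_up (g := fun t : ℝ => u (x + t • v) - u x) (g' := fun t => ⟪G (x + t • v), v⟫)
    hT hM ((h.cont_line x v hx).sub continuousOn_const) (by simp)
    (fun t ht hp => ⟨(h.hasDeriv_line x v (hx t ⟨ht.1.le, ht.2.le⟩) (by linarith)).sub_const _,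
      hG t ht (by linarith)⟩)
  simp only [sub_zero] at this
  linarith

end stripmax

open MeasureTheory Metric Set Filter ENNReal NNReal
open scoped Topology ContDiff RealInnerProductSpace

section geomsol
variable {n : ℕ}

lemma Hm.congr {f g : EE n → ℝ} {s : Set (EE n)} (hf : Hm f s) (h : ∀ x ∈ s, g x = f x) : Hm g s := by
  refine ⟨hf.1, hf.2.1.congr h, fun x hx => ?_⟩
  rw [lap_congr (g := f) ((hf.1.eventually_mem hx).mono fun y hy => h y hy)]
  exact hf.2.2 x hx

lemma Cy_open (e : EE n) (R : ℝ) : IsOpen (Cy e R) := by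
  have h1 : IsOpen {x : EE n | ‖Pe e x‖ < R} :=
    isOpen_lt (Pe_cont e).norm continuous_const
  have h2 : IsOpen {x : EE n | |⟪e, x⟫| < 1 / 4} :=
    isOpen_lt (by fun_prop : Continuous fun x : EE n => |⟪e, x⟫|) continuous_const
  exact h1.inter h2

/-- a flat solution with all its smallness assumptions -/
structure GS (u : EE n → ℝ) (G : EE n → EE n) (e : EE n) (ε τ K : ℝ) : Prop where
  hn : 1 ≤ n
  su : Sol u G
  he : ‖e‖ = 1
  fl : Flat e ε u
  hε : 0 ≤ ε
  hε1 : ε ≤ eps0 n τ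
  hε2 : ε * (7680 * n * CG n) ≤ 1
  hτ : 0 < τ
  hK : n ≤ K
  hτ1 : τ * (180000 * K ^ 2) ≤ 1

namespace GS
variable {u : EE n → ℝ} {G : EE n → EE n} {e : EE n} {ε τ K : ℝ} 

lemma n1 (h : GS u G e ε τ K) : (1 : ℝ) ≤ n := by exact_mod_cast h.hn
lemma K1 (h : GS u G e ε τ K) : (1 : ℝ) ≤ K := h.n1.trans h.hK
lemma eps64 (h : GS u G e ε τ K) : ε ≤ 1 / 64 := h.hε1.trans (min_le_left _ _)
lemma eps_n (h : GS u G e ε τ K) : 7680 * n * ε ≤ 1 := by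
  have h1 := CG_ge (n := n)
  have h2 := h.n1
  have h3 := h.hε
  have : 0 ≤ ε * (7680 * n) * (CG n - 1) := by
    have : 0 ≤ CG n - 1 := by linarith
    positivity
  linarith [h.hε2]
lemma tau_n (h : GS u G e ε τ K) : τ * (180000 * n ^ 2) ≤ 1 := by
  have h1 : (n : ℝ) ^ 2 ≤ K ^ 2 := by have := h.hK; have := h.n1; gcongr
  have := h.hτ
  refine le_trans ?_ h.hτ1
  gcongr

lemma ball1 (h : GS u G e ε τ K) {x : EE n} (hx : x ∈ Cy e (85 / 100)) : x ∈ ball (0 : EE n) 1 :=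
  Cy_ball h.he (by norm_num) hx

lemma cone (h : GS u G e ε τ K) {x y : EE n} (hx : x ∈ Cy e (85 / 100)) (hy : y ∈ Cy e (85 / 100))
    (hv : ‖Pe e (x - y)‖ ≤ 200 * K * ⟪e, x - y⟫) : u y ≤ u x := by
  have hK := h.K1
  have h0 : 0 ≤ ⟪e, x - y⟫ := by
    by_contra hc
    push Not at hc
    have := norm_nonneg (Pe e (x - y))
    nlinarith
  refine cone_all h.hn h.hτ h.tau_n h.hε h.hε1 h.su h.he h.fl hx hy h0 ?_
  rw [norm_sq_Pe h.he (x - y)]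
  set c := ⟪e, x - y⟫
  have h1 : ‖Pe e (x - y)‖ ^ 2 ≤ (200 * K * c) ^ 2 := by gcongr
  have h2 := h.hτ1
  have h3 := h.hτ
  have h4 : τ ≤ 1 / 180000 := by nlinarith [h.hτ1, mul_le_mul hK hK (by norm_num) (by linarith)]
  calc 4 * τ * (‖Pe e (x - y)‖ ^ 2 + c ^ 2) ≤ 4 * τ * ((200 * K * c) ^ 2 + c ^ 2) := by gcongr
    _ = (160000 * (τ * K ^ 2) + 4 * τ) * c ^ 2 := by ring
    _ ≤ 1 * c ^ 2 := by gcongr; nlinarith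
    _ = c ^ 2 := one_mul _

lemma vert (h : GS u G e ε τ K) {x : EE n} (hx : x ∈ Cy e (85 / 100)) {t : ℝ} (ht : 0 ≤ t)
    (hxt : x + t • e ∈ Cy e (85 / 100)) : u x ≤ u (x + t • e) := by
  refine h.cone hxt hx ?_
  rw [add_sub_cancel_left, Pe_self h.he, inner_e_self h.he, norm_zero]
  have := h.K1
  positivity

lemma zero_below (h : GS u G e ε τ K) {z y : EE n} (hz : z ∈ Cy e (85 / 100)) (hz0 : u z = 0)
    (hy : y ∈ Cy e (85 / 100)) (hv : ‖Pe e (z - y)‖ ≤ 200 * K * ⟪e, z - y⟫) : u y = 0 :=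
  le_antisymm (hz0 ▸ h.cone hz hy hv) (h.su.nonneg y (h.ball1 hy))

/-- `z` is the top zero on its vertical line -/
structure Top (u : EE n → ℝ) (e : EE n) (ε : ℝ) (z : EE n) : Prop where
  small : |⟪e, z⟫| ≤ ε
  zero : u z = 0
  pos : ∀ δ : ℝ, 0 < δ → ⟪e, z⟫ + δ < 1 / 4 → 0 < u (z + δ • e)

lemma top (h : GS u G e ε τ K) {x : EE n} (hx : ‖Pe e x‖ < 85 / 100) :
    ∃ z : EE n, Pe e z = Pe e x ∧ z ∈ Cy e (85 / 100) ∧ Top u e ε z := by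
  have := h.eps64
  obtain ⟨z, h1, h2, h3, h4⟩ := h.fl.top_zero h.he h.su h.hε (by linarith)
    (by norm_num : (85 / 100 : ℝ) ≤ 9 / 10) hx
  exact ⟨z, h1, ⟨by rw [h1]; exact hx, by linarith⟩, h2, h3, h4⟩

lemma pos_above (h : GS u G e ε τ K) {z y : EE n} (hz : z ∈ Cy e (85 / 100)) (ht : Top u e ε z)
    (hy : y ∈ Cy e (85 / 100)) (hp : 0 < ⟪e, y - z⟫) (hv : ‖Pe e (y - z)‖ ≤ 100 * K * ⟪e, y - z⟫) :
    0 < u y := by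
  set d := ⟪e, y - z⟫ with hd
  have hd' : ⟪e, y⟫ - ⟪e, z⟫ = d := by rw [hd, inner_sub_right]
  have hy2 := abs_lt.1 hy.2
  have hz2 := abs_lt.1 hz.2
  have h1 := ht.pos (d / 2) (by linarith) (by linarith)
  refine lt_of_lt_of_le h1 (h.cone hy ⟨?_, ?_⟩ ?_)
  · rw [Pe_add, Pe_self h.he, add_zero]; exact hz.1
  · rw [inner_add_right, inner_e_self h.he, abs_lt]; constructor <;> linarith
  · have e1 : y - (z + (d / 2) • e) = (y - z) - (d / 2) • e := by abel
    rw [e1, Pe_sub, Pe_self h.he, sub_zero, inner_sub_right, inner_e_self h.he, ← hd]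
    linarith

lemma not_closure (h : GS u G e ε τ K) {z x : EE n} (hz : z ∈ Cy e (85 / 100)) (hz0 : u z = 0)
    (hx : x ∈ Cy e (85 / 100)) (hp : 0 < ⟪e, z - x⟫) (hv : ‖Pe e (z - x)‖ ≤ 100 * K * ⟪e, z - x⟫) :
    x ∉ closure {x | 0 < u x} := by
  intro hc
  have hK := h.K1
  set d := ⟪e, z - x⟫ with hd
  obtain ⟨y, hy, hy0⟩ := mem_closure_iff.1 hc (Cy e (85 / 100) ∩ ball x (d / 4))
    ((Cy_open e _).inter isOpen_ball) ⟨hx, Metric.mem_ball_self (by linarith)⟩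
  have hyx : ‖x - y‖ < d / 4 := by have := hy.2; rwa [Metric.mem_ball, dist_comm, dist_eq_norm] at this
  have e1 : z - y = (z - x) + (x - y) := by abel
  have : u y = 0 := by
    refine h.zero_below hz hz0 hy.1 ?_
    rw [e1, Pe_add, inner_add_right, ← hd]
    have h1 := norm_add_le (Pe e (z - x)) (Pe e (x - y))
    have h2 := Pe_le h.he (x - y)
    have h3 := abs_le.1 (inner_e_le h.he (x - y))
    have h4 : d * 1 ≤ d * K := by gcongr
    have h5 : K * (d / 4) ≥ K * ‖x - y‖ := by gcongr
    nlinarith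
  have hy0' : 0 < u y := hy0
  linarith

lemma clos_above (h : GS u G e ε τ K) {x : EE n} (hx : x ∈ Cy e (85 / 100))
    (hc : x ∈ closure {x | 0 < u x}) : ∃ z : EE n, Pe e z = Pe e x ∧ z ∈ Cy e (85 / 100) ∧ Top u e ε z ∧
      ⟪e, z⟫ ≤ ⟪e, x⟫ := by
  obtain ⟨z, h1, h2, h3⟩ := h.top hx.1
  refine ⟨z, h1, h2, h3, ?_⟩
  by_contra hcon
  push Not at hcon
  have hi : 0 < ⟪e, z - x⟫ := by rw [inner_sub_right]; linarith
  refine h.not_closure h2 h3.zero hx hi ?_ hc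
  rw [Pe_sub, h1, sub_self, norm_zero]
  have := h.K1
  positivity

lemma top_mem_closure (h : GS u G e ε τ K) {z : EE n} (ht : Top u e ε z) :
    z ∈ closure {x | 0 < u x} := by
  have h1 := h.eps64
  have h2 := abs_le.1 ht.small
  rw [Metric.mem_closure_iff]
  intro δ hδ
  refine ⟨z + (min (δ / 2) (1 / 8)) • e, ht.pos _ (by positivity) ?_, ?_⟩
  · have := min_le_right (δ / 2) (1 / 8 : ℝ); linarith
  · rw [dist_eq_norm, sub_add_cancel_left, norm_neg, norm_te h.he (by positivity)]
    have := min_le_left (δ / 2) (1 / 8 : ℝ); linarith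

lemma grad_cone_pos (h : GS u G e ε τ K) {x v : EE n} (hx : x ∈ Cy e (85 / 100)) (hp : 0 < u x)
    (hv : ‖Pe e v‖ ≤ 200 * K * ⟪e, v⟫) : 0 ≤ ⟪G x, v⟫ := by
  have h1 := h.su.hasDeriv_line x v (t := 0) (by simpa using h.ball1 hx) (by simpa using hp)
  simp only [zero_smul, add_zero] at h1
  have h2 := (hasDerivWithinAt_iff_tendsto_slope' (s := Ioi (0:ℝ)) (by simp)).1 h1.hasDerivWithinAt
  refine ge_of_tendsto h2 ?_
  have hc : Tendsto (fun t : ℝ => x + t • v) (𝓝[>] 0) (𝓝 x) := by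
    have : Continuous (fun t : ℝ => x + t • v) := by fun_prop
    simpa using (this.tendsto 0).mono_left nhdsWithin_le_nhds
  filter_upwards [hc.eventually ((Cy_open e _).eventually_mem hx), self_mem_nhdsWithin] with t ht ht0
  have ht0' : (0:ℝ) < t := ht0
  rw [slope_def_field]
  have : u x ≤ u (x + t • v) := by
    refine h.cone ht hx ?_
    rw [add_sub_cancel_left, Pe_smul, inner_smul_right, norm_smul, Real.norm_eq_abs, abs_of_pos ht0']
    nlinarith
  apply div_nonneg <;> simp <;> linarith

lemma ext_closure (h : GS u G e ε τ K) {f : EE n → ℝ} {R c : ℝ} (hR : R ≤ 85 / 100)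
    (hf : ContinuousOn f (ball 0 1 ∩ closure {x | 0 < u x}))
    (hc : ∀ x ∈ Cy e R, 0 < u x → f x ≤ c) {x : EE n} (hx : x ∈ Cy e R)
    (hxc : x ∈ closure {x | 0 < u x}) : f x ≤ c := by
  have hcl : x ∈ closure (Cy e R ∩ {x | 0 < u x}) :=
    (Cy_open e R).inter_closure ⟨hx, hxc⟩
  have h1 := (hf x ⟨h.ball1 (Cy_mono hR hx), hxc⟩).mono (s := Cy e R ∩ {x | 0 < u x})
    (fun y (hy : y ∈ Cy e R ∩ {x | 0 < u x}) => ⟨h.ball1 (Cy_mono hR hy.1), subset_closure hy.2⟩)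
  have : (𝓝[Cy e R ∩ {x | 0 < u x}] x).NeBot := mem_closure_iff_nhdsWithin_neBot.1 hcl
  exact le_of_tendsto h1 (eventually_mem_nhdsWithin.mono fun y hy => hc y hy.1 hy.2)

lemma grad_cone (h : GS u G e ε τ K) {x v : EE n} (hx : x ∈ Cy e (85 / 100))
    (hc : x ∈ closure {x | 0 < u x})
    (hv : ‖Pe e v‖ ≤ 200 * K * ⟪e, v⟫) : 0 ≤ ⟪G x, v⟫ := by
  have := h.ext_closure (f := fun x => - ⟪G x, v⟫) (c := 0) le_rfl
    (h.su.Gcont.inner continuousOn_const).neg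
    (fun x hx hp => by simpa using h.grad_cone_pos hx hp hv) hx hc
  linarith

lemma fb_slope (h : GS u G e ε τ K) {x : EE n} (hx : x ∈ Cy e (85 / 100))
    (hc : x ∈ closure {x | 0 < u x}) (h0 : u x = 0) : 3 / 4 ≤ ⟪e, G x⟫ ∧ ⟪e, G x⟫ ≤ 1 := by
  have h1 := h.su.Gfb x (h.ball1 hx) hc h0
  have hK := h.K1
  have h2 := norm_sq_Pe h.he (G x)
  have h3 := (le_abs_self _).trans (inner_e_le h.he (G x))
  have h4 := h.grad_cone hx hc (v := e - (10:ℝ) • Pe e (G x)) (by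
    rw [Pe_sub, Pe_smul, Pe_Pe, inner_sub_right, inner_smul_right, inner_Pe h.he, real_inner_self_eq_norm_sq, h.he]
    have : Pe e e = 0 := by simpa using Pe_self h.he 1
    rw [this, zero_sub, norm_neg, norm_smul]
    have := Pe_le h.he (G x)
    norm_num
    linarith
    exact h.he)
  have h5 := h.grad_cone hx hc (v := e) (by
    have : Pe e e = 0 := by simpa using Pe_self h.he 1
    rw [this, norm_zero, real_inner_self_eq_norm_sq, h.he]; linarith)
  have h6 : ⟪G x, Pe e (G x)⟫ = ‖Pe e (G x)‖ ^ 2 := by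
    rw [Pe_sq h.he]; unfold Pe qf
    rw [inner_sub_right, inner_smul_right, real_inner_self_eq_norm_sq, real_inner_comm e (G x)]; ring
  rw [inner_sub_right, inner_smul_right, h6] at h4
  rw [real_inner_comm] at h4 h5
  rw [h1] at h2 h3
  refine ⟨?_, h3⟩
  nlinarith

/-- gradient in the region where the solution is close to the plane -/
lemma slope_top (h : GS u G e ε τ K) {x v : EE n} {r : ℝ} (hr : 0 < r)
    (hb : ball x r ⊆ ball (0 : EE n) 1) (hx : ε + r ≤ ⟪e, x⟫) :
    |⟪G x, v⟫ - ⟪e, v⟫| ≤ CG n * ε * ‖v‖ / r := by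
  have hm : ∀ z ∈ ball x r, ε < ⟪e, z⟫ := by
    intro z hz
    rw [Metric.mem_ball, dist_eq_norm] at hz
    have h3 := abs_le.1 (inner_e_le h.he (z - x))
    rw [inner_sub_right] at h3
    linarith
  have hx0 : x ∈ ball x r := Metric.mem_ball_self hr
  have hpos : ∀ z ∈ ball x r, 0 < u z := fun z hz => h.fl.pos (hb hz) (hm z hz)
  have hH : Hm (fun z => u z - ⟪e, z⟫) (ball x r) :=
    (h.su.harm.mono isOpen_ball (fun z hz => ⟨hb hz, hpos z hz⟩)).sub (Hm.inner e isOpen_ball)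
  have h1 := grad1 hH (m := ε) (fun z hz => h.fl.close (hb hz) (by linarith [hm z hz, h.hε])) hr v
  have h2 : fderiv ℝ (fun z => u z - ⟪e, z⟫) x v = ⟪G x, v⟫ - ⟪e, v⟫ := by
    have d1 := smooth_diffAt h.su.harm.1 h.su.harm.2.1 ⟨hb hx0, hpos x hx0⟩
    have d2 : HasFDerivAt (fun z : EE n => ⟪e, z⟫) (innerSL ℝ e) x := (innerSL ℝ e).hasFDerivAt
    have := (d1.hasFDerivAt.sub d2).fderiv
    have h3 : (fun z => u z - ⟪e, z⟫) = (u - fun z : EE n => ⟪e, z⟫) := rfl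
    rw [h3, this]
    simp [h.su.Ggrad x (hb hx0) (hpos x hx0)]
  rwa [h2] at h1

end GS
end geomsol

open MeasureTheory Metric Set Filter ENNReal NNReal
open scoped Topology ContDiff RealInnerProductSpace

section slopes
variable {n : ℕ}

lemma chi_center {e z x : EE n} (he : ‖e‖ = 1) {ℓ K : ℝ} (hP : Pe e (x - z) = 0) :
    1 - chi e z ℓ K x ≤ 4 * n / K ^ 2 := by
  have h1 : qf e (x - z) = 0 := by rw [← Pe_sq he, hP]; simp
  unfold chi
  rw [h1, zero_div, zero_add]
  have e2 : ∀ q : ℝ, 1 - (1 - q) = q := fun q => by ring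
  rw [e2]
  refine div_le_div_of_nonneg_right ?_ (by positivity)
  have : (0:ℝ) ≤ n := by positivity
  nlinarith [sq_nonneg (⟪e, x - z⟫ / ℓ + 1)]

noncomputable def CL (n : ℕ) : ℝ := 50 + 15360 * n * CG n

namespace GS
variable {u : EE n → ℝ} {G : EE n → EE n} {e : EE n} {ε τ K : ℝ} 

lemma pball (h : GS u G e ε τ K) {z x : EE n} (hz : z ∈ Cy e (85 / 100)) (ht : Top u e ε z) {ℓ : ℝ}
    (hℓ : 0 < ℓ) (hb : ball x (ℓ / 16) ⊆ Cy e (85 / 100)) (hx : ℓ / 4 ≤ ⟪e, x - z⟫)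
    (hP : ‖Pe e (x - z)‖ ≤ 12 * K * ℓ) : ∀ y ∈ ball x (ℓ / 16), 0 < u y := by
  intro y hy
  have hK := h.K1
  have hyx : ‖y - x‖ < ℓ / 16 := by rwa [Metric.mem_ball, dist_eq_norm] at hy
  have e1 : y - z = (x - z) + (y - x) := by abel
  have h3 := abs_le.1 (inner_e_le h.he (y - x))
  have hd : 3 * ℓ / 16 ≤ ⟪e, y - z⟫ := by rw [e1, inner_add_right]; linarith
  refine h.pos_above hz ht (hb hy) (by linarith) ?_
  have h1 := norm_add_le (Pe e (x - z)) (Pe e (y - x))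
  have h2 := Pe_le h.he (y - x)
  rw [← Pe_add, ← e1] at h1
  have h4 : 100 * K * (3 * ℓ / 16) ≤ 100 * K * ⟪e, y - z⟫ := by gcongr
  have h5 : ℓ * 1 ≤ ℓ * K := by gcongr
  linarith

lemma ee (h : GS u G e ε τ K) : ⟪e, e⟫ = 1 := by rw [real_inner_self_eq_norm_sq, h.he]; norm_num

lemma slope_hi (h : GS u G e ε τ K) {x : EE n} (hx : x ∈ Cy e (85 / 100)) (hx1 : 1 / (960 * n) ≤ ⟪e, x⟫) :
    3 / 4 ≤ ⟪e, G x⟫ ∧ ⟪e, G x⟫ ≤ 5 / 4 := by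
  have hn := h.n1
  have hr : (0:ℝ) < 1 / (1920 * n) := by positivity
  have hr1 : (1:ℝ) / (1920 * n) ≤ 1 / 1920 := by
    apply one_div_le_one_div_of_le <;> linarith
  have hε : ε + 1 / (1920 * n) ≤ 1 / (960 * n) := by
    have h1 : (1:ℝ) / (960 * n) = 1 / (1920 * n) + 1 / (1920 * n) := by field_simp; norm_num
    have h2 : ε ≤ 1 / (1920 * n) := by
      rw [le_div_iff₀ (by positivity)]; nlinarith [h.eps_n, h.hε]
    linarith
  have hb : ball x (1 / (1920 * n)) ⊆ ball (0 : EE n) 1 := fun y hy => by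
    rw [Metric.mem_ball, dist_eq_norm] at hy
    exact Cy_near h.he (by norm_num) hx (by linarith)
  have h1 := h.slope_top (v := e) hr hb (by linarith)
  rw [h.ee, h.he, real_inner_comm] at h1
  have h2 : CG n * ε * 1 / (1 / (1920 * n)) ≤ 1 / 4 := by
    rw [div_div_eq_mul_div, div_one]; nlinarith [h.hε2]
  have h3 := abs_le.1 (h1.trans h2)
  constructor <;> linarith

lemma harm_e (h : GS u G e ε τ K) : Hm (fun x => ⟪e, G x⟫) (ball 0 1 ∩ {x | 0 < u x}) :=
  (h.su.harm.dir e).congr (fun x hx => by rw [h.su.Ggrad x hx.1 hx.2, real_inner_comm])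

lemma cont_e (h : GS u G e ε τ K) : ContinuousOn (fun x => ⟪e, G x⟫) (ball 0 1 ∩ closure {x | 0 < u x}) :=
  continuousOn_const.inner h.su.Gcont

lemma clos_low (h : GS u G e ε τ K) {x : EE n} (hx : x ∈ Cy e (85 / 100))
    (hc : x ∈ closure {x | 0 < u x}) : -ε ≤ ⟪e, x⟫ := by
  obtain ⟨z, -, -, h3, h4⟩ := h.clos_above hx hc
  linarith [(abs_le.1 h3.small).1]

lemma slope_low (h : GS u G e ε τ K) {x : EE n} (hx : x ∈ Cy e (80 / 100))
    (hc : x ∈ closure {x | 0 < u x}) : 1 / 2 ≤ ⟪e, G x⟫ := by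
  have hn := h.n1
  have hx' := Cy_mono (by norm_num : (80 / 100 : ℝ) ≤ 85 / 100) hx
  rcases le_or_gt (1 / (960 * n) : ℝ) ⟪e, x⟫ with h1 | h1
  · linarith [(h.slope_hi hx' h1).1]
  have hεn : ε < 1 / (960 * n) := by
    rw [lt_div_iff₀ (by positivity)]; nlinarith [h.eps_n, h.hε]
  have hlow := h.clos_low hx' hc
  set ℓ : ℝ := 1 / (240 * n) with hℓd
  have hℓ : 0 < ℓ := by positivity
  have hℓ4 : ℓ / 4 = 1 / (960 * n) := by rw [hℓd]; field_simp; norm_num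
  have hKℓ : 2 * (6 * n) * ℓ = 1 / 20 := by rw [hℓd]; field_simp; norm_num
  have hℓs : ℓ ≤ 1 / 240 := by
    rw [hℓd]; apply one_div_le_one_div_of_le <;> linarith
  rw [← hℓ4] at h1 hεn
  have hPz : Pe e (x - Pe e x) = 0 := by rw [Pe_sub, Pe_Pe h.he, sub_self]
  have hiz : ∀ y, ⟪e, y - Pe e x⟫ = ⟪e, y⟫ := fun y => by rw [inner_sub_right, inner_Pe h.he, sub_zero]
  have hQ : ∀ y ∈ Qs e (Pe e x) ℓ (6 * n), y ∈ Cy e (85 / 100) := by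
    intro y hy
    have hy1 := (qf_le_iff h.he _ (by positivity)).1 hy.1
    have hy2 := hy.2
    rw [hiz] at hy2
    refine ⟨?_, by linarith⟩
    rw [Pe_sub, Pe_Pe h.he, hKℓ] at hy1
    have := norm_le_norm_add_norm_sub' (Pe e y) (Pe e x)
    linarith [hx.1]
  have hmain := strip_max h.su h.he hℓ (K := 6 * n) (by positivity) (z := Pe e x) (f := fun x => - ⟪e, G x⟫)
    h.harm_e.neg h.cont_e.neg (fun y hy => h.ball1 (hQ y hy)) (a := - (3 / 4)) (S := 3 / 4) (by norm_num)
    (fun y hy hyc hy0 => by linarith [(h.fb_slope (hQ y hy) hyc hy0).1])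
    (fun y hy hyc hy0 => by
      rw [hiz] at hy0
      have hl := h.clos_low (hQ y hy) hyc
      have : ℓ / 4 ≤ ⟪e, y⟫ := by
        rcases le_abs.1 hy0 with h | h
        · exact h
        · linarith
      rw [hℓ4] at this
      linarith [(h.slope_hi (hQ y hy) this).1])
    (fun y hy hyc => by
      have := h.grad_cone (hQ y hy) hyc (v := e) (by
        have : Pe e e = 0 := by simpa using Pe_self h.he 1
        rw [this, norm_zero, h.ee]; have := h.K1; positivity)
      rw [real_inner_comm] at this
      linarith)
    x ⟨by rw [← Pe_sq h.he, hPz, norm_zero, zero_pow two_ne_zero]; positivity, by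
      rw [hiz, abs_le]; constructor <;> linarith⟩ hc
  have h2 := chi_center (ℓ := ℓ) (K := 6 * n) h.he hPz
  have h3 : 4 * (n:ℝ) / (6 * n) ^ 2 ≤ 1 / 9 := by
    rw [div_le_div_iff₀ (by positivity) (by norm_num)]; nlinarith
  linarith

lemma near_Cy (h : GS u G e ε τ K) {x y : EE n} {R a b r : ℝ} (h1 : ‖Pe e x‖ ≤ a) (h2 : |⟪e, x⟫| ≤ b)
    (hy : ‖y - x‖ < r) (ha : a + r ≤ R) (hb : b + r ≤ 1 / 4) : y ∈ Cy e R := by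
  have e1 : y = x + (y - x) := by abel
  have h3 := Pe_le h.he (y - x)
  have h4 := inner_e_le h.he (y - x)
  constructor
  · rw [e1, Pe_add]; refine (norm_add_le _ _).trans_lt ?_; linarith
  · rw [e1, inner_add_right]; refine (abs_add_le _ _).trans_lt ?_; linarith

set_option maxHeartbeats 1000000 in
lemma slope_up (h : GS u G e ε τ K) {x : EE n} (hx : x ∈ Cy e (75 / 100))
    (hc : x ∈ closure {x | 0 < u x}) : ⟪e, G x⟫ ≤ CL n := by
  have hn := h.n1
  have hCG := CG_ge (n := n)
  have hε64 := h.eps64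
  have hεn := h.eps_n
  set B : ℝ := 5 / 4 + 384 * n * CG n with hB
  have hBp : 0 < B := by positivity
  set D : Set (EE n) := Cy e (80 / 100) ∩ closure {x | 0 < u x} with hD
  have hDC : ∀ x ∈ D, x ∈ Cy e (85 / 100) := fun x hx => Cy_mono (by norm_num) hx.1
  obtain ⟨M0, hM0⟩ : ∃ M0, ∀ x ∈ D, ⟪e, G x⟫ ≤ M0 := by
    have hcl1 : IsClosed {x : EE n | ‖Pe e x‖ ≤ 80 / 100} :=
      isClosed_le (Pe_cont e).norm continuous_const
    have hcl2 : IsClosed {x : EE n | |⟪e, x⟫| ≤ 1 / 4} :=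
      isClosed_le (by fun_prop : Continuous fun x : EE n => |⟪e, x⟫|) continuous_const
    set Z : Set (EE n) := {x : EE n | ‖Pe e x‖ ≤ 80 / 100} ∩ {x : EE n | |⟪e, x⟫| ≤ 1 / 4} ∩
      closure {x | 0 < u x} with hZ
    have hZn : ∀ x ∈ Z, ‖x‖ ≤ 9 / 10 := by
      intro x hx
      refine abs_le_of_sq_le_sq' ?_ (by norm_num) |>.2
      rw [norm_sq_Pe h.he x]
      have h2 : ‖Pe e x‖ ≤ 80 / 100 := hx.1.1
      have h3' : |⟪e, x⟫| ≤ 1 / 4 := hx.1.2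
      have h3 := abs_le.1 h3'
      have : ‖Pe e x‖ ^ 2 ≤ (80 / 100) ^ 2 := by gcongr
      nlinarith
    have hcpt : IsCompact Z := (isCompact_closedBall (0 : EE n) (9 / 10)).of_isClosed_subset
      ((hcl1.inter hcl2).inter isClosed_closure) (fun x hx => by
        rw [mem_closedBall_zero_iff]; exact hZn x hx)
    obtain ⟨M, hM⟩ := hcpt.exists_bound_of_continuousOn (h.cont_e.mono (fun x hx => ⟨by
      rw [mem_ball_zero_iff]; linarith [hZn x hx], hx.2⟩))
    refine ⟨M, fun x hx => (le_abs_self _).trans (hM x ⟨⟨hx.1.1.le, hx.1.2.le⟩, hx.2⟩)⟩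
  have key := growth (D := D) (f := fun x => ⟪e, G x⟫) (ρ := fun x => 80 / 100 - ‖Pe e x‖) (e := e) (p := 1)
    (B := B) (θ := 1 / 9) (M0 := M0) (R0 := 80 / 100) (fun _ => rfl)
    (fun x hx => by have := hx.1.1; linarith)
    (fun x hx => by linarith [h.slope_low hx.1 hx.2]) hM0 hBp.le (by norm_num) (by norm_num) ?_ x
    ⟨Cy_mono (by norm_num) hx, hc⟩
  · have h1 := hx.1
    have h2 := h.slope_low (Cy_mono (by norm_num) hx) hc
    simp only [pow_one] at key
    have h3 : ⟪e, G x⟫ * (5 / 100) ≤ 2 * B := le_trans (by gcongr; linarith) key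
    unfold CL; linarith
  clear hx hc x
  intro x hx S hS
  simp only [pow_one] at *
  set ρ := 80 / 100 - ‖Pe e x‖ with hρ
  have hρ0 : 0 < ρ := by have := hx.1.1; linarith
  have hρ1 : ρ ≤ 80 / 100 := by have := norm_nonneg (Pe e x); linarith
  have hS0 : ⟪e, G x⟫ ≤ S := hS x hx (by rw [sub_self]; simp [Pe]; positivity)
  have hSp : 0 ≤ S := by linarith [h.slope_low hx.1 hx.2]
  have hCn : (0:ℝ) ≤ 384 * n * CG n := by positivity
  suffices hgoal : ⟪e, G x⟫ ≤ 5 / 4 + 384 * n * CG n / ρ + S / 9 by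
    have h1 : ⟪e, G x⟫ * ρ ≤ (5 / 4 + 384 * n * CG n / ρ + S / 9) * ρ := by gcongr
    have h2 : (5 / 4 + 384 * n * CG n / ρ + S / 9) * ρ = 5 / 4 * ρ + 384 * n * CG n + S / 9 * ρ := by
      field_simp
    rw [hB]; linarith
  have hq : 0 ≤ 384 * n * CG n / ρ := by positivity
  rcases le_or_gt (1 / (960 * n) : ℝ) ⟪e, x⟫ with h1 | h1
  · linarith [(h.slope_hi (hDC x hx) h1).2]
  have hxs : ⟪e, x⟫ ≤ 1 / 960 :=
    h1.le.trans (by apply one_div_le_one_div_of_le <;> linarith)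
  have hxl := h.clos_low (hDC x hx) hx.2
  set ℓ := ρ / (24 * n) with hℓd
  have hℓ : 0 < ℓ := by positivity
  have hℓρ : 384 * n * CG n / ρ = CG n * 16 / ℓ := by rw [hℓd]; field_simp; norm_num
  have hKℓ : 2 * (6 * n) * ℓ = ρ / 2 := by rw [hℓd]; field_simp; norm_num
  have hℓs : ℓ ≤ 1 / 30 := by
    rw [hℓd, div_le_div_iff₀ (by positivity) (by norm_num)]; linarith
  obtain ⟨z, hzP, hzC, hzT, hzx⟩ := h.clos_above (hDC x hx) hx.2
  have hz2 := abs_le.1 hzT.small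
  -- gradient bound at height
  have gl : ∀ y, ‖Pe e y‖ ≤ 80 / 100 → |⟪e, y⟫| ≤ 1 / 8 → ℓ / 4 ≤ ⟪e, y - z⟫ → ‖Pe e (y - z)‖ ≤ 12 * K * ℓ →
      ⟪e, G y⟫ ≤ CG n * 16 / ℓ := by
    intro y hy1 hy2 hy3 hy4
    have hb : ball y (ℓ / 16) ⊆ Cy e (85 / 100) := fun w hw => by
      rw [Metric.mem_ball, dist_eq_norm] at hw
      exact h.near_Cy hy1 hy2 hw (by linarith) (by linarith)
    have hp := h.pball hzC hzT hℓ hb hy3 hy4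
    have hy0 : y ∈ ball y (ℓ / 16) := Metric.mem_ball_self (by linarith)
    have hg := grad1 (h.su.harm.mono isOpen_ball (fun w hw => ⟨h.ball1 (hb hw), hp w hw⟩)) (m := 1)
      (fun w hw => by
        rw [abs_of_pos (hp w hw)]
        refine (h.fl w (h.ball1 (hb hw))).2.trans (max_le ?_ (by norm_num))
        have := abs_lt.1 (hb hw).2
        linarith) (by linarith : 0 < ℓ / 16) e
    rw [h.su.Ggrad y (h.ball1 (hb hy0)) (hp y hy0), real_inner_comm, h.he] at hg
    refine (le_abs_self _).trans (hg.trans (le_of_eq ?_))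
    field_simp
  have hPxz : Pe e (x - z) = 0 := by rw [Pe_sub, hzP, sub_self]
  rw [hℓρ]
  rw [hℓρ] at hq
  have hK := h.K1
  rcases le_or_gt (ℓ / 4) ⟪e, x - z⟫ with h2 | h2
  · have := gl x hx.1.1.le (by rw [abs_le]; constructor <;> linarith) h2 (by rw [hPxz, norm_zero]; positivity)
    linarith
  have hQ : ∀ y ∈ Qs e z ℓ (6 * n), ‖Pe e (y - x)‖ ≤ ρ / 2 ∧ ‖Pe e y‖ < 80 / 100 ∧ |⟪e, y⟫| ≤ 1 / 8 := by
    intro y hy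
    have hy1 := (qf_le_iff h.he _ (by positivity)).1 hy.1
    have hy2 := abs_le.1 hy.2
    rw [inner_sub_right] at hy2
    rw [hKℓ, Pe_sub, hzP, ← Pe_sub] at hy1
    refine ⟨hy1, ?_, by rw [abs_le]; constructor <;> linarith⟩
    rw [Pe_sub] at hy1
    have := norm_le_norm_add_norm_sub' (Pe e y) (Pe e x)
    linarith
  have hQD : ∀ y ∈ Qs e z ℓ (6 * n), y ∈ closure {x | 0 < u x} → y ∈ D := fun y hy hyc =>
    ⟨⟨(hQ y hy).2.1, by linarith [(hQ y hy).2.2]⟩, hyc⟩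
  have hQC : ∀ y ∈ Qs e z ℓ (6 * n), y ∈ Cy e (85 / 100) := fun y hy =>
    ⟨by linarith [(hQ y hy).2.1], by linarith [(hQ y hy).2.2]⟩
  have hQP : ∀ y ∈ Qs e z ℓ (6 * n), ‖Pe e (y - z)‖ ≤ 12 * K * ℓ := fun y hy => by
    have hy1 := (qf_le_iff h.he _ (by positivity)).1 hy.1
    have : (n:ℝ) * ℓ ≤ K * ℓ := by have := h.hK; gcongr
    linarith
  have hmain := strip_max h.su h.he hℓ (K := 6 * n) (by positivity) (z := z) (f := fun x => ⟪e, G x⟫)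
    h.harm_e h.cont_e (fun y hy => h.ball1 (hQC y hy)) (a := 5 / 4 + CG n * 16 / ℓ) (S := S) hSp
    (fun y hy hyc hy0 => by linarith [(h.fb_slope (hQC y hy) hyc hy0).2])
    (fun y hy hyc hy0 => by
      rcases le_abs.1 hy0 with h3 | h3
      · have := gl y (hQ y hy).2.1.le (hQ y hy).2.2 h3 (hQP y hy)
        linarith
      · exfalso
        have e1 : ⟪e, z - y⟫ = -⟪e, y - z⟫ := by rw [← inner_neg_right, neg_sub]
        have e2 : ‖Pe e (z - y)‖ = ‖Pe e (y - z)‖ := by rw [Pe_sub, Pe_sub, norm_sub_rev]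
        refine h.not_closure hzC hzT.zero (hQC y hy) (by linarith) ?_ hyc
        rw [e1, e2]
        have : 100 * K * (ℓ / 4) ≤ 100 * K * -⟪e, y - z⟫ := by gcongr
        have := hQP y hy
        have : 0 < K * ℓ := by positivity
        linarith)
    (fun y hy hyc => by
      have := hS y (hQD y hy hyc) (hQ y hy).1
      linarith)
    x ⟨by rw [← Pe_sq h.he, hPxz, norm_zero, zero_pow two_ne_zero]; positivity, by
      rw [inner_sub_right] at h2 ⊢; rw [abs_le]; constructor <;> linarith⟩ hx.2
  have h3 := chi_center (ℓ := ℓ) (K := 6 * n) h.he hPxz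
  have h4 : 4 * (n:ℝ) / (6 * n) ^ 2 ≤ 1 / 9 := by
    rw [div_le_div_iff₀ (by positivity) (by norm_num)]; nlinarith
  have h5 : S * (1 - chi e z ℓ (6 * n) x) ≤ S * (1 / 9) := by gcongr; linarith
  linarith

end GS
end slopes

open MeasureTheory Metric Set Filter ENNReal NNReal
open scoped Topology ContDiff RealInnerProductSpace

section lines
variable {n : ℕ}

lemma CL_ge : 50 ≤ CL n := by
  have := CG_ge (n := n)
  unfold CL
  have : 0 ≤ 15360 * (n:ℝ) * CG n := by positivity
  linarith

namespace GS
variable {u : EE n → ℝ} {G : EE n → EE n} {e : EE n} {ε τ K : ℝ} 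

lemma vmem (h : GS u G e ε τ K) {R : ℝ} {x : EE n} (hx : ‖Pe e x‖ < R) {t : ℝ}
    (ht : |⟪e, x⟫ + t| < 1 / 4) : x + t • e ∈ Cy e R := by
  refine ⟨?_, ?_⟩
  · rw [Pe_add, Pe_self h.he, add_zero]; exact hx
  · rw [inner_add_right, inner_e_self h.he]; exact ht

lemma line_lo (h : GS u G e ε τ K) {x : EE n} (hx : x ∈ Cy e (80 / 100))
    (hc : x ∈ closure {x | 0 < u x}) {T : ℝ} (hT : 0 ≤ T) (hxT : ⟪e, x⟫ + T < 1 / 4) :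
    u x + T / 2 ≤ u (x + T • e) := by
  have hx2 := abs_lt.1 hx.2
  have hm : ∀ t, 0 ≤ t → t ≤ T → x + t • e ∈ Cy e (80 / 100) := fun t h1 h2 =>
    h.vmem hx.1 (by rw [abs_lt]; constructor <;> linarith)
  have hm' : ∀ t, 0 ≤ t → t ≤ T → x + t • e ∈ Cy e (85 / 100) := fun t h1 h2 =>
    Cy_mono (by norm_num) (hm t h1 h2)
  have hx' : x ∈ Cy e (85 / 100) := Cy_mono (by norm_num) hx
  obtain ⟨z, hzP, hzC, hzT, hzx⟩ := h.clos_above hx' hc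
  have hp : ∀ t, 0 < t → t ≤ T → 0 < u (x + t • e) := by
    intro t h1 h2
    have e1 : ⟪e, x + t • e - z⟫ = ⟪e, x⟫ + t - ⟪e, z⟫ := by
      rw [inner_sub_right, inner_add_right, inner_e_self h.he]
    have e2 : Pe e (x + t • e - z) = 0 := by
      rw [Pe_sub, Pe_add, Pe_self h.he, hzP]; simp
    have := h.K1
    have hpos : 0 < ⟪e, x + t • e - z⟫ := by rw [e1]; linarith
    refine h.pos_above hzC hzT (hm' t h1.le h2) hpos ?_
    rw [e2, norm_zero]; positivity
  rcases hT.eq_or_lt with h0 | h0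
  · rw [← h0]; simp
  refine le_of_forall_pos_le_add fun δ hδ => ?_
  set d := min δ T with hd
  have hd0 : 0 < d := lt_min hδ h0
  have hdT : d ≤ T := min_le_right _ _
  have hdδ : d ≤ δ := min_le_left _ _
  have hadd : ∀ t : ℝ, x + d • e + t • e = x + (d + t) • e := fun t => by rw [add_smul]; abel
  have h1 := h.su.line_low (x + d • e) e (T := T - d) (m := 1 / 2) (by linarith) (by norm_num)
    (fun t ht => by rw [hadd]; exact h.ball1 (hm' _ (by linarith [ht.1]) (by linarith [ht.2])))
    (hp d hd0 hdT) (fun t ht _ => by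
      rw [hadd, real_inner_comm]
      have hp1 := hp (d + t) (by linarith [ht.1]) (by linarith [ht.2])
      exact h.slope_low (hm _ (by linarith [ht.1]) (by linarith [ht.2])) (subset_closure hp1))
  rw [hadd] at h1
  have e3 : d + (T - d) = T := by ring
  rw [e3] at h1
  have h2 := h.vert hx' hd0.le (hm' d hd0.le hdT)
  linarith

lemma line_hi (h : GS u G e ε τ K) {x : EE n} (hx : x ∈ Cy e (75 / 100)) {T : ℝ} (hT : 0 ≤ T)
    (hxT : ⟪e, x⟫ + T < 1 / 4) : u (x + T • e) ≤ u x + CL n * T := by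
  have hx2 := abs_lt.1 hx.2
  have hm : ∀ t, 0 ≤ t → t ≤ T → x + t • e ∈ Cy e (75 / 100) := fun t h1 h2 =>
    h.vmem hx.1 (by rw [abs_lt]; constructor <;> linarith)
  refine h.su.line_up' x e hT (by linarith [CL_ge (n := n)])
    (fun t ht => h.ball1 (Cy_mono (by norm_num) (hm t ht.1 ht.2))) (fun t ht hp => ?_)
  rw [real_inner_comm]
  exact h.slope_up (hm t ht.1.le ht.2.le) (subset_closure hp)

lemma line_dn (h : GS u G e ε τ K) {x : EE n} (hx : x ∈ Cy e (80 / 100)) {T : ℝ} (hT : 0 ≤ T)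
    (hxT : -(1 / 4) < ⟪e, x⟫ - T) : u (x - T • e) ≤ max (u x - T / 2) 0 := by
  rcases le_or_gt (u (x - T • e)) 0 with h0 | h0
  · exact h0.trans (le_max_right _ _)
  have hx2 := abs_lt.1 hx.2
  have e1 : x - T • e = x + (-T) • e := by rw [neg_smul]; abel
  have hm : x - T • e ∈ Cy e (80 / 100) := by
    rw [e1]; exact h.vmem hx.1 (by rw [abs_lt]; constructor <;> linarith)
  have := h.line_lo hm (subset_closure h0) hT (by
    rw [inner_sub_right, inner_e_self h.he]; linarith)
  rw [sub_add_cancel] at this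
  exact le_max_of_le_left (by linarith)

end GS

lemma chain_seg {f : EE n → ℝ} {x y : EE n} {r : ℝ} (hr : 0 < r)
    (hH : ∀ t ∈ Icc (0:ℝ) 1, Hm f (ball (x + t • (y - x)) r) ∧ ∀ z ∈ ball (x + t • (y - x)) r, 0 ≤ f z)
    (m : ℕ) (hm : ‖y - x‖ ≤ m * (r / 8)) : f x ≤ CH n ^ m * f y := by
  have hCH := CH_ge (n := n)
  rcases Nat.eq_zero_or_pos m with h0 | h0
  · rw [h0] at hm
    have : y - x = 0 := by
      rw [← norm_le_zero_iff]; simpa using hm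
    rw [sub_eq_zero.1 this, h0]; simp
  have hmp : (0:ℝ) < m := by exact_mod_cast h0
  have key : ∀ k : ℕ, k ≤ m → f x ≤ CH n ^ k * f (x + ((k:ℝ) / m) • (y - x)) := by
    intro k
    induction k with
    | zero => intro _; simp
    | succ k ih =>
      intro hk
      have h1 := ih (by omega)
      have hk' : (k:ℝ) / m ∈ Icc (0:ℝ) 1 := by
        refine ⟨by positivity, ?_⟩
        rw [div_le_one hmp]; exact_mod_cast (by omega : k ≤ m)
      obtain ⟨h2, h3⟩ := hH _ hk'
      have h4 := harnack2 h2 h3 hr (y := x + (((k + 1 : ℕ):ℝ) / m) • (y - x)) (by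
        have e1 : x + (((k + 1 : ℕ):ℝ) / m) • (y - x) - (x + ((k:ℝ) / m) • (y - x)) = ((1:ℝ) / m) • (y - x) := by
          rw [add_sub_add_left_eq_sub, ← sub_smul]; congr 1; push_cast; field_simp; ring
        rw [e1, norm_smul, Real.norm_eq_abs, abs_of_pos (by positivity), one_div, inv_mul_le_iff₀ hmp]
        exact hm)
      calc f x ≤ CH n ^ k * f (x + ((k:ℝ) / m) • (y - x)) := h1
        _ ≤ CH n ^ k * (CH n * f (x + (((k + 1 : ℕ):ℝ) / m) • (y - x))) := by gcongr
        _ = _ := by ring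
  have := key m le_rfl
  rwa [div_self hmp.ne', one_smul, add_sub_cancel] at this

/-- an ordered pair of flat solutions -/
structure PS (u1 u2 : EE n → ℝ) (G1 G2 : EE n → EE n) (e : EE n) (ε τ K : ℝ) : Prop where
  h1 : GS u1 G1 e ε τ K
  h2 : GS u2 G2 e ε τ K
  le : ∀ x ∈ ball (0 : EE n) 1, u1 x ≤ u2 x

lemma exists_pn (n : ℕ) : ∃ p : ℕ, CH n ≤ (33 / 32) ^ p := by
  obtain ⟨p, hp⟩ := pow_unbounded_of_one_lt (CH n) (by norm_num : (1:ℝ) < 33 / 32)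
  exact ⟨p, hp.le⟩

noncomputable def pn (n : ℕ) : ℕ := (exists_pn n).choose
lemma pn_spec : CH n ≤ (33 / 32) ^ pn n := (exists_pn n).choose_spec

namespace PS
variable {u1 u2 : EE n → ℝ} {G1 G2 : EE n → EE n} {e : EE n} {ε τ K : ℝ}

lemma harm (h : PS u1 u2 G1 G2 e ε τ K) {s : Set (EE n)} (hs : IsOpen s)
    (h1 : ∀ x ∈ s, x ∈ ball (0 : EE n) 1 ∧ 0 < u1 x) :
    Hm (fun x => u2 x - u1 x) s ∧ ∀ x ∈ s, 0 ≤ u2 x - u1 x :=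
  ⟨(h.h2.su.harm.mono hs fun x hx => ⟨(h1 x hx).1, lt_of_lt_of_le (h1 x hx).2 (h.le x (h1 x hx).1)⟩).sub
    (h.h1.su.harm.mono hs h1), fun x hx => by linarith [h.le x (h1 x hx).1]⟩

lemma fixed (h : PS u1 u2 G1 G2 e ε τ K) {x y : EE n} (hx : ‖x‖ ≤ 15 / 16) (hy : ‖y‖ ≤ 15 / 16) {r : ℝ}
    (hr : 0 < r) (hr1 : r ≤ 1 / 16) (hxe : ε + r ≤ ⟪e, x⟫) (hye : ε + r ≤ ⟪e, y⟫) {m : ℕ}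
    (hm : 16 ≤ m * r) : u2 x - u1 x ≤ CH n ^ m * (u2 y - u1 y) := by
  refine chain_seg (f := fun x => u2 x - u1 x) hr (fun t ht => ?_) m ?_
  · have e1 : x + t • (y - x) = (1 - t) • x + t • y := by
      rw [smul_sub, sub_smul, one_smul]; abel
    set w := x + t • (y - x) with hw
    have hw1 : ‖w‖ ≤ 15 / 16 := by
      rw [e1]
      refine (norm_add_le _ _).trans ?_
      rw [norm_smul, norm_smul, Real.norm_eq_abs, Real.norm_eq_abs, abs_of_nonneg ht.1,
        abs_of_nonneg (by linarith [ht.2])]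
      nlinarith [ht.1, ht.2]
    have hw2 : ε + r ≤ ⟪e, w⟫ := by
      rw [e1, inner_add_right, inner_smul_right, inner_smul_right]
      nlinarith [ht.1, ht.2]
    refine h.harm isOpen_ball (fun z hz => ?_)
    rw [Metric.mem_ball, dist_eq_norm] at hz
    have hzb : z ∈ ball (0 : EE n) 1 := by
      rw [mem_ball_zero_iff]
      have := norm_le_norm_add_norm_sub' z w
      linarith
    refine ⟨hzb, h.h1.fl.pos hzb ?_⟩
    have h3 := abs_le.1 (inner_e_le h.h1.he (z - w))
    rw [inner_sub_right] at h3
    linarith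
  · have := norm_sub_le y x
    linarith

lemma xbar_norm (h : PS u1 u2 G1 G2 e ε τ K) : ‖(1 / 8 : ℝ) • e‖ ≤ 15 / 16 := by
  rw [norm_te h.h1.he (by norm_num)]; norm_num

lemma Cy_norm {e : EE n} (he : ‖e‖ = 1) {R : ℝ} (hR : R ≤ 9 / 10) {x : EE n} (hx : x ∈ Cy e R) :
    ‖x‖ ≤ 15 / 16 := by
  refine abs_le_of_sq_le_sq' ?_ (by norm_num) |>.2
  rw [norm_sq_Pe he x]
  have h2 := hx.1
  have h3 := abs_lt.1 hx.2
  have : ‖Pe e x‖ ^ 2 ≤ (9 / 10) ^ 2 := by gcongr; linarith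
  nlinarith

lemma fix32 (h : PS u1 u2 G1 G2 e ε τ K) {x : EE n} (hx : ‖x‖ ≤ 15 / 16) (hxe : 1 / 32 ≤ ⟪e, x⟫) :
    u2 x - u1 x ≤ CH n ^ 1024 * (u2 ((1 / 8 : ℝ) • e) - u1 ((1 / 8 : ℝ) • e)) := by
  have := h.h1.eps64
  refine h.fixed hx h.xbar_norm (r := 1 / 64) (by norm_num) (by norm_num) (by linarith) ?_ (by norm_num)
  rw [inner_e_self h.h1.he]; linarith

lemma vbar_nonneg (h : PS u1 u2 G1 G2 e ε τ K) : 0 ≤ u2 ((1 / 8 : ℝ) • e) - u1 ((1 / 8 : ℝ) • e) := by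
  have := h.le ((1 / 8 : ℝ) • e) (by rw [mem_ball_zero_iff]; linarith [h.xbar_norm])
  linarith

lemma poly_aux (h : PS u1 u2 G1 G2 e ε τ K) (k : ℕ) : ∀ {x z : EE n}, x ∈ Cy e (80 / 100) →
    z ∈ Cy e (85 / 100) → GS.Top u1 e ε z → Pe e z = Pe e x → 1 / 16 ≤ ⟪e, x - z⟫ * (33 / 32) ^ k →
    u2 x - u1 x ≤ CH n ^ k * (CH n ^ 1024 * (u2 ((1 / 8 : ℝ) • e) - u1 ((1 / 8 : ℝ) • e))) := by
  have hCH := CH_ge (n := n)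
  have hε := h.h1.eps64
  have hv := h.vbar_nonneg
  have hvC : 0 ≤ CH n ^ 1024 * (u2 ((1 / 8 : ℝ) • e) - u1 ((1 / 8 : ℝ) • e)) := by positivity
  generalize hW : CH n ^ 1024 * (u2 ((1 / 8 : ℝ) • e) - u1 ((1 / 8 : ℝ) • e)) = W at *
  have hbig : ∀ {x : EE n}, x ∈ Cy e (80 / 100) → 1 / 32 ≤ ⟪e, x⟫ → u2 x - u1 x ≤ W := fun {x} hx hxe => by
    rw [← hW]
    exact h.fix32 (Cy_norm h.h1.he (by norm_num) hx) hxe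
  induction k with
  | zero =>
    intro x z hx hz hzT hzP hh
    rw [pow_zero, mul_one, inner_sub_right] at hh
    have := (abs_le.1 hzT.small).1
    rw [pow_zero, one_mul]
    exact hbig hx (by linarith)
  | succ k ih =>
    intro x z hx hz hzT hzP hh
    rcases le_or_gt (1 / 32) ⟪e, x⟫ with h1 | h1
    · have h2 := hbig hx h1
      have h3 : 1 ≤ CH n ^ (k + 1) := one_le_pow₀ (by linarith)
      nlinarith
    have hz2 := abs_le.1 hzT.small
    have hx2 := abs_lt.1 hx.2
    set d := ⟪e, x - z⟫ with hd
    have hd' : d = ⟪e, x⟫ - ⟪e, z⟫ := by rw [hd, inner_sub_right]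
    have hd0 : 0 < d := by
      by_contra hc
      push Not at hc
      have : (0:ℝ) < (33 / 32) ^ (k + 1) := by positivity
      nlinarith
    have hPxz : Pe e (x - z) = 0 := by rw [Pe_sub, hzP, sub_self]
    have hK := h.h1.K1
    have hb : ∀ y ∈ ball x (d / 4), y ∈ ball (0 : EE n) 1 ∧ 0 < u1 y := by
      intro y hy
      rw [Metric.mem_ball, dist_eq_norm] at hy
      have hyC : y ∈ Cy e (85 / 100) := h.h1.near_Cy (a := 80 / 100) (b := 1 / 5) hx.1.le
        (by rw [abs_le]; constructor <;> linarith) hy (by linarith) (by linarith)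
      refine ⟨h.h1.ball1 hyC, ?_⟩
      have e1 : y - z = (x - z) + (y - x) := by abel
      have h3 := abs_le.1 (inner_e_le h.h1.he (y - x))
      have h5 : 3 * d / 4 ≤ ⟪e, y - z⟫ := by rw [e1, inner_add_right, ← hd]; linarith
      refine h.h1.pos_above hz hzT hyC (by linarith) ?_
      rw [e1, Pe_add, hPxz, zero_add, ← e1]
      have h4 := Pe_le h.h1.he (y - x)
      have h6 : 1 * (3 * d / 4) ≤ K * ⟪e, y - z⟫ := by gcongr
      nlinarith
    obtain ⟨g1, g2⟩ := h.harm isOpen_ball hb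
    have g3 := harnack2 g1 g2 (by linarith) (y := x + (d / 32) • e) (by
      rw [add_sub_cancel_left, norm_te h.h1.he (by linarith)]; linarith)
    have g4 := ih (x := x + (d / 32) • e) (z := z)
      (h.h1.vmem hx.1 (by rw [abs_lt]; constructor <;> linarith)) hz hzT
      (by rw [hzP, Pe_add, Pe_self h.h1.he, add_zero]) (by
        have e2 : ⟪e, x + (d / 32) • e - z⟫ = d * (33 / 32) := by
          rw [inner_sub_right, inner_add_right, inner_e_self h.h1.he, hd']; ring
        rw [e2]
        refine hh.trans (le_of_eq ?_)
        ring)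
    calc u2 x - u1 x ≤ CH n * (u2 (x + (d / 32) • e) - u1 (x + (d / 32) • e)) := g3
      _ ≤ CH n * (CH n ^ k * W) := by gcongr
      _ = _ := by ring

lemma poly (h : PS u1 u2 G1 G2 e ε τ K) {x z : EE n} (hx : x ∈ Cy e (80 / 100))
    (hz : z ∈ Cy e (85 / 100)) (hzT : GS.Top u1 e ε z) (hzP : Pe e z = Pe e x) {d : ℝ} (hd0 : 0 < d)
    (hd : d ≤ ⟪e, x - z⟫) :
    (u2 x - u1 x) * d ^ pn n ≤ CH n ^ 1024 * (u2 ((1 / 8 : ℝ) • e) - u1 ((1 / 8 : ℝ) • e)) := by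
  have hCH := CH_ge (n := n)
  have hv := h.vbar_nonneg
  have hvC : 0 ≤ CH n ^ 1024 * (u2 ((1 / 8 : ℝ) • e) - u1 ((1 / 8 : ℝ) • e)) := by positivity
  have hvx : 0 ≤ u2 x - u1 x := by
    linarith [h.le x (Cy_ball h.h1.he (by norm_num) hx)]
  have hd1 : d ≤ 1 := by
    rw [inner_sub_right] at hd
    have := (abs_lt.1 hx.2).2
    have := (abs_lt.1 hz.2).1
    linarith
  rcases le_or_gt (1 / 16) d with h1 | h1
  · have := h.poly_aux 0 hx hz hzT hzP (by rw [pow_zero, mul_one]; linarith)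
    rw [pow_zero, one_mul] at this
    have h3 : d ^ pn n ≤ 1 := pow_le_one₀ hd0.le hd1
    nlinarith
  obtain ⟨k, hk1, hk2⟩ := exists_nat_pow_near (x := 1 / (16 * d)) (y := (33 / 32 : ℝ))
    (by rw [le_div_iff₀ (by positivity)]; linarith) (by norm_num)
  rw [div_lt_iff₀ (by positivity)] at hk2
  rw [le_div_iff₀ (by positivity)] at hk1
  have h4 := h.poly_aux (k + 1) hx hz hzT hzP (by
    have : (0:ℝ) < (33 / 32) ^ (k + 1) := by positivity
    nlinarith)
  have h5 : CH n ^ (k + 1) * d ^ pn n ≤ 1 := by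
    have h6 : CH n ^ (k + 1) ≤ ((33 / 32) ^ (k + 1)) ^ pn n := by
      rw [← pow_mul, mul_comm, pow_mul]
      gcongr
      exact pn_spec
    calc CH n ^ (k + 1) * d ^ pn n ≤ ((33 / 32) ^ (k + 1)) ^ pn n * d ^ pn n := by gcongr
      _ = ((33 / 32) ^ (k + 1) * d) ^ pn n := by rw [mul_pow]
      _ ≤ 1 := by
        apply pow_le_one₀ (by positivity)
        rw [pow_succ]; nlinarith
  calc (u2 x - u1 x) * d ^ pn n
      ≤ (CH n ^ (k + 1) * (CH n ^ 1024 * (u2 ((1 / 8 : ℝ) • e) - u1 ((1 / 8 : ℝ) • e)))) * d ^ pn n := by gcongr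
    _ = (CH n ^ (k + 1) * d ^ pn n) * (CH n ^ 1024 * (u2 ((1 / 8 : ℝ) • e) - u1 ((1 / 8 : ℝ) • e))) := by ring
    _ ≤ 1 * (CH n ^ 1024 * (u2 ((1 / 8 : ℝ) • e) - u1 ((1 / 8 : ℝ) • e))) := by gcongr
    _ = _ := one_mul _

end PS
end lines

open MeasureTheory Metric Set Filter ENNReal NNReal
open scoped Topology ContDiff RealInnerProductSpace

section lower
variable {n : ℕ}

namespace GS
variable {u : EE n → ℝ} {G : EE n → EE n} {e : EE n} {ε τ K : ℝ} 

lemma mon (h : GS u G e ε τ K) {s : ℝ} (hs : 0 < s) (hsT : s ≤ T0 n τ) {x : EE n}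
    (hx : x ∈ Cy e (85 / 100)) : DomAt u u e s (1 - τ) x :=
  mon_all h.hn h.hτ h.tau_n h.hε h.hε1 h.su h.he h.fl hs hsT x hx

lemma eps_T0 (h : GS u G e ε τ K) : 8 * ε ≤ T0 n τ * τ :=  by
  have h1 := h.hε1
  have h2 : eps0 n τ ≤ T0 n τ * τ / 8 := (min_le_right _ _).trans (min_le_right _ _)
  linarith

lemma tau_small (h : GS u G e ε τ K) : τ * (180000 * n) ≤ 1 := by
  have h1 := h.n1
  have h2 := h.tau_n
  have h3 := h.hτ
  have : τ * (180000 * n) * 1 ≤ τ * (180000 * n) * n := by gcongr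
  nlinarith

/-- small differences of a flat solution away from the boundary -/
lemma diff_top (h : GS u G e ε τ K) {x y : EE n} {r : ℝ} (hr : 0 < r)
    (hb : ball x r ⊆ ball (0 : EE n) 1) (hx : ε + r ≤ ⟪e, x⟫) (hy : ‖y - x‖ ≤ r / 2) :
    u y - u x ≤ ⟪e, y - x⟫ + CG n * ε * ‖y - x‖ / r := by
  have hm : ∀ z ∈ ball x r, ε < ⟪e, z⟫ := by
    intro z hz
    rw [Metric.mem_ball, dist_eq_norm] at hz
    have h3 := abs_le.1 (inner_e_le h.he (z - x))
    rw [inner_sub_right] at h3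
    linarith
  have hpos : ∀ z ∈ ball x r, 0 < u z := fun z hz => h.fl.pos (hb hz) (hm z hz)
  have hH : Hm (fun z => u z - ⟪e, z⟫) (ball x r) :=
    (h.su.harm.mono isOpen_ball (fun z hz => ⟨hb hz, hpos z hz⟩)).sub (Hm.inner e isOpen_ball)
  have h1 := osc1 hH (m := ε) (fun z hz => h.fl.close (hb hz) (by linarith [hm z hz, h.hε])) hr hy
  have := (abs_le.1 h1).2
  rw [inner_sub_right]
  linarith
end GS

namespace PS
variable {u1 u2 : EE n → ℝ} {G1 G2 : EE n → EE n} {e : EE n} {ε τ K : ℝ}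

set_option maxHeartbeats 1000000 in
lemma lower (h : PS u1 u2 G1 G2 e ε τ K) {x1 : EE n} (hx1 : x1 ∈ Cy e (60 / 100))
    (hc : x1 ∈ closure {x | 0 < u1 x}) :
    u2 ((1 / 8 : ℝ) • e) - u1 ((1 / 8 : ℝ) • e) ≤ 1040 * n * CH n ^ (7680 * n) * (u2 x1 - u1 x1) := by
  have he := h.h1.he
  have hn := h.h1.n1
  have hCH := CH_ge (n := n)
  have hCG := CG_ge (n := n)
  have hεn := h.h1.eps_n
  have hε0 := h.h1.hε
  have hK := h.h1.hK
  have hK1 := h.h1.K1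
  have hτ := h.h1.hτ
  have hτs := h.h1.tau_small
  have hεs : ε ≤ 1 / 7680 := by nlinarith
  have hx1' : x1 ∈ Cy e (85 / 100) := Cy_mono (by norm_num) hx1
  have hvb := h.vbar_nonneg
  have hv1 : 0 ≤ u2 x1 - u1 x1 := by linarith [h.le x1 (h.h1.ball1 hx1')]
  have hbar2 : u2 ((1 / 8 : ℝ) • e) - u1 ((1 / 8 : ℝ) • e) ≤ 2 * ε := by
    have hb : (1 / 8 : ℝ) • e ∈ ball (0 : EE n) 1 := by rw [mem_ball_zero_iff]; linarith [h.xbar_norm]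
    have g1 := (h.h1.fl _ hb).1
    have g2 := (h.h2.fl _ hb).2
    rw [inner_e_self he] at g1 g2
    rw [max_eq_left (by linarith)] at g1 g2
    linarith
  generalize hW : u2 ((1 / 8 : ℝ) • e) - u1 ((1 / 8 : ℝ) • e) = W at *
  set Cf : ℝ := CH n ^ (7680 * n) with hCf
  have hCf1 : 1 ≤ Cf := one_le_pow₀ (by linarith)
  set ℓ : ℝ := 1 / (60 * n) with hℓd
  have hℓ : 0 < ℓ := by positivity
  have hnℓ : n * ℓ = 1 / 60 := by rw [hℓd]; field_simp
  have hℓs : ℓ ≤ 1 / 60 := by nlinarith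
  have hεℓ : 128 * ε ≤ ℓ := by
    rw [hℓd, le_div_iff₀ (by positivity)]; linarith
  -- lower bound at height
  have hfix : ∀ x ∈ Cy e (85 / 100), ℓ / 4 - ε ≤ ⟪e, x⟫ → W ≤ Cf * (u2 x - u1 x) := by
    intro x hx hxe
    rw [← hW]
    refine h.fixed h.xbar_norm (Cy_norm he (by norm_num) hx) (r := ℓ / 8) (by positivity) (by linarith)
      (by rw [inner_e_self he]; linarith) (by linarith) ?_
    push_cast
    nlinarith
  obtain ⟨z, hzP, hzC, hzT, hzx⟩ := h.h1.clos_above hx1' hc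
  have hz2 := abs_le.1 hzT.small
  have hPxz : Pe e (x1 - z) = 0 := by rw [Pe_sub, hzP, sub_self]
  have hbigC : Cf ≤ 1040 * n * Cf := by nlinarith
  rcases le_or_gt (ℓ / 4) ⟪e, x1 - z⟫ with h2 | h2
  · rw [inner_sub_right] at h2
    refine (hfix x1 hx1' (by linarith)).trans ?_
    gcongr
  rcases hvb.eq_or_lt with hW0 | hW0
  · rw [← hW0]; positivity
  set s := W / Cf with hs
  have hs0 : 0 < s := by positivity
  have hsW : s ≤ W := by rw [hs]; exact div_le_self hvb hCf1
  have hτ1 : τ ≤ 1 / 180000 := by nlinarith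
  have hsT : s ≤ T0 n τ := by
    have := h.h1.eps_T0
    have := T0_pos h.h1.hn hτ
    nlinarith
  have hA0 : (0:ℝ) < 1 / (130 * n) := by positivity
  have hA130 : (1 / (130 * n) : ℝ) * (130 * n) = 1 := by field_simp
  set A : ℝ := 1 / (130 * n) with hA
  have hA1 : A ≤ 1 / 130 := by nlinarith
  have hQ : ∀ x ∈ Qs e z ℓ (3 * n), ‖Pe e x‖ < 70 / 100 ∧ |⟪e, x⟫| ≤ 1 / 16 ∧ ‖Pe e (x - z)‖ ≤ 6 * n * ℓ := by
    intro y hy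
    have hy1 := (qf_le_iff he _ (by positivity)).1 hy.1
    have hy2 := abs_le.1 hy.2
    rw [inner_sub_right] at hy2
    have hy3 : ‖Pe e (y - z)‖ ≤ 6 * n * ℓ := by linarith
    refine ⟨?_, by rw [abs_le]; constructor <;> linarith, hy3⟩
    rw [Pe_sub, hzP] at hy3
    have := norm_le_norm_add_norm_sub' (Pe e y) (Pe e x1)
    linarith [hx1.1]
  have hnear : ∀ x ∈ Qs e z ℓ (3 * n), ∀ w, ‖w - x‖ ≤ 8 * s → w ∈ Cy e (85 / 100) := fun x hx w hw =>
    h.h1.near_Cy (hQ x hx).1.le (hQ x hx).2.1 (r := 1 / 100) (by linarith) (by norm_num) (by norm_num)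
  have hQC : ∀ x ∈ Qs e z ℓ (3 * n), x ∈ Cy e (85 / 100) := fun x hx =>
    hnear x hx x (by rw [sub_self, norm_zero]; positivity)
  have hSL : SLH u1 u2 G1 G2 e z ℓ (3 * n) s s τ A (1 - τ) := by
    refine ⟨h.h1.hn, h.h1.su, h.h2.su, he, hℓ, le_rfl, hs0, by linarith, hA0, hA130.le, by linarith,
      by linarith, hs0, by linarith, hτ.le, ?_, ?_, ?_, ?_, ?_⟩
    · have := h.h1.tau_n; nlinarith
    · intro x hx w hw
      rw [Metric.mem_closedBall, dist_eq_norm] at hw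
      exact h.h1.ball1 (hnear x hx w hw)
    · intro x hx y hy
      exact (h.h1.mon hs0 hsT (hQC x hx) y hy).trans (h.le x (h.h1.ball1 (hQC x hx)))
    · intro x hx hxt y hy
      have e0 : y - x = (y - (x - s • e)) + -(s • e) := by abel
      have hyx : ‖y - x‖ ≤ 3 * s := by
        rw [e0]; refine (norm_add_le _ _).trans ?_
        rw [norm_neg, norm_te he hs0.le]; nlinarith
      have hyC := hnear x hx y (by linarith)
      rcases le_abs.1 hxt with h3 | h3
      · rw [inner_sub_right] at h3
        have hvx := hfix x (hQC x hx) (by linarith)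
        have hsv : s ≤ u2 x - u1 x := by rw [hs, div_le_iff₀ (by linarith)]; linarith
        have hd := h.h1.diff_top (x := x) (y := y) (r := ℓ / 8) (by positivity) (fun w hw => by
          rw [Metric.mem_ball, dist_eq_norm] at hw
          exact Cy_near he (by norm_num) (hQC x hx) (by linarith)) (by linarith) (by linarith)
        have hyi : ⟪e, y - x⟫ ≤ s * A := by
          rw [e0, inner_add_right, inner_neg_right, inner_e_self he]
          have := (abs_le.1 (inner_e_le he (y - (x - s • e)))).2
          nlinarith
        have hsA : s * A ≤ s * (1 / 130) := by gcongr
        have hq : CG n * ε * ‖y - x‖ / (ℓ / 8) ≤ s / 4 := by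
          rw [div_le_iff₀ (by positivity)]
          have q1 : CG n * ε * ‖y - x‖ ≤ CG n * ε * (3 * s) := by gcongr
          have q2 : CG n * ε * 7680 ≤ 60 * ℓ := by
            have := h.h1.hε2
            rw [hℓd, mul_one_div, le_div_iff₀ (by positivity)]; linarith
          have q3 : CG n * ε * 7680 * s ≤ 60 * ℓ * s := by gcongr
          have q4 : 0 < ℓ * s := by positivity
          nlinarith
        linarith
      · have hy0 : u1 y = 0 := by
          refine h.h1.zero_below hzC hzT.zero hyC ?_
          have e1 : z - y = -((x - z) + (y - x)) := by abel
          have q1 := (abs_le.1 (inner_e_le he (y - x))).2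
          have q2 : ℓ / 4 - 3 * s ≤ ⟪e, z - y⟫ := by
            rw [e1, inner_neg_right, inner_add_right]; linarith
          have q3 : ‖Pe e (z - y)‖ ≤ 6 * n * ℓ + 3 * s := by
            have e2 : Pe e (z - y) = -(Pe e (x - z) + Pe e (y - x)) := by
              simp only [Pe_sub]; abel
            rw [e2, norm_neg]
            refine (norm_add_le _ _).trans ?_
            linarith [(hQ x hx).2.2, Pe_le he (y - x)]
          have q4 : 200 * K * (ℓ / 8) ≤ 200 * K * ⟪e, z - y⟫ := by gcongr; linarith
          have q5 : n * ℓ ≤ K * ℓ := by gcongr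
          have q6 : 1 * ℓ ≤ K * ℓ := by gcongr
          linarith
        rw [hy0]; exact h.h2.su.nonneg x (h.h1.ball1 (hQC x hx))
    · intro x hx w hw y hy
      rw [Metric.mem_closedBall, dist_eq_norm] at hw
      exact h.h1.mon hs0 hsT (hnear x hx w hw) y hy
  have hx1Q : x1 ∈ Qs e z ℓ (3 * n) :=
    ⟨by rw [← Pe_sq he, hPxz, norm_zero, zero_pow two_ne_zero]; positivity, by
      rw [inner_sub_right] at h2 ⊢; rw [abs_le]; constructor <;> linarith⟩
  have hchi := chi_center (ℓ := ℓ) (K := 3 * n) he hPxz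
  have h4 : 4 * (n:ℝ) / (3 * n) ^ 2 ≤ 4 / 9 := by
    rw [div_le_div_iff₀ (by positivity) (by norm_num)]; nlinarith
  have hfin := hSL.strip hx1Q (y1 := x1 + (s * (A / 4)) • e) (by
    have e1 : x1 + (s * (A / 4)) • e - (x1 - s • e) = (s * (A / 4) + s) • e := by
      rw [add_smul]; abel
    rw [e1, norm_te he (by positivity)]
    have : A * (5 / 9) ≤ A * chi e z ℓ (3 * n) x1 := by gcongr; linarith
    have hτA : τ ≤ A / 4 := by
      rw [hA, div_div, le_div_iff₀ (by positivity)]; linarith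
    have : s * (1 + A / 4) ≤ s * (1 - τ + A * chi e z ℓ (3 * n) x1) :=
      mul_le_mul_of_nonneg_left (by linarith) hs0.le
    linarith)
  have hsA : s * (A / 4) ≤ 1 / 100 := by nlinarith
  have hlo := h.h1.line_lo (Cy_mono (by norm_num) hx1) hc (T := s * (A / 4)) (by positivity) (by
    rw [inner_sub_right] at h2; linarith)
  have hend : s * A ≤ 8 * (u2 x1 - u1 x1) := by linarith
  have hWs : W = s * A * (130 * n) * Cf := by
    rw [mul_assoc s A, hA130, mul_one, hs]; field_simp
  rw [hWs]
  calc s * A * (130 * n) * Cf ≤ 8 * (u2 x1 - u1 x1) * (130 * n) * Cf := by gcongr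
    _ = _ := by ring

end PS
end lower

open MeasureTheory Metric Set Filter ENNReal NNReal
open scoped Topology ContDiff RealInnerProductSpace

section upper
variable {n : ℕ}

namespace PS
variable {u1 u2 : EE n → ℝ} {G1 G2 : EE n → EE n} {e : EE n} {ε τ K : ℝ}

lemma dom_cl (h : PS u1 u2 G1 G2 e ε τ K) {x y : EE n} {s t : ℝ} (hx : x ∈ Cy e (80 / 100))
    (hxe : |⟪e, x⟫| ≤ 1 / 8) (ht : 0 ≤ t) (hts : 2 * t < s) (hs : s ≤ 1 / 100) (hsT : s ≤ T0 n τ)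
    (hv : u2 x - u1 x ≤ t) (hy : ‖y - (x - s • e)‖ ≤ s * (1 - τ) - 2 * t) : u2 y ≤ u1 x := by
  have he := h.h1.he
  have hτ := h.h1.hτ
  have hx2 := abs_le.1 hxe
  have e1 : x - (2 * t) • e = x + (-(2 * t)) • e := by rw [neg_smul]; abel
  have hm : x - (2 * t) • e ∈ Cy e (85 / 100) := by
    rw [e1]; exact h.h2.vmem (by linarith [hx.1]) (by rw [abs_lt]; constructor <;> linarith)
  have h1 := h.h2.mon (s := s - 2 * t) (by linarith) (by linarith) hm y (by
    have e2 : x - (2 * t) • e - (s - 2 * t) • e = x - s • e := by rw [sub_smul]; abel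
    rw [e2]
    nlinarith)
  have h2 := h.h2.line_dn hx (T := 2 * t) (by linarith) (by linarith)
  refine h1.trans (h2.trans (max_le (by linarith) ?_))
  exact h.h1.su.nonneg x (h.h1.ball1 (Cy_mono (by norm_num) hx))

lemma dom_all (h : PS u1 u2 G1 G2 e ε τ K) {x y : EE n} {s t : ℝ} (hx : x ∈ Cy e (80 / 100))
    (hxe : |⟪e, x⟫| ≤ 1 / 8) (ht : 0 ≤ t) (hts : 2 * t < s) (hs : s ≤ 1 / 100) (hsT : s ≤ T0 n τ)
    (hv : ∀ w, Pe e w = Pe e x → |⟪e, w⟫| ≤ 1 / 8 → w ∈ closure {x | 0 < u1 x} → u2 w - u1 w ≤ t)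
    (hy : ‖y - (x - s • e)‖ ≤ s * (1 - τ) - 2 * t) : u2 y ≤ u1 x := by
  have he := h.h1.he
  have hτ := h.h1.hτ
  have hε := h.h1.eps64
  have hx2 := abs_le.1 hxe
  have hK := h.h1.K1
  by_cases hc : x ∈ closure {x | 0 < u1 x}
  · exact h.dom_cl hx hxe ht hts hs hsT (hv x rfl hxe hc) hy
  have hx' : x ∈ Cy e (85 / 100) := Cy_mono (by norm_num) hx
  obtain ⟨z, hzP, hzC, hzT⟩ := h.h1.top hx'.1
  have hz2 := abs_le.1 hzT.small
  set d := ⟪e, z⟫ - ⟪e, x⟫ with hd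
  have hz8 : |⟪e, z⟫| ≤ 1 / 8 := by linarith [hzT.small]
  have hzx : z = x + d • e := by
    rw [← line_eq e z, hzP]
    conv_rhs => rw [← line_eq e x]
    rw [add_assoc, ← add_smul]; congr 2; rw [hd]; ring
  have hd0 : 0 ≤ d := by
    by_contra hcon
    push Not at hcon
    apply hc
    apply subset_closure
    refine h.h1.pos_above hzC hzT hx' (by rw [inner_sub_right]; linarith) ?_
    rw [Pe_sub, hzP, sub_self, norm_zero, inner_sub_right]
    have : 0 ≤ ⟪e, x⟫ - ⟪e, z⟫ := by linarith
    positivity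
  have hzc := h.h1.top_mem_closure hzT
  have h1 := h.dom_cl (x := z) (y := y + d • e) ⟨by rw [hzP]; exact hx.1, by linarith⟩ hz8 ht hts hs hsT
    (hv z hzP hz8 hzc) (by
      have e1 : y + d • e - (z - s • e) = y - (x - s • e) := by rw [hzx]; abel
      rw [e1]; exact hy)
  have hyx : ‖y - x‖ < 1 / 40 := by
    have e0 : y - x = (y - (x - s • e)) + -(s • e) := by abel
    rw [e0]; refine (norm_add_le _ _).trans_lt ?_
    have hs0 : 0 < s := by linarith
    rw [norm_neg, norm_te he hs0.le]; nlinarith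
  have hyC : y ∈ Cy e (85 / 100) := h.h1.near_Cy hx.1.le hxe hyx (by norm_num) (by norm_num)
  have hydC : y + d • e ∈ Cy e (85 / 100) := h.h1.near_Cy (x := z) (a := 80 / 100) (b := 1 / 8)
    (by rw [hzP]; exact hx.1.le) hz8 (r := 1 / 40) (by
      have e1 : y + d • e - z = y - x := by rw [hzx]; abel
      rw [e1]; exact hyx) (by norm_num) (by norm_num)
  have h2 := h.h2.vert hyC hd0 hydC
  rw [hzT.zero] at h1
  linarith [h.h1.su.nonneg x (h.h1.ball1 hx')]

lemma top_cmp (h : PS u1 u2 G1 G2 e ε τ K) {x z : EE n} {ℓ : ℝ} (hℓ : 0 < ℓ) (hz : z ∈ Cy e (85 / 100))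
    (hzT : GS.Top u1 e ε z) (hx : x ∈ Cy e (80 / 100)) (hd : ℓ / 4 ≤ ⟪e, x - z⟫)
    (hP : ‖Pe e (x - z)‖ ≤ 2 * K * ℓ) : (u2 x - u1 x) * (ℓ / 8) ^ pn n ≤
      CH n ^ 1024 * (u2 ((1 / 8 : ℝ) • e) - u1 ((1 / 8 : ℝ) • e)) := by
  have hK := h.h1.K1
  obtain ⟨z', hzP', hzC', hzT'⟩ := h.h1.top (x := x) (by linarith [hx.1])
  refine h.poly hx hzC' hzT' hzP' (by positivity) ?_
  by_contra hcon
  push Not at hcon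
  have h1 : ⟪e, z' - z⟫ = ⟪e, x - z⟫ - ⟪e, x - z'⟫ := by
    rw [← inner_sub_right]; congr 1; abel
  have h2 := h.h1.pos_above hz hzT hzC' (by linarith) (by
    rw [Pe_sub, hzP', ← Pe_sub]
    have : 100 * K * (ℓ / 8) ≤ 100 * K * ⟪e, z' - z⟫ := by gcongr; linarith
    have : 0 < K * ℓ := by positivity
    linarith)
  rw [hzT'.zero] at h2
  exact lt_irrefl _ h2

lemma v_le (h : PS u1 u2 G1 G2 e ε τ K) {x : EE n} (hx : x ∈ ball (0 : EE n) 1) :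
    u2 x - u1 x ≤ 2 * ε := by
  have g1 := (h.h1.fl x hx).1
  have g2 := (h.h2.fl x hx).2
  have := le_max_left (⟪e, x⟫ - ε) 0
  have := le_max_right (⟪e, x⟫ - ε) 0
  have := h.h1.hε
  have : max (⟪e, x⟫ + ε) 0 ≤ max (⟪e, x⟫ - ε) 0 + 2 * ε := max_le (by linarith) (by linarith)
  linarith

set_option maxHeartbeats 1000000 in
/-- the comparison (strip) step -/
lemma caseC (h : PS u1 u2 G1 G2 e ε τ K) (hK3 : 3 * n ≤ K) {x z : EE n} {ℓ S S1 : ℝ} (hℓ : 0 < ℓ) (hℓ1 : ℓ ≤ 1 / 60)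
    (hx : ‖Pe e x‖ + 2 * K * ℓ < 70 / 100) (hzP : Pe e z = Pe e x) (hzT : GS.Top u1 e ε z)
    (hzx : ⟪e, z⟫ ≤ ⟪e, x⟫) (hxz : ⟪e, x - z⟫ < ℓ / 4) 
    (hS0 : 0 < S) (hSε : S ≤ 2 * ε) (hSℓ : 64000 * n * S ≤ ℓ) (hS1 : 0 ≤ S1) (hS1S : S1 < S)
    (hvS : ∀ w ∈ closure {x | 0 < u1 x}, ‖Pe e (w - x)‖ ≤ 2 * K * ℓ → |⟪e, w⟫| ≤ 1 / 8 → u2 w - u1 w ≤ S)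
    (hvS1 : ∀ w, ‖Pe e (w - x)‖ ≤ 2 * K * ℓ → |⟪e, w⟫| ≤ 1 / 8 → ℓ / 4 ≤ ⟪e, w - z⟫ → u2 w - u1 w ≤ S1) :
    u2 x - u1 x ≤ CL n * (9 * n * S / K ^ 2 + 2 * S1) := by
  have he := h.h1.he
  have hn := h.h1.n1
  have hK1 := h.h1.K1
  have hτ := h.h1.hτ
  have hε0 := h.h1.hε
  have hτs := h.h1.tau_small
  have hεs : ε ≤ 1 / 7680 := by nlinarith [h.h1.eps_n]
  have hτ1 : τ ≤ 1 / 180000 := by nlinarith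
  have hz2 := abs_le.1 hzT.small
  have hPxz : Pe e (x - z) = 0 := by rw [Pe_sub, hzP, sub_self]
  have hKℓ : 0 < K * ℓ := by positivity
  have hKℓ1 : 1 * ℓ ≤ K * ℓ := by gcongr
  have hzC : z ∈ Cy e (85 / 100) := ⟨by rw [hzP]; linarith, by linarith [hzT.small]⟩
  set s := 1000 * n * S with hs
  have hnS : 1 * S ≤ n * S := by gcongr
  have hs0 : 0 < s := by positivity
  have hsℓ : 64 * s ≤ ℓ := by linarith
  have hSs : S * 1000 ≤ s := by linarith
  have hsT : s ≤ T0 n τ := by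
    have q1 := h.h1.eps_T0
    have q2 := T0_pos h.h1.hn hτ
    have q3 : s ≤ 2000 * (n * ε) := by
      have : n * S ≤ n * (2 * ε) := by gcongr
      linarith
    have q4 : (180000 * n) * (8 * ε) ≤ (180000 * n) * (T0 n τ * τ) := by gcongr
    have q5 : T0 n τ * (τ * (180000 * n)) ≤ T0 n τ * 1 := by gcongr
    have q6 : 0 ≤ n * ε := by positivity
    linarith
  set A := 2 * (S - S1) / s with hA
  have hsA : s * A = 2 * (S - S1) := by rw [hA]; field_simp
  have hA0 : 0 < A := by rw [hA]; apply div_pos <;> linarith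
  have hAn : A * (500 * n) ≤ 1 := by
    rw [hA, div_mul_eq_mul_div, div_le_one hs0, hs]
    nlinarith
  set β := 1 - (τ + 2 * S / s) with hβ
  have hsβ : s * β = s * (1 - τ) - 2 * S := by rw [hβ]; field_simp; ring
  have h2Ss : 2 * S / s ≤ 1 / 500 := by rw [div_le_iff₀ hs0]; linarith
  have h2Ss0 : 0 ≤ 2 * S / s := by positivity
  have hQ : ∀ w ∈ Qs e z ℓ K, ‖Pe e (w - x)‖ ≤ 2 * K * ℓ ∧ ‖Pe e w‖ < 70 / 100 ∧ |⟪e, w⟫| ≤ 1 / 16 := by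
    intro y hy
    have hy1 := (qf_le_iff he _ (by positivity)).1 hy.1
    have hy2 := abs_le.1 hy.2
    rw [inner_sub_right] at hy2
    have hy3 : ‖Pe e (y - x)‖ ≤ 2 * K * ℓ := by rw [Pe_sub, ← hzP, ← Pe_sub]; exact hy1
    refine ⟨hy3, ?_, by rw [abs_le]; constructor <;> linarith⟩
    rw [Pe_sub] at hy3
    have := norm_le_norm_add_norm_sub' (Pe e y) (Pe e x)
    linarith
  have hnear : ∀ x ∈ Qs e z ℓ K, ∀ w, ‖w - x‖ ≤ 8 * s → w ∈ Cy e (85 / 100) := fun x hx w hw =>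
    h.h1.near_Cy (hQ x hx).2.1.le (hQ x hx).2.2 (r := 1 / 100) (by linarith) (by norm_num) (by norm_num)
  have hQC : ∀ x ∈ Qs e z ℓ K, x ∈ Cy e (80 / 100) := fun x hx =>
    ⟨by linarith [(hQ x hx).2.1], by linarith [(hQ x hx).2.2]⟩
  have hSL : SLH u2 u1 G2 G1 e z ℓ K s s τ A β := by
    refine ⟨h.h1.hn, h.h2.su, h.h1.su, he, hℓ, hK3, hs0, by linarith, hA0, by nlinarith, by linarith,
      by linarith, hs0, by linarith, hτ.le, ?_, ?_, ?_, ?_, ?_⟩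
    · have := h.h1.hτ1
      have : 0 ≤ τ * K ^ 2 := by positivity
      linarith
    · intro w hw y hy
      rw [Metric.mem_closedBall, dist_eq_norm] at hy
      exact h.h1.ball1 (hnear w hw y hy)
    · intro w hw y hy
      rw [hsβ] at hy
      refine h.dom_all (hQC w hw) (by linarith [(hQ w hw).2.2]) hS0.le (by linarith) (by linarith) hsT ?_ hy
      intro w' hw' hw1 hw2
      refine hvS w' hw2 ?_ hw1
      rw [Pe_sub, hw', ← Pe_sub]; exact (hQ w hw).1
    · intro w hw hwt y hy
      have hsβA : s * (β + A) = s * (1 - τ) - 2 * S1 := by rw [mul_add, hsβ, hsA]; ring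
      rw [hsβA] at hy
      rcases le_abs.1 hwt with h3 | h3
      · exact h.dom_cl (hQC w hw) (by linarith [(hQ w hw).2.2]) hS1 (by linarith) (by linarith) hsT
          (hvS1 w (hQ w hw).1 (by linarith [(hQ w hw).2.2]) h3) hy
      · have e0 : y - w = (y - (w - s • e)) + -(s • e) := by abel
        have hsτ : s * (1 - τ) ≤ s := by nlinarith
        have hyw : ‖y - w‖ ≤ 3 * s := by
          rw [e0]; refine (norm_add_le _ _).trans ?_
          rw [norm_neg, norm_te he hs0.le]; linarith
        have hyC := hnear w hw y (by linarith)
        have hzc := h.h1.top_mem_closure hzT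
        have hvz := hvS z hzc (by rw [Pe_sub, hzP, sub_self, norm_zero]; positivity)
          (by linarith [hzT.small])
        rw [hzT.zero] at hvz
        have e1 : z - (2 * S) • e = z + (-(2 * S)) • e := by rw [neg_smul]; abel
        have hzC2 : z - (2 * S) • e ∈ Cy e (85 / 100) := by
          rw [e1]; exact h.h2.vmem hzC.1 (by rw [abs_lt]; constructor <;> linarith)
        have hz0 : u2 (z - (2 * S) • e) = 0 := by
          have q := h.h2.line_dn (x := z) ⟨by rw [hzP]; linarith, hzC.2⟩ (T := 2 * S) (by linarith) (by linarith)
          rw [max_eq_right (by linarith)] at q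
          exact le_antisymm q (h.h2.su.nonneg _ (h.h2.ball1 hzC2))
        have hy0 : u2 y = 0 := by
          refine h.h2.zero_below hzC2 hz0 hyC ?_
          have e1 : z - (2 * S) • e - y = -((w - z) + (y - w)) - (2 * S) • e := by abel
          have q1 := (abs_le.1 (inner_e_le he (y - w))).2
          have q2 : ℓ / 8 ≤ ⟪e, z - (2 * S) • e - y⟫ := by
            rw [e1, inner_sub_right, inner_neg_right, inner_add_right, inner_e_self he]; linarith
          have q3 : ‖Pe e (z - (2 * S) • e - y)‖ ≤ 2 * K * ℓ + 3 * s := by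
            have e2 : Pe e (z - (2 * S) • e - y) = -(Pe e (w - x) + Pe e (y - w)) := by
              rw [Pe_sub, Pe_sub, Pe_self he, Pe_sub, Pe_sub, hzP]; abel
            rw [e2, norm_neg]
            refine (norm_add_le _ _).trans ?_
            linarith [(hQ w hw).1, Pe_le he (y - w)]
          have q4 : 200 * K * (ℓ / 8) ≤ 200 * K * ⟪e, z - (2 * S) • e - y⟫ := by gcongr
          linarith
        rw [hy0]; exact h.h1.su.nonneg w (h.h1.ball1 (Cy_mono (by norm_num) (hQC w hw)))
    · intro w hw w' hw' y hy
      rw [Metric.mem_closedBall, dist_eq_norm] at hw'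
      exact h.h2.mon hs0 hsT (hnear w hw w' hw') y hy
  have hxQ : x ∈ Qs e z ℓ K :=
    ⟨by rw [← Pe_sq he, hPxz, norm_zero, zero_pow two_ne_zero]; positivity, by
      rw [inner_sub_right] at hxz ⊢; rw [abs_le]; constructor <;> linarith⟩
  have hchi := chi_center (ℓ := ℓ) (K := K) he hPxz
  have hchi1 : chi e z ℓ K x ≤ 1 := chi_le_one he hℓ (by linarith) hxQ.2
  set X := chi e z ℓ K x with hX
  have hX0 : 0 ≤ X := by
    have : 4 * (n:ℝ) / K ^ 2 ≤ 1 := by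
      rw [div_le_one (by positivity)]; nlinarith
    linarith
  set m := s * τ + 2 * S * (1 - X) + 2 * S1 * X with hm
  have hm0 : 0 ≤ m := by
    have : 0 ≤ 1 - X := by linarith
    positivity
  have hsm : s * (β + A * X) = s - m := by
    rw [mul_add, hsβ, ← mul_assoc, hsA, hm]; ring
  have hsm0 : 0 ≤ s - m := by
    rw [← hsm]
    have : 0 ≤ β := by linarith
    positivity
  have hfin := hSL.strip hxQ (y1 := x - m • e) (by
    have e1 : x - m • e - (x - s • e) = (s - m) • e := by rw [sub_smul]; abel
    rw [e1, norm_te he hsm0, ← hX, hsm])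
  have e1 : x - m • e = x + (-m) • e := by rw [neg_smul]; abel
  have hxi : |⟪e, x⟫| ≤ 1 / 16 := (hQ x hxQ).2.2
  have hxi2 := abs_le.1 hxi
  have hhi := h.h2.line_hi (x := x - m • e) (T := m) (by
    rw [e1]; exact h.h2.vmem (by linarith [(hQ x hxQ).2.1]) (by rw [abs_lt]; constructor <;> linarith)) hm0 (by
    rw [inner_sub_right, inner_e_self he]; linarith)
  rw [sub_add_cancel] at hhi
  have hCL := CL_ge (n := n)
  have hmb : m ≤ 9 * n * S / K ^ 2 + 2 * S1 := by
    have q1 : s * τ ≤ n * S / K ^ 2 := by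
      rw [le_div_iff₀ (by positivity), hs]
      have := h.h1.hτ1
      have q : n * S * (τ * (180000 * K ^ 2)) ≤ n * S * 1 := by gcongr
      have q' : 0 ≤ n * S * (τ * K ^ 2) := by positivity
      linarith
    have q2 : 2 * S * (1 - X) ≤ 2 * S * (4 * n / K ^ 2) := by gcongr
    have q3 : 2 * S1 * X ≤ 2 * S1 * 1 := by gcongr
    have q4 : 2 * S * (4 * n / K ^ 2) = 8 * n * S / K ^ 2 := by ring
    have q5 : 9 * n * S / K ^ 2 = 8 * n * S / K ^ 2 + n * S / K ^ 2 := by ring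
    linarith
  have : CL n * m ≤ CL n * (9 * n * S / K ^ 2 + 2 * S1) := by gcongr
  linarith

end PS
end upper

open MeasureTheory Metric Set Filter ENNReal NNReal
open scoped Topology ContDiff RealInnerProductSpace

section upper
variable {n : ℕ}
namespace PS
variable {u1 u2 : EE n → ℝ} {G1 G2 : EE n → EE n} {e : EE n} {ε τ K : ℝ}

noncomputable def eta (n : ℕ) : ℝ := 1 / (2 * 2 ^ pn n) / (64000 * n) / (2 * CL n)

noncomputable def CB (n : ℕ) (K : ℝ) : ℝ := 2 * CL n * (32 * K) ^ pn n + 2 * (4 * K / eta n) ^ pn n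

set_option maxHeartbeats 1000000 in
lemma upper_step (h : PS u1 u2 G1 G2 e ε τ K) (hK3 : 3 * n ≤ K) (hK9 : 900 ≤ K)
    (hKθ : 9 * n * CL n ≤ 1 / (2 * 2 ^ pn n) * K ^ 2) {x : EE n} (hx : x ∈ Cy e (70 / 100))
    (hc : x ∈ closure {x | 0 < u1 x}) {S : ℝ} (hS2 : S ≤ 2 * ε)
    (hS : ∀ x' ∈ Cy e (70 / 100) ∩ closure {x | 0 < u1 x}, ‖Pe e (x' - x)‖ ≤ (70 / 100 - ‖Pe e x‖) / 2 →
      u2 x' - u1 x' ≤ S) :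
    (u2 x - u1 x) * (70 / 100 - ‖Pe e x‖) ^ pn n ≤
      CB n K * (CH n ^ 1024 * (u2 ((1 / 8 : ℝ) • e) - u1 ((1 / 8 : ℝ) • e))) +
      1 / (2 * 2 ^ pn n) * S * (70 / 100 - ‖Pe e x‖) ^ pn n := by
  have hn := h.h1.n1
  have hCL := CL_ge (n := n)
  have hCH := CH_ge (n := n)
  have hε64 := h.h1.eps64
  have hv := h.vbar_nonneg
  have hvC : 0 ≤ CH n ^ 1024 * (u2 ((1 / 8 : ℝ) • e) - u1 ((1 / 8 : ℝ) • e)) := by positivity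
  have hfix := h.fix32 (x := x) (Cy_norm h.h1.he (by norm_num) hx)
  have hpoly : ∀ {x z : EE n}, _ → _ → _ → _ → ∀ {d : ℝ}, _ → _ → _ := @h.poly
  have htop : ∀ {x z : EE n} {ℓ : ℝ}, _ → _ → _ → _ → _ → _ → _ := @h.top_cmp
  generalize hW : CH n ^ 1024 * (u2 ((1 / 8 : ℝ) • e) - u1 ((1 / 8 : ℝ) • e)) = W at *
  set p := pn n with hp
  set θ : ℝ := 1 / (2 * 2 ^ p) with hθ
  have hθ0 : 0 < θ := by positivity
  have hθ1 : θ ≤ 1 := by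
    rw [hθ, div_le_one (by positivity)]
    have : (1:ℝ) ≤ 2 ^ p := one_le_pow₀ (by norm_num)
    linarith
  set ρ := 70 / 100 - ‖Pe e x‖ with hρ
  have hρ0 : 0 < ρ := by have := hx.1; linarith
  have hρ1 : ρ ≤ 70 / 100 := by have := norm_nonneg (Pe e x); linarith
  have hρp : 0 < ρ ^ p := by positivity
  have hη : eta n = θ / (64000 * n) / (2 * CL n) := rfl
  have hη0 : 0 < eta n := by rw [hη]; positivity
  have hη1 : 2 * CL n * eta n * (64000 * n) = θ := by rw [hη]; field_simp
  have hηs : eta n ≤ 1 := by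
    have h0 : 0 ≤ eta n * (CL n * n - 50) :=
      mul_nonneg hη0.le (by nlinarith)
    nlinarith
  have hCB : CB n K = 2 * CL n * (32 * K) ^ p + 2 * (4 * K / eta n) ^ p := rfl
  generalize eta n = η at *
  have hK0 : 0 < K := by linarith
  have hCB1 : 2 * CL n * (32 * K) ^ p ≤ CB n K := by
    rw [hCB]; have : 0 ≤ 2 * (4 * K / η) ^ p := by positivity
    linarith
  have hq1 : 1 ≤ (32 * K) ^ p := one_le_pow₀ (by linarith)
  have hbig : (32 * K) ^ p * W ≤ CB n K * W := by
    refine mul_le_mul_of_nonneg_right (le_trans ?_ hCB1) hvC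
    nlinarith
  have hv0 : 0 ≤ u2 x - u1 x := by
    linarith [h.le x (h.h1.ball1 (Cy_mono (by norm_num) hx))]
  have hself : u2 x - u1 x ≤ S := hS x ⟨hx, hc⟩ (by rw [sub_self]; simp [Pe]; positivity)
  have hS0 : 0 ≤ S := hv0.trans hself
  have hθS : 0 ≤ θ * S * ρ ^ p := by positivity
  rcases le_or_gt (1 / 32 : ℝ) ⟪e, x⟫ with h1 | h1
  · have h2 : (u2 x - u1 x) * ρ ^ p ≤ W * 1 := by
      refine mul_le_mul (hfix h1) (pow_le_one₀ hρ0.le (by linarith)) hρp.le hvC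
    have h3 : 1 * W ≤ (32 * K) ^ p * W := mul_le_mul_of_nonneg_right hq1 hvC
    linarith
  obtain ⟨z, hzP, hzC, hzT, hzx⟩ := h.h1.clos_above (Cy_mono (by norm_num) hx) hc
  have hz2 := abs_le.1 hzT.small
  have hx2 := abs_lt.1 hx.2
  set ℓ := ρ / (4 * K) with hℓd
  have hℓ : 0 < ℓ := by positivity
  have hKℓ : 2 * K * ℓ = ρ / 2 := by rw [hℓd]; field_simp; norm_num
  have hℓ1 : ℓ ≤ 1 / 60 := by
    rw [hℓd, div_le_div_iff₀ (by positivity) (by norm_num)]; linarith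
  have hρℓ : ρ ^ p = (32 * K) ^ p * (ℓ / 8) ^ p := by
    rw [← mul_pow]; congr 1; rw [hℓd]; field_simp; norm_num
  have exz : ⟪e, x - z⟫ = ⟪e, x⟫ - ⟪e, z⟫ := inner_sub_right _ _ _
  have hCBW : CB n K * W = 2 * CL n * (32 * K) ^ p * W + 2 * (4 * K / η) ^ p * W := by rw [hCB]; ring
  have hx80 : x ∈ Cy e (80 / 100) := Cy_mono (by norm_num) hx
  rcases le_or_gt (ℓ / 4) ⟪e, x - z⟫ with h2 | h2
  · have h3 := hpoly hx80 hzC hzT hzP (d := ℓ / 8) (by positivity) (by linarith)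
    have h4 : (32 * K) ^ p * ((u2 x - u1 x) * (ℓ / 8) ^ p) ≤ (32 * K) ^ p * W :=
      mul_le_mul_of_nonneg_left h3 (by positivity)
    rw [hρℓ] at hθS ⊢
    linarith
  rcases le_or_gt (u2 x - u1 x) (θ * S) with h3 | h3
  · have h4 : (u2 x - u1 x) * ρ ^ p ≤ θ * S * ρ ^ p := by gcongr
    have : 0 ≤ (32 * K) ^ p * W := by positivity
    linarith
  have hSp : 0 < S := by nlinarith
  rcases le_or_gt (64000 * n * S) ℓ with h4 | h4
  · -- main case
    set S1 := (32 * K) ^ p * W / ρ ^ p with hS1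
    have hS10 : 0 ≤ S1 := by positivity
    have hS1ρ : S1 * ρ ^ p = (32 * K) ^ p * W := by rw [hS1]; field_simp
    rcases le_or_gt S S1 with h5 | h5
    · have : (u2 x - u1 x) * ρ ^ p ≤ S1 * ρ ^ p := by gcongr; linarith
      linarith
    have hin : ∀ w, ‖Pe e (w - x)‖ ≤ 2 * K * ℓ → |⟪e, w⟫| ≤ 1 / 8 → w ∈ Cy e (70 / 100) := by
      intro w hw1 hw2
      refine ⟨?_, lt_of_le_of_lt hw2 (by norm_num)⟩
      have e1 : Pe e w = Pe e x + Pe e (w - x) := by rw [Pe_sub]; abel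
      rw [e1]
      refine (norm_add_le _ _).trans_lt ?_
      linarith
    have key := h.caseC hK3 hℓ hℓ1 (by linarith) hzP hzT hzx h2 hSp hS2 h4 hS10 h5
      (fun w hwc hw1 hw2 => hS w ⟨hin w hw1 hw2, hwc⟩ (by linarith))
      (fun w hw1 hw2 hw3 => by
        have g := htop hℓ hzC hzT (Cy_mono (by norm_num) (hin w hw1 hw2)) hw3 (by
          rw [Pe_sub, hzP, ← Pe_sub]; exact hw1)
        rw [hS1, le_div_iff₀ hρp, hρℓ]
        have : (32 * K) ^ p * ((u2 w - u1 w) * (ℓ / 8) ^ p) ≤ (32 * K) ^ p * W :=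
          mul_le_mul_of_nonneg_left g (by positivity)
        linarith)
    have h6 : CL n * (9 * n * S / K ^ 2) ≤ θ * S := by
      have : CL n * (9 * n * S / K ^ 2) = 9 * n * CL n * S / K ^ 2 := by ring
      rw [this, div_le_iff₀ (by positivity)]
      have := mul_le_mul_of_nonneg_right hKθ hS0
      linarith
    have h7 : u2 x - u1 x ≤ θ * S + 2 * CL n * S1 := by linarith
    have h8 : (u2 x - u1 x) * ρ ^ p ≤ (θ * S + 2 * CL n * S1) * ρ ^ p := by gcongr
    have h9 : (θ * S + 2 * CL n * S1) * ρ ^ p = θ * S * ρ ^ p + 2 * CL n * (S1 * ρ ^ p) := by ring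
    rw [hS1ρ] at h9
    have : 0 ≤ 2 * (4 * K / η) ^ p * W := by positivity
    linarith
  · -- large difference
    have h5 : 2 * CL n * (η * ℓ) ≤ u2 x - u1 x := by
      have g1 : θ * ℓ ≤ θ * (64000 * n * S) := by gcongr
      have g2 : 0 < 64000 * (n:ℝ) := by positivity
      have g3 : 2 * CL n * (η * ℓ) * (64000 * n) = θ * ℓ := by rw [← hη1]; ring
      have g4 : θ * S * (64000 * n) ≤ (u2 x - u1 x) * (64000 * n) := by gcongr
      exact le_of_mul_le_mul_right (by linarith) g2
    have hηℓ : 0 < η * ℓ := by positivity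
    have hηℓ1 : η * ℓ ≤ 1 * ℓ := by gcongr
    have hxl := h.h1.clos_low (Cy_mono (by norm_num) hx) hc
    have hm : ∀ R, 70 / 100 ≤ R → x + (η * ℓ) • e ∈ Cy e R := fun R hR =>
      h.h1.vmem (lt_of_lt_of_le hx.1 hR) (by rw [abs_lt]; constructor <;> linarith)
    have g1 := h.h1.line_hi (Cy_mono (by norm_num) hx) hηℓ.le (by linarith)
    have g2 := h.h2.vert (x := x) (t := η * ℓ) (Cy_mono (by norm_num) hx) hηℓ.le (hm _ (by norm_num))
    have g3 := hpoly (hm _ (by norm_num)) hzC hzT (by rw [hzP, Pe_add, Pe_self h.h1.he]; simp) (d := η * ℓ) hηℓ (by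
      rw [inner_sub_right, inner_add_right, inner_e_self h.h1.he]; linarith)
    have g4 : (u2 x - u1 x) ≤ 2 * (u2 (x + (η * ℓ) • e) - u1 (x + (η * ℓ) • e)) := by linarith
    have g5 : ρ ^ p = (4 * K / η) ^ p * (η * ℓ) ^ p := by
      rw [← mul_pow]; congr 1; rw [hℓd]; field_simp
    have g6 : (u2 x - u1 x) * ρ ^ p ≤ 2 * (u2 (x + (η * ℓ) • e) - u1 (x + (η * ℓ) • e)) * ρ ^ p := by gcongr
    have g7 : 2 * (4 * K / η) ^ p * ((u2 (x + (η * ℓ) • e) - u1 (x + (η * ℓ) • e)) * (η * ℓ) ^ p) ≤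
      2 * (4 * K / η) ^ p * W := mul_le_mul_of_nonneg_left g3 (by positivity)
    have : 0 ≤ 2 * CL n * (32 * K) ^ p * W := by positivity
    rw [hCBW]
    rw [g5] at g6 hθS ⊢
    linarith

lemma CB_pos (hn : 1 ≤ n) (hK : 0 < K) : 0 < CB n K := by
  have hCL := CL_ge (n := n)
  have hn' : (0:ℝ) < n := by exact_mod_cast hn
  have : 0 < eta n := by unfold eta; positivity
  unfold CB; positivity

lemma upper (h : PS u1 u2 G1 G2 e ε τ K) (hK3 : 3 * n ≤ K) (hK9 : 900 ≤ K)
    (hKθ : 9 * n * CL n ≤ 1 / (2 * 2 ^ pn n) * K ^ 2) {x : EE n} (hx : x ∈ Cy e (60 / 100))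
    (hc : x ∈ closure {x | 0 < u1 x}) :
    u2 x - u1 x ≤ 2 * 10 ^ pn n * CB n K * (CH n ^ 1024 * (u2 ((1 / 8 : ℝ) • e) - u1 ((1 / 8 : ℝ) • e))) := by
  have hCH := CH_ge (n := n)
  have hv := h.vbar_nonneg
  have hvC : 0 ≤ CH n ^ 1024 * (u2 ((1 / 8 : ℝ) • e) - u1 ((1 / 8 : ℝ) • e)) := by positivity
  have hCB := CB_pos h.h1.hn (K := K) (by linarith)
  have hb : ∀ x ∈ Cy e (70 / 100) ∩ closure {x | 0 < u1 x}, x ∈ ball (0 : EE n) 1 := fun x hx =>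
    h.h1.ball1 (Cy_mono (by norm_num) hx.1)
  have key := growth (D := Cy e (70 / 100) ∩ closure {x | 0 < u1 x}) (f := fun x => u2 x - u1 x)
    (ρ := fun x => 70 / 100 - ‖Pe e x‖) (e := e) (p := pn n)
    (B := CB n K * (CH n ^ 1024 * (u2 ((1 / 8 : ℝ) • e) - u1 ((1 / 8 : ℝ) • e))))
    (θ := 1 / (2 * 2 ^ pn n)) (M0 := 2 * ε) (R0 := 70 / 100) (fun _ => rfl)
    (fun x hx => by have := hx.1.1; linarith)
    (fun x hx => by linarith [h.le x (hb x hx)]) (fun x hx => h.v_le (hb x hx)) (by positivity) (by positivity)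
    (le_of_eq (by field_simp)) (fun x hx S hS => by
      have g := h.upper_step hK3 hK9 hKθ hx.1 hx.2 (S := min S (2 * ε)) (min_le_right _ _)
        (fun x' hx' hP => le_min (hS x' hx' hP) (h.v_le (hb x' hx')))
      refine g.trans ?_
      have : 0 < 70 / 100 - ‖Pe e x‖ := by have := hx.1.1; linarith
      gcongr
      exact min_le_left _ _) x ⟨Cy_mono (by norm_num) hx, hc⟩
  have h1 := hx.1
  have h0 : 0 ≤ u2 x - u1 x := by linarith [h.le x (h.h1.ball1 (Cy_mono (by norm_num) hx))]
  have h2 : (u2 x - u1 x) * (1 / 10) ^ pn n ≤ (u2 x - u1 x) * (70 / 100 - ‖Pe e x‖) ^ pn n := by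
    gcongr; linarith
  have h3 : (10:ℝ) ^ pn n * (1 / 10) ^ pn n = 1 := by rw [← mul_pow]; norm_num
  have h4 := mul_le_mul_of_nonneg_left (h2.trans key) (by positivity : (0:ℝ) ≤ 10 ^ pn n)
  calc u2 x - u1 x = 10 ^ pn n * ((u2 x - u1 x) * (1 / 10) ^ pn n) := by
        rw [mul_left_comm, h3, mul_one]
    _ ≤ _ := h4
    _ = _ := by ring
end PS
end upper

open MeasureTheory Metric Set Filter ENNReal NNReal
open scoped Topology ContDiff RealInnerProductSpace

section final
variable {n : ℕ}
namespace PS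
variable {u1 u2 : EE n → ℝ} {G1 G2 : EE n → EE n} {e : EE n} {ε τ K : ℝ}

lemma both (h : PS u1 u2 G1 G2 e ε τ K) (hK3 : 3 * n ≤ K) (hK9 : 900 ≤ K)
    (hKθ : 9 * n * CL n ≤ 1 / (2 * 2 ^ pn n) * K ^ 2) {x : EE n} (hx : x ∈ ball (0 : EE n) (1 / 2))
    (hc : x ∈ closure {x | 0 < u1 x}) :
    u2 x - u1 x ≤ ((2 * 10 ^ pn n * CB n K + 1) * CH n ^ 1024) * (u2 ((1 / 8 : ℝ) • e) - u1 ((1 / 8 : ℝ) • e)) ∧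
    u2 ((1 / 8 : ℝ) • e) - u1 ((1 / 8 : ℝ) • e) ≤
      (1040 * n * CH n ^ (7680 * n) + CH n ^ 1024) * (u2 x - u1 x) := by
  have hCH := CH_ge (n := n)
  have hv := h.vbar_nonneg
  have hCB := CB_pos h.h1.hn (K := K) (by linarith)
  have hε := h.h1.eps64
  rw [mem_ball_zero_iff] at hx
  have hxb : x ∈ ball (0 : EE n) 1 := by rw [mem_ball_zero_iff]; linarith
  have h0 : 0 ≤ u2 x - u1 x := by linarith [h.le x hxb]
  have hvC : 0 ≤ CH n ^ 1024 * (u2 ((1 / 8 : ℝ) • e) - u1 ((1 / 8 : ℝ) • e)) := by positivity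
  rcases lt_or_ge |⟪e, x⟫| (1 / 4) with h1 | h1
  · have hC : x ∈ Cy e (60 / 100) := ⟨by linarith [Pe_le h.h1.he x], h1⟩
    constructor
    · have := h.upper hK3 hK9 hKθ hC hc
      linarith
    · have := h.lower hC hc
      have : 0 ≤ CH n ^ 1024 * (u2 x - u1 x) := by positivity
      linarith
  have h2 : 1 / 4 ≤ ⟪e, x⟫ := by
    rcases le_abs.1 h1 with h2 | h2
    · exact h2
    exfalso
    obtain ⟨y, hy, hyx⟩ := Metric.mem_closure_iff.1 hc (1 / 8) (by norm_num)
    have hy' : 0 < u1 y := hy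
    rw [dist_eq_norm] at hyx
    have g1 : ‖y‖ < 1 := by
      have := norm_sub_norm_le y x
      rw [norm_sub_rev] at this
      linarith
    have g2 := (h.h1.fl y (by rwa [mem_ball_zero_iff])).2
    have g3 := (abs_le.1 (inner_e_le h.h1.he (x - y))).1
    rw [inner_sub_right] at g3
    rw [max_eq_right (by linarith)] at g2
    linarith
  constructor
  · have := h.fix32 (x := x) (by linarith) (by linarith)
    have : 0 ≤ 2 * 10 ^ pn n * CB n K * (CH n ^ 1024 * (u2 ((1 / 8 : ℝ) • e) - u1 ((1 / 8 : ℝ) • e))) := by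
      positivity
    linarith
  · have := h.fixed (y := x) h.xbar_norm (by linarith) (r := 1 / 64) (by norm_num) (by norm_num)
      (by rw [inner_e_self h.h1.he]; linarith) (by linarith) (m := 1024) (by norm_num)
    have : 0 ≤ 1040 * n * CH n ^ (7680 * n) * (u2 x - u1 x) := by positivity
    linarith
end PS
end final

theorem stmt17 (n : ℕ) (hn : 2 ≤ n) :
    ∃ ε₁ ∈ Set.Ioo (0 : ℝ) 1, ∃ C : ℝ, 0 < C ∧
      ∀ u₁ u₂ : EuclideanSpace ℝ (Fin n) → ℝ,
        OnePhaseSolution u₁ → OnePhaseSolution u₂ →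
        (∀ x ∈ Metric.ball (0 : EuclideanSpace ℝ (Fin n)) 1,
          max (x ⟨n - 1, by omega⟩ - ε₁) 0 ≤ u₁ x ∧ u₁ x ≤ u₂ x ∧
            u₂ x ≤ max (x ⟨n - 1, by omega⟩ + ε₁) 0) →
        ∀ x ∈ Metric.ball (0 : EuclideanSpace ℝ (Fin n)) (1 / 2) ∩ closure {y | 0 < u₁ y},
          ∀ y ∈ Metric.ball (0 : EuclideanSpace ℝ (Fin n)) (1 / 2) ∩ closure {y | 0 < u₁ y},
            u₂ x - u₁ x ≤ C * (u₂ y - u₁ y) := by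
  have hn1 : 1 ≤ n := by omega
  have hnR : (1:ℝ) ≤ n := by exact_mod_cast hn1
  have hCL := CL_ge (n := n)
  have hCG := CG_ge (n := n)
  have hCH := CH_ge (n := n)
  have h2p : (1:ℝ) ≤ 2 ^ pn n := one_le_pow₀ (by norm_num)
  set K : ℝ := 18 * n * CL n * 2 ^ pn n with hK
  have hnC : (50:ℝ) * n ≤ n * CL n := by nlinarith
  have hK' : 900 * (n:ℝ) ≤ K := by
    have : 18 * n * CL n * 1 ≤ K := by rw [hK]; gcongr
    linarith
  have hK3 : 3 * (n:ℝ) ≤ K := by linarith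
  have hK9 : 900 ≤ K := by linarith
  have hK0 : 0 < K := by linarith
  have hKθ : 9 * n * CL n ≤ 1 / (2 * 2 ^ pn n) * K ^ 2 := by
    have h1 : 9 * n * CL n = 1 / (2 * 2 ^ pn n) * K := by rw [hK]; field_simp; norm_num
    rw [h1]
    gcongr
    nlinarith
  set τ : ℝ := 1 / (180000 * K ^ 2) with hτ
  have hτ0 : 0 < τ := by positivity
  have hτ1 : τ * (180000 * K ^ 2) ≤ 1 := le_of_eq (by rw [hτ]; field_simp)
  set ε : ℝ := min (eps0 n τ) (1 / (7680 * n * CG n)) with hε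
  have hε0 : 0 < ε := lt_min (eps0_pos hn1 hτ0) (by positivity)
  have hε2 : ε * (7680 * n * CG n) ≤ 1 := by
    rw [← le_div_iff₀ (by positivity)]; exact min_le_right _ _
  have hε1 : ε < 1 := by
    have : (7680:ℝ) * 1 * 1 ≤ 7680 * n * CG n := by gcongr
    have : ε * (7680 * 1 * 1) ≤ ε * (7680 * n * CG n) := by gcongr
    linarith
  have hCB := PS.CB_pos hn1 (K := K) hK0
  refine ⟨ε, ⟨hε0, hε1⟩, ((2 * 10 ^ pn n * PS.CB n K + 1) * CH n ^ 1024) *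
    (1040 * n * CH n ^ (7680 * n) + CH n ^ 1024), by positivity, ?_⟩
  intro u₁ u₂ hu₁ hu₂ hfl x hx y hy
  obtain ⟨G1, hG1⟩ := hu₁.sol
  obtain ⟨G2, hG2⟩ := hu₂.sol
  set e : EE n := EuclideanSpace.single ⟨n - 1, by omega⟩ 1 with he
  have hee : ‖e‖ = 1 := by rw [he]; simp
  have hie : ∀ x : EE n, ⟪e, x⟫ = x ⟨n - 1, by omega⟩ := fun x => by
    rw [he, EuclideanSpace.inner_single_left]; simp
  have f1 : Flat e ε u₁ := fun x hx => by
    have g := hfl x hx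
    rw [hie]; exact ⟨g.1, g.2.1.trans g.2.2⟩
  have f2 : Flat e ε u₂ := fun x hx => by
    have g := hfl x hx
    rw [hie]; exact ⟨g.1.trans g.2.1, g.2.2⟩
  have h : PS u₁ u₂ G1 G2 e ε τ K :=
    ⟨⟨hn1, hG1, hee, f1, hε0.le, min_le_left _ _, hε2, hτ0, by linarith, hτ1⟩,
     ⟨hn1, hG2, hee, f2, hε0.le, min_le_left _ _, hε2, hτ0, by linarith, hτ1⟩,
     fun x hx => (hfl x hx).2.1⟩
  have a := (h.both hK3 hK9 hKθ hx.1 hx.2).1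
  have b := (h.both hK3 hK9 hKθ hy.1 hy.2).2
  refine a.trans ?_
  refine (mul_le_mul_of_nonneg_left b
    (by positivity : 0 ≤ (2 * 10 ^ pn n * PS.CB n K + 1) * CH n ^ 1024)).trans (le_of_eq ?_)
  ring
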